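/- Infinite-time singularity (Theorem 1.3, reduced Calabi-symmetry form): There exist an integer n ≥ 3, a real a > 1, a smooth σ : [1,a] → ℝ with σ > 0 on (1,a) and σ(1) = σ(a) = 0, reals q > 0 and p, a smooth initial function f₀ : [1,a] → ℝ with f₀(1) = q, f₀(a) = p and supercritical phase ((n−1)·arctan(f₀(x)/x) + arctan(f₀'(x)) > (n−2)·π/2 for all x), a smooth solution f : [0,∞) × [1,a] → ℝ of ∂_t f = σ(x)·( (∂_xx f)/(1 + (∂_x f)²) + (n−1)·(x·∂_x f − f)/(x² + f²) ) with f(0,·) = f₀, and a continuous function f_∞ : [1,a] → ℝ which is smooth on (1,a] with f_∞(1) = q and lim_{x→1⁺} f_∞'(x) = +∞, such that f(t,·) converges uniformly to f_∞ as t → ∞. Consequently sup_{x∈(1,a]} ∂_x f(t,x) → ∞ as t → ∞, i.e. the flow becomes singular at infinite time at the boundary point x = 1 (corresponding to the exceptional divisor). -/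

import Mathlib

open Real Set Filter

/-- The right-hand side of the reduced line bundle mean curvature flow under Calabi symmetry. -/
noncomputable def flowRHS (n : ℕ) (a : ℝ) (σ : ℝ → ℝ) (f : ℝ → ℝ → ℝ) (t x : ℝ) : ℝ :=
  σ x * (derivWithin (derivWithin (f t) (Icc 1 a)) (Icc 1 a) x /
      (1 + (derivWithin (f t) (Icc 1 a) x) ^ 2) +
    ((n : ℝ) - 1) * (x * derivWithin (f t) (Icc 1 a) x - f t x) / (x ^ 2 + (f t x) ^ 2))

namespace LBMCF
open scoped Topology ContDiff

/-- The interval on which the flow is posed. -/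
abbrev J : Set ℝ := Icc 1 (101 / 100)

theorem uniqueDiffOn_J : UniqueDiffOn ℝ J := uniqueDiffOn_Icc (by norm_num)

theorem J_bounds {x : ℝ} (hx : x ∈ J) : 1 ≤ x ∧ x ≤ 101 / 100 ∧ 0 < x := by
  have h1 : (1 : ℝ) ≤ x := hx.1
  exact ⟨h1, hx.2, by linarith⟩

/-- Iterated derivative within `J`. -/
noncomputable abbrev D (k : ℕ) (u : ℝ → ℝ) (x : ℝ) : ℝ := iteratedDerivWithin k u J x

/-- Smoothness on `J`. -/
abbrev Sm (u : ℝ → ℝ) : Prop := ContDiffOn ℝ ∞ u J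

theorem Sm.hasDerivWithinAt {u : ℝ → ℝ} (hu : Sm u) (k : ℕ) {x : ℝ} (hx : x ∈ J) :
    HasDerivWithinAt (D k u) (D (k + 1) u x) J x := by
  have h := (hu.differentiableOn_iteratedDerivWithin (m := k)
    (by exact_mod_cast ENat.natCast_lt_top k)
    uniqueDiffOn_J) x hx
  have := h.hasDerivWithinAt
  unfold D
  rw [iteratedDerivWithin_succ]
  exact this

theorem Sm.continuousOn_D {u : ℝ → ℝ} (hu : Sm u) (k : ℕ) : ContinuousOn (D k u) J :=
  fun _ hx => (hu.hasDerivWithinAt k hx).continuousWithinAt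

theorem Sm.D {u : ℝ → ℝ} (hu : Sm u) (k : ℕ) : Sm (D k u) := by
  induction k with
  | zero => exact hu.congr fun x _ => by simp [LBMCF.D]
  | succ k ih =>
    have : Sm (derivWithin (LBMCF.D k u) J) := ih.derivWithin uniqueDiffOn_J (by simp)
    refine this.congr fun x _ => ?_
    unfold LBMCF.D
    rw [iteratedDerivWithin_succ]

theorem D_zero (u : ℝ → ℝ) (x : ℝ) : D 0 u x = u x := by simp [D]

theorem D_congr {u v : ℝ → ℝ} (h : EqOn u v J) (k : ℕ) {x : ℝ} (hx : x ∈ J) :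
    D k u x = D k v x := iteratedDerivWithin_congr h hx

theorem D_succ_eq {u u' : ℝ → ℝ} (h : ∀ x ∈ J, HasDerivWithinAt u (u' x) J x) (k : ℕ) {x : ℝ}
    (hx : x ∈ J) : D (k + 1) u x = D k u' x := by
  unfold D
  rw [iteratedDerivWithin_succ']
  exact iteratedDerivWithin_congr (fun y hy => (h y hy).derivWithin (uniqueDiffOn_J y hy)) hx

theorem D_eq_of_chain {u : ℕ → ℝ → ℝ}
    (h : ∀ k, ∀ x ∈ J, HasDerivWithinAt (u k) (u (k + 1) x) J x) (k j : ℕ) {x : ℝ}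
    (hx : x ∈ J) : D k (u j) x = u (j + k) x := by
  induction k generalizing j with
  | zero => simp [D]
  | succ k ih =>
    rw [D_succ_eq (h j) k hx, ih (j + 1)]
    congr 1
    omega

theorem D_D (k j : ℕ) {u : ℝ → ℝ} (hu : Sm u) {x : ℝ} (hx : x ∈ J) :
    D k (D j u) x = D (j + k) u x :=
  D_eq_of_chain (u := fun i => D i u) (fun i _ hy => hu.hasDerivWithinAt i hy) k j hx

theorem sm_of_chain {u : ℕ → ℝ → ℝ}
    (h : ∀ k, ∀ x ∈ J, HasDerivWithinAt (u k) (u (k + 1) x) J x) (j : ℕ) : Sm (u j) := by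
  have key : ∀ n : ℕ, ∀ j, ContDiffOn ℝ n (u j) J := by
    intro n
    induction n with
    | zero =>
      intro j
      exact contDiffOn_zero.2 fun x hx => (h j x hx).continuousWithinAt
    | succ n ih =>
      intro j
      push_cast
      rw [contDiffOn_succ_iff_derivWithin uniqueDiffOn_J]
      refine ⟨fun x hx => (h j x hx).differentiableWithinAt, by simp, ?_⟩
      exact (ih (j + 1)).congr fun x hx => (h j x hx).derivWithin (uniqueDiffOn_J x hx)
  exact contDiffOn_infty.2 fun n => key n j

theorem D_add {u v : ℝ → ℝ} (hu : Sm u) (hv : Sm v) (k : ℕ) {x : ℝ} (hx : x ∈ J) :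
    D k (fun y => u y + v y) x = D k u x + D k v x :=
  iteratedDerivWithin_fun_add hx uniqueDiffOn_J ((hu x hx).of_le (by exact_mod_cast le_top))
    ((hv x hx).of_le (by exact_mod_cast le_top))

theorem D_mul {u v : ℝ → ℝ} (hu : Sm u) (hv : Sm v) (k : ℕ) {x : ℝ} (hx : x ∈ J) :
    D k (fun y => u y * v y) x
      = ∑ i ∈ Finset.range (k + 1), (k.choose i : ℝ) * D i u x * D (k - i) v x :=
  iteratedDerivWithin_mul hx uniqueDiffOn_J ((hu x hx).of_le (by exact_mod_cast le_top))
    ((hv x hx).of_le (by exact_mod_cast le_top))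

/-- Smooth functions of three real variables. -/
abbrev Sm3 (G : ℝ × ℝ × ℝ → ℝ) : Prop := ContDiff ℝ ∞ G

/-- Evaluation of `G` along `(1/x, f, p)`. -/
noncomputable def cp (G : ℝ × ℝ × ℝ → ℝ) (f p : ℝ → ℝ) (x : ℝ) : ℝ := G (x⁻¹, f x, p x)

/-- The part of the total derivative not involving the derivative of `p`. -/
noncomputable def KG (G : ℝ × ℝ × ℝ → ℝ) (z : ℝ × ℝ × ℝ) : ℝ :=
  fderiv ℝ G z (-z.1 ^ 2, z.2.2, 0)

/-- Partial derivative in the last variable. -/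
noncomputable def GP (G : ℝ × ℝ × ℝ → ℝ) (z : ℝ × ℝ × ℝ) : ℝ := fderiv ℝ G z (0, 0, 1)

theorem Sm3.KG {G : ℝ × ℝ × ℝ → ℝ} (hG : Sm3 G) : Sm3 (KG G) := by
  have h : ContDiff ℝ ∞ (fderiv ℝ G) := hG.fderiv_right (by simp)
  unfold LBMCF.KG
  exact h.clm_apply (by fun_prop)

theorem Sm3.GP {G : ℝ × ℝ × ℝ → ℝ} (hG : Sm3 G) : Sm3 (GP G) := by
  have h : ContDiff ℝ ∞ (fderiv ℝ G) := hG.fderiv_right (by simp)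
  unfold LBMCF.GP
  exact h.clm_apply contDiff_const

theorem sm_inv : Sm (fun x : ℝ => x⁻¹) :=
  contDiffOn_id.inv fun _ hx => (J_bounds hx).2.2.ne'

theorem Sm3.cp {G : ℝ × ℝ × ℝ → ℝ} (hG : Sm3 G) {f p : ℝ → ℝ} (hf : Sm f) (hp : Sm p) :
    Sm (cp G f p) :=
  hG.comp_contDiffOn (sm_inv.prodMk (hf.prodMk hp))

theorem hasDerivWithinAt_cp {G : ℝ × ℝ × ℝ → ℝ} (hG : Sm3 G) {f p : ℝ → ℝ} {p' x : ℝ}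
    (hx : x ∈ J) (hf : HasDerivWithinAt f (p x) J x) (hp : HasDerivWithinAt p p' J x) :
    HasDerivWithinAt (cp G f p) (cp (KG G) f p x + cp (GP G) f p x * p') J x := by
  have hx0 := (J_bounds hx).2.2.ne'
  have h1 : HasDerivWithinAt (fun x : ℝ => x⁻¹) (-(x ^ 2)⁻¹) J x :=
    (hasDerivAt_inv hx0).hasDerivWithinAt
  have h2 := h1.prodMk (hf.prodMk hp)
  have hd : DifferentiableAt ℝ G (x⁻¹, f x, p x) := hG.differentiable (by simp) _
  have h3 := hd.hasFDerivAt.comp_hasDerivWithinAt x h2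
  refine h3.congr_deriv ?_
  unfold cp KG GP
  simp only
  rw [mul_comm, ← smul_eq_mul, ← map_smul, ← map_add]
  congr 1
  ext <;> simp

theorem D_cp_succ {G : ℝ × ℝ × ℝ → ℝ} (hG : Sm3 G) {f p : ℝ → ℝ} (hf : Sm f) (hp : Sm p)
    (hfp : ∀ x ∈ J, HasDerivWithinAt f (p x) J x) (k : ℕ) {x : ℝ} (hx : x ∈ J) :
    D (k + 1) (cp G f p) x = D k (cp (KG G) f p) x + ∑ l ∈ Finset.range (k + 1),
      (k.choose l : ℝ) * D l (cp (GP G) f p) x * D (k - l + 1) p x := by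
  have h1 : ∀ y ∈ J, HasDerivWithinAt p (D 1 p y) J y := fun y hy => by
    have := hp.hasDerivWithinAt 0 hy
    exact this.congr (fun z _ => (D_zero p z).symm) (D_zero p y).symm
  rw [D_succ_eq (fun y hy => hasDerivWithinAt_cp hG hy (hfp y hy) (h1 y hy)) k hx,
    D_add (hG.KG.cp hf hp) ((hG.GP.cp hf hp).mul (hp.D 1)) k hx,
    D_mul (hG.GP.cp hf hp) (hp.D 1) k hx]
  congr 1
  refine Finset.sum_congr rfl fun l _ => ?_
  rw [D_D _ _ hp hx, add_comm 1]

end LBMCF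

namespace LBMCF
open scoped Topology ContDiff

/-- Weighted size of the `l`-th derivative. -/
noncomputable def wt (s : ℝ) (p : ℝ → ℝ) (x : ℝ) (l : ℕ) : ℝ := s ^ l * |D l p x|

theorem wt_nonneg {s : ℝ} (hs : 0 ≤ s) (p : ℝ → ℝ) (x : ℝ) (l : ℕ) : 0 ≤ wt s p x l := by
  unfold wt; positivity

theorem exists_bound_three {G : ℝ × ℝ × ℝ → ℝ} (hG : Sm3 G) (M : ℝ) : ∃ C, 0 ≤ C ∧
    ∀ y f p : ℝ, 0 ≤ y → y ≤ 1 → |f| ≤ M → |p| ≤ M → |G (y, f, p)| ≤ C := by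
  obtain ⟨C, hC⟩ := ((isCompact_Icc (a := (0 : ℝ)) (b := 1)).prod
    ((isCompact_Icc (a := -M) (b := M)).prod (isCompact_Icc (a := -M) (b := M)))
    ).exists_bound_of_continuousOn (f := G) hG.continuous.continuousOn
  refine ⟨max C 0, le_max_right _ _, fun y f p h0 h1 hf hp => ?_⟩
  exact (hC (y, f, p) ⟨⟨h0, h1⟩, abs_le.1 hf, abs_le.1 hp⟩).trans (le_max_left _ _)

theorem inv_bounds {x : ℝ} (hx : x ∈ J) : 0 ≤ x⁻¹ ∧ x⁻¹ ≤ 1 := by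
  have := J_bounds hx
  exact ⟨by have := this.2.2; positivity, inv_le_one_of_one_le₀ this.1⟩

/-- Admissible data for the pointwise estimates of order `k`. -/
structure Adm (M : ℝ) (f p : ℝ → ℝ) (s x : ℝ) (k : ℕ) : Prop where
  sf : Sm f
  sp : Sm p
  der : ∀ x ∈ J, HasDerivWithinAt f (p x) J x
  hx : x ∈ J
  s0 : 0 ≤ s
  s1 : s ≤ 1
  bf : |f x| ≤ M
  bw : ∀ l < max 2 k, wt s p x l ≤ M

theorem Adm.mono {M : ℝ} {f p : ℝ → ℝ} {s x : ℝ} {k k' : ℕ} (h : Adm M f p s x k) (hk : k' ≤ k) :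
    Adm M f p s x k' :=
  { h with bw := fun l hl => h.bw l (lt_of_lt_of_le hl (max_le_max le_rfl hk)) }

theorem Adm.bp {M : ℝ} {f p : ℝ → ℝ} {s x : ℝ} {k : ℕ} (h : Adm M f p s x k) : |p x| ≤ M := by
  have := h.bw 0 (by simp)
  simpa [wt, D] using this

theorem exists_bound_prod (M C : ℝ) (hC : 0 ≤ C) (i l : ℕ) (hl : l ≤ i) : ∃ C', 0 ≤ C' ∧
    ∀ w : ℕ → ℝ, ∀ d : ℝ, (∀ l, 0 ≤ w l) → (∀ l < max 2 i, w l ≤ M) → 0 ≤ d →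
      d ≤ C * (1 + w (l - 1) + w l) → d * w (i + 1 - l) ≤ C' * (1 + w i + w (i + 1)) := by
  by_cases hM : 0 ≤ M
  swap
  · exact ⟨0, le_rfl, fun w d hw hM' => absurd ((hw 0).trans (hM' 0 (by simp))) hM⟩
  refine ⟨C * (1 + 2 * M) * (1 + M), by positivity, fun w d hw hb hd hdC => ?_⟩
  rcases Nat.eq_zero_or_pos l with rfl | hl0
  · have h0 := hb 0 (by simp)
    have hd2 : d ≤ C * (1 + 2 * M) := hdC.trans (by
      simp only [Nat.zero_sub]
      exact mul_le_mul_of_nonneg_left (by linarith) hC)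
    simp only [Nat.sub_zero]
    have hwi := hw i
    have hwi1 := hw (i + 1)
    calc d * w (i + 1) ≤ (C * (1 + 2 * M)) * w (i + 1) := by gcongr
      _ ≤ (C * (1 + 2 * M)) * ((1 + M) * (1 + w i + w (i + 1))) := by
        gcongr
        nlinarith [mul_nonneg hM hwi, mul_nonneg hM hwi1]
      _ = _ := by ring
  · rcases hl.lt_or_eq with hli | rfl
    · have h1 := hb (l - 1) (lt_max_of_lt_right (by omega))
      have h2 := hb l (lt_max_of_lt_right hli)
      have hd2 : d ≤ C * (1 + 2 * M) := hdC.trans (mul_le_mul_of_nonneg_left (by linarith) hC)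
      have h3 : w (i + 1 - l) ≤ (1 + M) * (1 + w i + w (i + 1)) := by
        have hwi := hw i
        have hwi1 := hw (i + 1)
        rcases (show i + 1 - l ≤ i by omega).lt_or_eq with h | h
        · have := hb _ (lt_max_of_lt_right h)
          nlinarith [mul_nonneg hM hwi, mul_nonneg hM hwi1]
        · rw [h]
          nlinarith [mul_nonneg hM hwi, mul_nonneg hM hwi1]
      calc d * w (i + 1 - l) ≤ (C * (1 + 2 * M)) * ((1 + M) * (1 + w i + w (i + 1))) :=
            mul_le_mul hd2 h3 (hw _) (by positivity)
        _ = _ := by ring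
    · have h1 := hb 1 (by simp)
      have h2 := hb (l - 1) (lt_max_of_lt_right (by omega))
      have e : l + 1 - l = 1 := by omega
      rw [e]
      have hwi := hw l
      have hwi1 := hw (l + 1)
      calc d * w 1 ≤ (C * (1 + w (l - 1) + w l)) * M := mul_le_mul hdC h1 (hw _)
            (mul_nonneg hC (by linarith [hw (l - 1)]))
        _ ≤ (C * (1 + M + w l)) * M := by gcongr
        _ ≤ _ := by
          have : (1 + M + w l) * M ≤ (1 + 2 * M) * (1 + M) * (1 + w l + w (l + 1)) := by
            nlinarith [mul_nonneg hM hwi, mul_nonneg hM hwi1, mul_nonneg hM (mul_nonneg hM hwi),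
              mul_nonneg hM (mul_nonneg hM hwi1), mul_nonneg hM hM]
          calc C * (1 + M + w l) * M = C * ((1 + M + w l) * M) := by ring
            _ ≤ C * ((1 + 2 * M) * (1 + M) * (1 + w l + w (l + 1))) := by gcongr
            _ = _ := by ring

theorem D_cp_bound (k : ℕ) : ∀ (G : ℝ × ℝ × ℝ → ℝ) (_ : Sm3 G) (M : ℝ), ∃ C, 0 ≤ C ∧
    ∀ f p s x, Adm M f p s x (k - 1) →
      s ^ k * |D k (cp G f p) x| ≤ C * (1 + wt s p x (k - 1) + wt s p x k) := by
  induction k using Nat.strong_induction_on with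
  | _ k ih =>
  intro G hG M
  rcases k with _ | i
  · obtain ⟨C, hC, h⟩ := exists_bound_three hG M
    refine ⟨C, hC, fun f p s x A => ?_⟩
    have := h x⁻¹ (f x) (p x) (inv_bounds A.hx).1 (inv_bounds A.hx).2 A.bf A.bp
    have w0 := wt_nonneg A.s0 p x 0
    simp only [pow_zero, one_mul, D_zero, Nat.zero_sub, cp]
    nlinarith [mul_nonneg hC w0]
  · obtain ⟨C0, hC0, h0⟩ := ih i (by omega) (KG G) hG.KG M
    have key : ∀ l : ℕ, ∃ C', 0 ≤ C' ∧ (l ≤ i → ∀ f p s x, Adm M f p s x i →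
        s ^ l * |D l (cp (GP G) f p) x| * wt s p x (i + 1 - l)
          ≤ C' * (1 + wt s p x i + wt s p x (i + 1))) := by
      intro l
      by_cases hl : l ≤ i
      · obtain ⟨C, hC, h⟩ := ih l (by omega) (GP G) hG.GP M
        obtain ⟨C', hC', h'⟩ := exists_bound_prod M C hC i l hl
        refine ⟨C', hC', fun _ f p s x A => h' (wt s p x) _ (wt_nonneg A.s0 p x) A.bw ?_ ?_⟩
        · have := A.s0; positivity
        · exact h f p s x (A.mono (by omega))
      · exact ⟨0, le_rfl, fun h => absurd h hl⟩
    choose C' hC' h' using key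
    refine ⟨C0 * (1 + M ⊔ 0) + ∑ l ∈ Finset.range (i + 1), (i.choose l : ℝ) * C' l, by
      have : 0 ≤ M ⊔ 0 := le_max_right _ _
      have : 0 ≤ ∑ l ∈ Finset.range (i + 1), (i.choose l : ℝ) * C' l :=
        Finset.sum_nonneg fun l _ => mul_nonneg (by positivity) (hC' l)
      positivity, fun f p s x A => ?_⟩
    simp only [Nat.add_sub_cancel] at A
    have w0 := wt_nonneg A.s0 p x
    have hs := A.s0
    rw [D_cp_succ hG A.sf A.sp A.der i A.hx]
    simp only [Nat.add_sub_cancel]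
    have e1 : s ^ (i + 1) * |D i (cp (KG G) f p) x|
        ≤ C0 * (1 + M ⊔ 0) * (1 + wt s p x i + wt s p x (i + 1)) := by
      have h1 := h0 f p s x (A.mono (by omega))
      have hw1 : wt s p x (i - 1) ≤ (M ⊔ 0) * (1 + wt s p x i + wt s p x (i + 1)) ∨ i = 0 := by
        by_cases hi : i = 0
        · exact Or.inr hi
        · left
          have := A.bw (i - 1) (lt_max_of_lt_right (by omega))
          have h2 : wt s p x (i - 1) ≤ M ⊔ 0 := this.trans (le_max_left _ _)
          have h3 : 0 ≤ M ⊔ 0 := le_max_right _ _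
          nlinarith [mul_nonneg h3 (w0 i), mul_nonneg h3 (w0 (i + 1))]
      have h4 : 1 + wt s p x (i - 1) + wt s p x i
          ≤ (1 + M ⊔ 0) * (1 + wt s p x i + wt s p x (i + 1)) := by
        rcases hw1 with h | rfl
        · nlinarith [w0 (i + 1)]
        · have := A.bw 0 (by simp)
          have h2 : wt s p x 0 ≤ M ⊔ 0 := this.trans (le_max_left _ _)
          have h3 : 0 ≤ M ⊔ 0 := le_max_right _ _
          simp only [Nat.zero_sub]
          nlinarith [mul_nonneg h3 (w0 0), mul_nonneg h3 (w0 (0 + 1)), w0 (0 + 1)]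
      calc s ^ (i + 1) * |D i (cp (KG G) f p) x|
          = s * (s ^ i * |D i (cp (KG G) f p) x|) := by ring
        _ ≤ 1 * (s ^ i * |D i (cp (KG G) f p) x|) := by
            gcongr
            exact A.s1
        _ ≤ C0 * (1 + wt s p x (i - 1) + wt s p x i) := by rw [one_mul]; exact h1
        _ ≤ C0 * ((1 + M ⊔ 0) * (1 + wt s p x i + wt s p x (i + 1))) := by gcongr
        _ = _ := by ring
    have e2 : s ^ (i + 1) * |∑ l ∈ Finset.range (i + 1),
        (i.choose l : ℝ) * D l (cp (GP G) f p) x * D (i - l + 1) p x|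
        ≤ (∑ l ∈ Finset.range (i + 1), (i.choose l : ℝ) * C' l)
          * (1 + wt s p x i + wt s p x (i + 1)) := by
      calc _ ≤ s ^ (i + 1) * ∑ l ∈ Finset.range (i + 1),
          |(i.choose l : ℝ) * D l (cp (GP G) f p) x * D (i - l + 1) p x| := by
            gcongr
            exact Finset.abs_sum_le_sum_abs _ _
        _ ≤ _ := by
          rw [Finset.mul_sum, Finset.sum_mul]
          refine Finset.sum_le_sum fun l hl => ?_
          have hli : l ≤ i := by simpa [Nat.lt_succ_iff] using hl
          have := h' l hli f p s x A
          have e : s ^ (i + 1) = s ^ l * s ^ (i - l + 1) := by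
            rw [← pow_add]; congr 1; omega
          have e' : i + 1 - l = i - l + 1 := by omega
          rw [abs_mul, abs_mul, Nat.abs_cast, e, mul_assoc (i.choose l : ℝ) (C' l)]
          rw [e'] at this
          unfold wt at this
          calc _ = (i.choose l : ℝ) * (s ^ l * |D l (cp (GP G) f p) x| *
                (s ^ (i - l + 1) * |D (i - l + 1) p x|)) := by ring
            _ ≤ _ := by
              unfold wt
              gcongr
    calc _ ≤ s ^ (i + 1) * (|D i (cp (KG G) f p) x| + |∑ l ∈ Finset.range (i + 1),
          (i.choose l : ℝ) * D l (cp (GP G) f p) x * D (i - l + 1) p x|) := by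
            gcongr
            exact abs_add_le _ _
      _ ≤ _ := by
        rw [mul_add, add_mul]
        exact add_le_add e1 e2

/-- The part of the `(j+1)`-st derivative of `cp G f p` of lower order in `p`. -/
noncomputable def rem (G : ℝ × ℝ × ℝ → ℝ) (f p : ℝ → ℝ) (j : ℕ) (x : ℝ) : ℝ :=
  D (j + 1) (cp G f p) x - cp (GP G) f p x * D (j + 1) p x

theorem exists_bound_prod' (M C : ℝ) (hC : 0 ≤ C) (j l : ℕ) (hl : l + 1 ≤ j) : ∃ C', 0 ≤ C' ∧
    ∀ w : ℕ → ℝ, ∀ d : ℝ, (∀ l, 0 ≤ w l) → (∀ l < max 2 (j - 1), w l ≤ M) → 0 ≤ d →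
      d ≤ C * (1 + w l + w (l + 1)) → d * w (j - l) ≤ C' * (1 + w j + w (j - 1) ^ 2) := by
  by_cases hM : 0 ≤ M
  swap
  · exact ⟨0, le_rfl, fun w d hw hM' => absurd ((hw 0).trans (hM' 0 (by simp))) hM⟩
  refine ⟨C * (4 * (1 + M) ^ 2), by positivity, fun w d hw hb hd hdC => ?_⟩
  have hwj := hw j
  have hwj1 := hw (j - 1)
  have hs : w (j - 1) ≤ 1 + w (j - 1) ^ 2 := by nlinarith [sq_nonneg (w (j - 1) - 1)]
  have hM2 : 0 ≤ M ^ 2 := by positivity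
  have hs2 := sq_nonneg (w (j - 1))
  rcases Nat.eq_zero_or_pos l with rfl | hl0
  · have h0 := hb 0 (by simp)
    have h1 := hb 1 (by simp)
    have hd2 : d ≤ C * (1 + 2 * M) :=
      hdC.trans (mul_le_mul_of_nonneg_left (by simp only [zero_add]; linarith) hC)
    simp only [Nat.sub_zero]
    calc d * w j ≤ (C * (1 + 2 * M)) * w j := by gcongr
      _ = C * ((1 + 2 * M) * w j) := by ring
      _ ≤ C * ((4 * (1 + M) ^ 2) * (1 + w j + w (j - 1) ^ 2)) := by
        gcongr <;> nlinarith
      _ = _ := by ring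
  · have hlow : ∀ i ≤ j - 1, w i ≤ M + w (j - 1) := by
      intro i hi
      rcases hi.lt_or_eq with h | rfl
      · have := hb i (lt_max_of_lt_right h)
        linarith
      · linarith
    rcases hl.lt_or_eq with hlj | rfl
    · have h1 := hlow l (by omega)
      have h2 := hlow (l + 1) (by omega)
      have h3 := hlow (j - l) (by omega)
      have hd2 : d ≤ C * (1 + 2 * (M + w (j - 1))) :=
        hdC.trans (mul_le_mul_of_nonneg_left (by linarith) hC)
      calc d * w (j - l) ≤ (C * (1 + 2 * (M + w (j - 1)))) * (M + w (j - 1)) :=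
            mul_le_mul hd2 h3 (hw _) (by positivity)
        _ = C * ((1 + 2 * (M + w (j - 1))) * (M + w (j - 1))) := by ring
        _ ≤ C * ((4 * (1 + M) ^ 2) * (1 + w j + w (j - 1) ^ 2)) := by
          refine mul_le_mul_of_nonneg_left ?_ hC
          have e1 : 0 ≤ M * w j := by positivity
          have e2 : 0 ≤ M ^ 2 * w j := by positivity
          have e3 : 0 ≤ M * w (j - 1) ^ 2 := by positivity
          have e4 : 0 ≤ M ^ 2 * w (j - 1) ^ 2 := by positivity
          have e5 : M * w (j - 1) ≤ M * (1 + w (j - 1) ^ 2) := by gcongr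
          nlinarith
        _ = _ := by ring
    · have h1 := hb 1 (by simp)
      have e : l + 1 - l = 1 := by omega
      simp only [Nat.add_sub_cancel] at *
      rw [e]
      calc d * w 1 ≤ (C * (1 + w l + w (l + 1))) * M := mul_le_mul hdC h1 (hw _) (by positivity)
        _ = C * ((1 + w l + w (l + 1)) * M) := by ring
        _ ≤ C * ((4 * (1 + M) ^ 2) * (1 + w (l + 1) + w l ^ 2)) := by
          refine mul_le_mul_of_nonneg_left ?_ hC
          have e1 : 0 ≤ M * w (l + 1) := by positivity
          have e2 : 0 ≤ M ^ 2 * w (l + 1) := by positivity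
          have e3 : 0 ≤ M * w l ^ 2 := by positivity
          have e4 : 0 ≤ M ^ 2 * w l ^ 2 := by positivity
          have e5 : M * w l ≤ M * (1 + w l ^ 2) := by gcongr
          nlinarith
        _ = _ := by ring

theorem rem_bound {G : ℝ × ℝ × ℝ → ℝ} (hG : Sm3 G) (M : ℝ) (j : ℕ) : ∃ C, 0 ≤ C ∧
    ∀ f p s x, Adm M f p s x (j - 1) →
      s ^ (j + 1) * |rem G f p j x| ≤ C * (1 + wt s p x j + wt s p x (j - 1) ^ 2) := by
  obtain ⟨C0, hC0, h0⟩ := D_cp_bound j (KG G) hG.KG M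
  have key : ∀ l : ℕ, ∃ C', 0 ≤ C' ∧ (l + 1 ≤ j → ∀ f p s x, Adm M f p s x (j - 1) →
      s ^ (l + 1) * |D (l + 1) (cp (GP G) f p) x| * wt s p x (j - l)
        ≤ C' * (1 + wt s p x j + wt s p x (j - 1) ^ 2)) := by
    intro l
    by_cases hl : l + 1 ≤ j
    · obtain ⟨C, hC, h⟩ := D_cp_bound (l + 1) (GP G) hG.GP M
      obtain ⟨C', hC', h'⟩ := exists_bound_prod' M C hC j l hl
      refine ⟨C', hC', fun _ f p s x A => h' (wt s p x) _ (wt_nonneg A.s0 p x) A.bw ?_ ?_⟩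
      · have := A.s0; positivity
      · exact h f p s x (A.mono (by omega))
    · exact ⟨0, le_rfl, fun h => absurd h hl⟩
  choose C' hC' h' using key
  refine ⟨C0 * 2 + ∑ l ∈ Finset.range j, (j.choose (l + 1) : ℝ) * C' l, by
    have : 0 ≤ ∑ l ∈ Finset.range j, (j.choose (l + 1) : ℝ) * C' l :=
      Finset.sum_nonneg fun l _ => mul_nonneg (by positivity) (hC' l)
    positivity, fun f p s x A => ?_⟩
  have w0 := wt_nonneg A.s0 p x
  have hs := A.s0
  have e0 : rem G f p j x = D j (cp (KG G) f p) x + ∑ l ∈ Finset.range j,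
      (j.choose (l + 1) : ℝ) * D (l + 1) (cp (GP G) f p) x * D (j - l) p x := by
    unfold rem
    rw [D_cp_succ hG A.sf A.sp A.der j A.hx, Finset.sum_range_succ']
    simp only [Nat.choose_zero_right, Nat.cast_one, one_mul, Nat.sub_zero, D_zero]
    rw [← add_assoc, add_sub_cancel_right]
    congr 1
    refine Finset.sum_congr rfl fun l hl => ?_
    have : l < j := Finset.mem_range.1 hl
    rw [show j - (l + 1) + 1 = j - l by omega]
  have e1 : s ^ (j + 1) * |D j (cp (KG G) f p) x|
      ≤ C0 * 2 * (1 + wt s p x j + wt s p x (j - 1) ^ 2) := by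
    have h1 := h0 f p s x A
    calc s ^ (j + 1) * |D j (cp (KG G) f p) x|
        = s * (s ^ j * |D j (cp (KG G) f p) x|) := by ring
      _ ≤ 1 * (s ^ j * |D j (cp (KG G) f p) x|) := by
          gcongr
          exact A.s1
      _ ≤ C0 * (1 + wt s p x (j - 1) + wt s p x j) := by rw [one_mul]; exact h1
      _ ≤ C0 * (2 * (1 + wt s p x j + wt s p x (j - 1) ^ 2)) := by
          gcongr
          nlinarith [sq_nonneg (wt s p x (j - 1) - 1), w0 j]
      _ = _ := by ring
  have e2 : s ^ (j + 1) * |∑ l ∈ Finset.range j,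
      (j.choose (l + 1) : ℝ) * D (l + 1) (cp (GP G) f p) x * D (j - l) p x|
      ≤ (∑ l ∈ Finset.range j, (j.choose (l + 1) : ℝ) * C' l)
        * (1 + wt s p x j + wt s p x (j - 1) ^ 2) := by
    calc _ ≤ s ^ (j + 1) * ∑ l ∈ Finset.range j,
        |(j.choose (l + 1) : ℝ) * D (l + 1) (cp (GP G) f p) x * D (j - l) p x| := by
          gcongr
          exact Finset.abs_sum_le_sum_abs _ _
      _ ≤ _ := by
        rw [Finset.mul_sum, Finset.sum_mul]
        refine Finset.sum_le_sum fun l hl => ?_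
        have hli : l + 1 ≤ j := Finset.mem_range.1 hl
        have := h' l hli f p s x A
        have e : s ^ (j + 1) = s ^ (l + 1) * s ^ (j - l) := by
          rw [← pow_add]; congr 1; omega
        rw [abs_mul, abs_mul, Nat.abs_cast, e, mul_assoc (j.choose (l + 1) : ℝ) (C' l)]
        unfold wt at this
        calc _ = (j.choose (l + 1) : ℝ) * (s ^ (l + 1) * |D (l + 1) (cp (GP G) f p) x| *
              (s ^ (j - l) * |D (j - l) p x|)) := by ring
          _ ≤ _ := by
            unfold wt
            gcongr
  rw [e0]
  calc _ ≤ s ^ (j + 1) * (|D j (cp (KG G) f p) x| + |∑ l ∈ Finset.range j,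
        (j.choose (l + 1) : ℝ) * D (l + 1) (cp (GP G) f p) x * D (j - l) p x|) := by
          gcongr
          exact abs_add_le _ _
    _ ≤ _ := by
      rw [mul_add, add_mul]
      exact add_le_add e1 e2

end LBMCF

namespace LBMCF
open scoped Topology ContDiff

/-- Integral over `J`. -/
noncomputable def I (g : ℝ → ℝ) : ℝ := ∫ x in (1 : ℝ)..(101 / 100), g x

theorem one_le_b : (1 : ℝ) ≤ 101 / 100 := by norm_num

theorem uIcc_J : uIcc (1 : ℝ) (101 / 100) = J := uIcc_of_le one_le_b

theorem ii {g : ℝ → ℝ} (hg : ContinuousOn g J) :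
    IntervalIntegrable g MeasureTheory.volume 1 (101 / 100) :=
  ContinuousOn.intervalIntegrable (by rwa [uIcc_J])

theorem I_mono {f g : ℝ → ℝ} (hf : ContinuousOn f J) (hg : ContinuousOn g J)
    (h : ∀ x ∈ J, f x ≤ g x) : I f ≤ I g :=
  intervalIntegral.integral_mono_on one_le_b (ii hf) (ii hg) h

theorem I_congr {f g : ℝ → ℝ} (h : ∀ x ∈ J, f x = g x) : I f = I g :=
  intervalIntegral.integral_congr (by rw [uIcc_J]; exact h)

theorem I_add {f g : ℝ → ℝ} (hf : ContinuousOn f J) (hg : ContinuousOn g J) :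
    I (fun x => f x + g x) = I f + I g := intervalIntegral.integral_add (ii hf) (ii hg)

theorem I_sub {f g : ℝ → ℝ} (hf : ContinuousOn f J) (hg : ContinuousOn g J) :
    I (fun x => f x - g x) = I f - I g := intervalIntegral.integral_sub (ii hf) (ii hg)

theorem I_smul (c : ℝ) (g : ℝ → ℝ) : I (fun x => c * g x) = c * I g :=
  intervalIntegral.integral_const_mul c g

theorem I_const (c : ℝ) : I (fun _ => c) = c / 100 := by
  simp [I]; ring

theorem I_nonneg {g : ℝ → ℝ} (h : ∀ x ∈ J, 0 ≤ g x) : 0 ≤ I g :=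
  intervalIntegral.integral_nonneg one_le_b h

theorem I_le_lin {f g h : ℝ → ℝ} (a b c : ℝ) (hf : ContinuousOn f J) (hg : ContinuousOn g J)
    (hh : ContinuousOn h J) (H : ∀ x ∈ J, f x ≤ a + b * g x + c * h x) :
    I f ≤ a / 100 + b * I g + c * I h := by
  have := I_mono (g := fun x => a + b * g x + c * h x) hf (by fun_prop) H
  rwa [I_add (by fun_prop) (by fun_prop), I_add (by fun_prop) (by fun_prop), I_const,
    I_smul, I_smul] at this

theorem I_eq_lin {f g h : ℝ → ℝ} (b c : ℝ) (hg : ContinuousOn g J)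
    (hh : ContinuousOn h J) (H : ∀ x ∈ J, f x = b * g x + c * h x) :
    I f = b * I g + c * I h := by
  rw [I_congr H, I_add (by fun_prop) (by fun_prop), I_smul, I_smul]

theorem I_ibp {u v u' v' : ℝ → ℝ} (hu : ∀ x ∈ J, HasDerivWithinAt u (u' x) J x)
    (hv : ∀ x ∈ J, HasDerivWithinAt v (v' x) J x) (hu' : ContinuousOn u' J)
    (hv' : ContinuousOn v' J) (h1 : u 1 * v 1 = 0) (h2 : u (101 / 100) * v (101 / 100) = 0) :
    I (fun x => u x * v' x) = - I (fun x => u' x * v x) := by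
  have := intervalIntegral.integral_mul_deriv_eq_deriv_mul_of_hasDerivWithinAt
    (by rwa [uIcc_J]) (by rwa [uIcc_J]) (ii hu') (ii hv')
  unfold I
  rw [this, h1, h2]; ring

theorem I_ftc {u u' : ℝ → ℝ} (hu : ∀ x ∈ J, HasDerivWithinAt u (u' x) J x)
    (hu' : ContinuousOn u' J) {x y : ℝ} (hx : x ∈ J) (hy : y ∈ J) (hxy : x ≤ y) :
    ∫ z in x..y, u' z = u y - u x := by
  have hs : Icc x y ⊆ J := Icc_subset_Icc hx.1 hy.2
  refine intervalIntegral.integral_eq_sub_of_hasDerivAt_of_le hxy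
    (fun z hz => (hu z (hs hz)).continuousWithinAt.mono hs) (fun z hz => ?_)
    (ContinuousOn.intervalIntegrable (by rw [uIcc_of_le hxy]; exact hu'.mono hs))
  exact (hu z (hs (Ioo_subset_Icc_self hz))).hasDerivAt
    (Icc_mem_nhds (lt_of_le_of_lt hx.1 hz.1) (lt_of_lt_of_le hz.2 hy.2))

theorem abs_sub_le_I {u u' g : ℝ → ℝ} (hu : ∀ x ∈ J, HasDerivWithinAt u (u' x) J x)
    (hu' : ContinuousOn u' J) (hg : ContinuousOn g J) (h : ∀ x ∈ J, |u' x| ≤ g x) {x y : ℝ}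
    (hx : x ∈ J) (hy : y ∈ J) : |u y - u x| ≤ I g := by
  wlog hxy : x ≤ y generalizing x y
  · rw [abs_sub_comm]
    exact this hy hx (le_of_not_ge hxy)
  have hs : Icc x y ⊆ J := Icc_subset_Icc hx.1 hy.2
  rw [← I_ftc hu hu' hx hy hxy]
  have hi : ∀ {k : ℝ → ℝ}, ContinuousOn k J → IntervalIntegrable k MeasureTheory.volume x y :=
    fun hk => ContinuousOn.intervalIntegrable (by rw [uIcc_of_le hxy]; exact hk.mono hs)
  refine (intervalIntegral.abs_integral_le_integral_abs hxy).trans ?_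
  refine (intervalIntegral.integral_mono_on hxy (hi hu'.abs) (hi hg)
    fun z hz => h z (hs hz)).trans ?_
  refine intervalIntegral.integral_mono_interval hx.1 hxy hy.2 ?_ (ii hg)
  refine (MeasureTheory.ae_restrict_iff' measurableSet_Ioc).2 (MeasureTheory.ae_of_all _ ?_)
  exact fun z hz => (abs_nonneg _).trans (h z (Ioc_subset_Icc_self hz))

/-- The degenerate coefficient. -/
noncomputable def sg (x : ℝ) : ℝ := (x - 1) * (101 / 100 - x)

/-- The derivative of `sg`. -/
noncomputable def sg' (x : ℝ) : ℝ := 201 / 100 - 2 * x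

theorem sg_hasDerivAt (x : ℝ) : HasDerivAt sg (sg' x) x := by
  have := ((hasDerivAt_id x).sub_const 1).mul ((hasDerivAt_id x).const_sub (101 / 100))
  refine this.congr_deriv ?_
  simp [sg']; ring

theorem sg'_hasDerivAt (x : ℝ) : HasDerivAt sg' (-2) x := by
  have := ((hasDerivAt_id x).const_mul 2).const_sub (201 / 100)
  exact this.congr_deriv (by simp)

theorem sg_one : sg 1 = 0 := by simp [sg]
theorem sg_b : sg (101 / 100) = 0 := by simp [sg]

theorem sg_nonneg {x : ℝ} (hx : x ∈ J) : 0 ≤ sg x :=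
  mul_nonneg (sub_nonneg.2 hx.1) (sub_nonneg.2 hx.2)

theorem sg_le_one {x : ℝ} (hx : x ∈ J) : sg x ≤ 1 := by
  have := J_bounds hx
  unfold sg; nlinarith

theorem sg'_sq (x : ℝ) : sg' x ^ 2 = (1 / 100) ^ 2 - 4 * sg x := by
  unfold sg' sg; ring

theorem abs_sg'_le {x : ℝ} (hx : x ∈ J) : |sg' x| ≤ 1 := by
  have := J_bounds hx
  unfold sg'; rw [abs_le]; constructor <;> linarith

theorem continuousOn_sg : ContinuousOn sg J := fun x _ =>
  (sg_hasDerivAt x).continuousAt.continuousWithinAt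

theorem continuousOn_sg' : ContinuousOn sg' J := fun x _ =>
  (sg'_hasDerivAt x).continuousAt.continuousWithinAt

/-- Weighted `L²` norm squared of the `i`-th derivative. -/
noncomputable def Nw (k i : ℕ) (u : ℝ → ℝ) : ℝ := I (fun x => sg x ^ k * D i u x ^ 2)

/-- The energy of order `j`. -/
noncomputable abbrev En (j : ℕ) (u : ℝ → ℝ) : ℝ := Nw j j u

theorem Nw_nonneg (k i : ℕ) (u : ℝ → ℝ) : 0 ≤ Nw k i u :=
  I_nonneg fun _ hx => mul_nonneg (pow_nonneg (sg_nonneg hx) _) (sq_nonneg _)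

theorem Nw_cont {u : ℝ → ℝ} (hu : Sm u) (k i : ℕ) :
    ContinuousOn (fun x => sg x ^ k * D i u x ^ 2) J :=
  (continuousOn_sg.pow k).mul ((hu.continuousOn_D i).pow 2)

theorem hardy (k : ℕ) : ∃ C, 0 ≤ C ∧ ∀ u, Sm u → ∀ i,
    Nw k i u ≤ C * (Nw (k + 1) i u + Nw (k + 2) (i + 1) u) := by
  refine ⟨10000 * 12, by norm_num, fun u hu i => ?_⟩
  set v := D i u with hv
  set w := D (i + 1) u with hw
  have cv : ContinuousOn v J := hu.continuousOn_D i
  have cw : ContinuousOn w J := hu.continuousOn_D (i + 1)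
  have cs := continuousOn_sg
  have cs' := continuousOn_sg'
  have dv : ∀ x ∈ J, HasDerivWithinAt v (w x) J x := fun x hx => hu.hasDerivWithinAt i hx
  set X := I (fun x => sg x ^ k * (sg' x ^ 2 * v x ^ 2)) with hX
  have hXc : ContinuousOn (fun x => sg x ^ k * (sg' x ^ 2 * v x ^ 2)) J := by fun_prop
  have e1 : Nw k i u = 10000 * X + 40000 * Nw (k + 1) i u := by
    refine I_eq_lin _ _ hXc (Nw_cont hu _ _) fun x _ => ?_
    rw [sg'_sq]; ring
  have e2 : I (fun x => (sg' x * v x ^ 2) * ((k + 1 : ℕ) * sg x ^ k * sg' x))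
      = - I (fun x => (-2 * v x ^ 2 + sg' x * (2 * v x * w x)) * sg x ^ (k + 1)) := by
    refine I_ibp (u := fun x => sg' x * v x ^ 2) (v := fun x => sg x ^ (k + 1))
      (fun x hx => ?_) (fun x hx => ?_) (by fun_prop) (by fun_prop) (by simp [sg_one])
      (by simp [sg_b])
    · refine ((sg'_hasDerivAt x).hasDerivWithinAt.mul ((dv x hx).pow 2)).congr_deriv ?_
      simp
    · refine ((sg_hasDerivAt x).hasDerivWithinAt.pow (k + 1)).congr_deriv ?_
      simp
  have e3 : I (fun x => (sg' x * v x ^ 2) * ((k + 1 : ℕ) * sg x ^ k * sg' x))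
      = (k + 1) * X := by
    rw [hX, ← I_smul]
    refine I_congr fun x _ => ?_
    push_cast; ring
  have hk : (1 : ℝ) ≤ k + 1 := by simp
  have e4 : (k + 1) * X ≤ 2 * Nw (k + 1) i u + (1 / 2) * X + 2 * Nw (k + 2) (i + 1) u := by
    rw [← e3, e2, ← neg_one_mul]
    have : ∀ x ∈ J, -1 * ((-2 * v x ^ 2 + sg' x * (2 * v x * w x)) * sg x ^ (k + 1)) ≤
        2 * (sg x ^ (k + 1) * v x ^ 2) + ((1 / 2) * (sg x ^ k * (sg' x ^ 2 * v x ^ 2))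
          + 2 * (sg x ^ (k + 2) * w x ^ 2)) := by
      intro x hx
      have h0 := pow_nonneg (sg_nonneg hx) k
      have : 0 ≤ sg x ^ k * (sg' x * v x + 2 * sg x * w x) ^ 2 := by positivity
      have e : sg x ^ (k + 1) = sg x ^ k * sg x := pow_succ _ _
      have e' : sg x ^ (k + 2) = sg x ^ k * sg x ^ 2 := pow_add _ _ _
      rw [e, e']
      nlinarith
    have h := I_mono (by fun_prop) (by fun_prop) this
    rw [I_add (by fun_prop) (by fun_prop), I_add (by fun_prop) (by fun_prop), I_smul, I_smul,
      I_smul, I_smul] at h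
    unfold Nw
    linarith
  have hX0 : 0 ≤ X := I_nonneg fun x hx => by
    have := pow_nonneg (sg_nonneg hx) k
    positivity
  have := Nw_nonneg (k + 1) i u
  have := Nw_nonneg (k + 2) (i + 1) u
  nlinarith

theorem sobolev (k : ℕ) : ∃ C, 0 ≤ C ∧ ∀ u, Sm u → ∀ i, ∀ x ∈ J,
    sg x ^ (k + 1) * D i u x ^ 2 ≤ C * (Nw (k + 1) i u + Nw (k + 2) (i + 1) u) := by
  obtain ⟨C, hC, h⟩ := hardy k
  refine ⟨(k + 2) * C + 1, by positivity, fun u hu i x hx => ?_⟩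
  set v := D i u with hv
  set w := D (i + 1) u with hw
  have cv : ContinuousOn v J := hu.continuousOn_D i
  have cw : ContinuousOn w J := hu.continuousOn_D (i + 1)
  have cs := continuousOn_sg
  have cs' := continuousOn_sg'
  have dv : ∀ x ∈ J, HasDerivWithinAt v (w x) J x := fun x hx => hu.hasDerivWithinAt i hx
  have h1 : (1 : ℝ) ∈ J := ⟨le_rfl, one_le_b⟩
  have := abs_sub_le_I (u := fun x => sg x ^ (k + 1) * v x ^ 2)
    (u' := fun x => ((k + 1 : ℕ) * sg x ^ k * sg' x) * v x ^ 2 + sg x ^ (k + 1) * (2 * v x * w x))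
    (g := fun x => (k + 2) * (sg x ^ k * v x ^ 2) + sg x ^ (k + 2) * w x ^ 2)
    (fun x hx => by
      refine (((sg_hasDerivAt x).hasDerivWithinAt.pow (k + 1)).mul ((dv x hx).pow 2)).congr_deriv ?_
      simp) (by fun_prop) (by fun_prop) (fun x hx => by
      have h0 := pow_nonneg (sg_nonneg hx) k
      have e : sg x ^ (k + 1) = sg x ^ k * sg x := pow_succ _ _
      have e' : sg x ^ (k + 2) = sg x ^ k * sg x ^ 2 := pow_add _ _ _
      rw [e, e']
      have a1 := abs_le.1 (abs_sg'_le hx)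
      have b0 : 0 ≤ sg x ^ k * v x ^ 2 := by positivity
      have b1 : 0 ≤ sg x ^ k * (v x + sg x * w x) ^ 2 := by positivity
      have b2 : 0 ≤ sg x ^ k * (v x - sg x * w x) ^ 2 := by positivity
      have b3 : 0 ≤ (k + 1) * (sg x ^ k * v x ^ 2) := by positivity
      rw [abs_le]
      push_cast
      constructor <;> nlinarith) h1 hx
  rw [I_add (by fun_prop) (by fun_prop), I_smul] at this
  have h3 := h u hu i
  have h4 := Nw_nonneg (k + 1) i u
  have h5 := Nw_nonneg (k + 2) (i + 1) u
  simp only [sg_one, zero_pow (Nat.succ_ne_zero k), zero_mul, sub_zero] at this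
  have h6 := (le_abs_self _).trans this
  change _ ≤ (k + 2) * Nw k i u + Nw (k + 2) (i + 1) u at h6
  have h7 : ((k : ℝ) + 2) * Nw k i u
      ≤ (k + 2) * (C * (Nw (k + 1) i u + Nw (k + 2) (i + 1) u)) := by gcongr
  nlinarith

theorem sobolev_zero {u : ℝ → ℝ} (hu : Sm u) (i : ℕ) {x : ℝ} (hx : x ∈ J) :
    D i u x ^ 2 ≤ 101 * (Nw 0 i u + Nw 0 (i + 1) u) := by
  set v := D i u with hv
  set w := D (i + 1) u with hw
  have cv : ContinuousOn v J := hu.continuousOn_D i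
  have cw : ContinuousOn w J := hu.continuousOn_D (i + 1)
  have dv : ∀ x ∈ J, HasDerivWithinAt v (w x) J x := fun x hx => hu.hasDerivWithinAt i hx
  have key : ∀ y ∈ J, v x ^ 2 ≤ v y ^ 2 + I (fun x => v x ^ 2 + w x ^ 2) := by
    intro y hy
    have := abs_sub_le_I (u := fun x => v x ^ 2) (u' := fun x => 2 * v x * w x)
      (g := fun x => v x ^ 2 + w x ^ 2) (fun x hx => by
        refine ((dv x hx).pow 2).congr_deriv ?_
        simp) (by fun_prop) (by fun_prop) (fun x hx => by
        rw [abs_le]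
        constructor <;> nlinarith [sq_nonneg (v x + w x), sq_nonneg (v x - w x)]) hy hx
    have := (le_abs_self _).trans this
    linarith
  have h := I_mono (by fun_prop) (by fun_prop) key
  rw [I_const, I_add (by fun_prop) (by fun_prop), I_const, I_add (by fun_prop) (by fun_prop)] at h
  have e1 : I (fun x => v x ^ 2) = Nw 0 i u := by simp [Nw, hv]
  have e2 : I (fun x => w x ^ 2) = Nw 0 (i + 1) u := by simp [Nw, hw]
  rw [e1, e2] at h
  have := Nw_nonneg 0 (i + 1) u
  nlinarith

theorem Nw_bound (d : ℕ) : ∀ (i : ℕ) (M : ℕ → ℝ), d ≤ i → ∃ K, ∀ u, Sm u →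
    (∀ j ≤ i + d, En j u ≤ M j) → Nw (i - d) i u ≤ K := by
  induction d with
  | zero => exact fun i M _ => ⟨M i, fun u _ h => h i le_rfl⟩
  | succ d ih =>
    intro i M hd
    obtain ⟨K1, h1⟩ := ih i M (by omega)
    obtain ⟨K2, h2⟩ := ih (i + 1) M (by omega)
    obtain ⟨C, hC, h⟩ := hardy (i - (d + 1))
    refine ⟨C * (K1 + K2), fun u hu hM => (h u hu i).trans ?_⟩
    have a1 := h1 u hu fun j hj => hM j (by omega)
    have a2 := h2 u hu fun j hj => hM j (by omega)
    rw [show i - (d + 1) + 1 = i - d by omega, show i - (d + 1) + 2 = i + 1 - d by omega]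
    gcongr

theorem D_bound_of_En (i : ℕ) (M : ℕ → ℝ) : ∃ K, ∀ u, Sm u →
    (∀ j ≤ 2 * i + 2, En j u ≤ M j) → ∀ x ∈ J, |D i u x| ≤ K := by
  obtain ⟨K1, h1⟩ := Nw_bound i i M le_rfl
  obtain ⟨K2, h2⟩ := Nw_bound (i + 1) (i + 1) M le_rfl
  refine ⟨101 * (K1 + K2) + 1, fun u hu hM x hx => ?_⟩
  have a1 := h1 u hu fun j hj => hM j (by omega)
  have a2 := h2 u hu fun j hj => hM j (by omega)
  simp only [Nat.sub_self] at a1 a2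
  have := sobolev_zero hu i hx
  rw [abs_le]
  constructor <;> nlinarith [sq_nonneg (D i u x - 1), sq_nonneg (D i u x + 1)]

end LBMCF

namespace LBMCF
open scoped Topology ContDiff

/-- The phase as a function of `(1/x, f, p)`. -/
noncomputable def Hf (z : ℝ × ℝ × ℝ) : ℝ := arctan z.2.2 + 2 * arctan (z.1 * z.2.1)

theorem sm3_Hf : Sm3 Hf := by
  unfold Hf
  have h := Real.contDiff_arctan (n := ∞)
  exact (h.comp (by fun_prop)).add (contDiff_const.mul (h.comp (by fun_prop)))

theorem GP_Hf (z : ℝ × ℝ × ℝ) : GP Hf z = 1 / (1 + z.2.2 ^ 2) := by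
  have hd : DifferentiableAt ℝ Hf z := sm3_Hf.differentiable (by simp) _
  have h1 : HasDerivAt (fun t : ℝ => z + t • ((0, 0, 1) : ℝ × ℝ × ℝ)) (0, 0, 1) 0 := by
    have := ((hasDerivAt_id (0 : ℝ)).smul_const ((0, 0, 1) : ℝ × ℝ × ℝ)).const_add z
    simpa using this
  have h2 : HasDerivAt (fun t : ℝ => Hf (z + t • ((0, 0, 1) : ℝ × ℝ × ℝ))) (GP Hf z) 0 := by
    have hd' : HasFDerivAt Hf (fderiv ℝ Hf z) (z + (0 : ℝ) • ((0, 0, 1) : ℝ × ℝ × ℝ)) := by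
      simpa using hd.hasFDerivAt
    exact hd'.comp_hasDerivAt 0 h1
  have h3 : HasDerivAt (fun t : ℝ => Hf (z + t • ((0, 0, 1) : ℝ × ℝ × ℝ)))
      (1 / (1 + z.2.2 ^ 2)) 0 := by
    unfold Hf
    simp only [Prod.snd_add, Prod.fst_add, Prod.smul_mk, smul_eq_mul, mul_one]
    have := ((((hasDerivAt_id (0 : ℝ)).const_add z.2.2).arctan).add_const
      (2 * arctan (z.1 * z.2.1)))
    simpa using this
  exact h2.unique h3

/-- The Lagrangian phase. -/
noncomputable abbrev Th (f p : ℝ → ℝ) : ℝ → ℝ := cp Hf f p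

/-- The `j`-th derivative of `sg * u'`. -/
noncomputable def Uu (u : ℝ → ℝ) (j : ℕ) (x : ℝ) : ℝ :=
  sg x * D (j + 1) u x + j * sg' x * D j u x - j * (j - 1) * D (j - 1) u x

theorem Uu_chain {u : ℝ → ℝ} (hu : Sm u) (j : ℕ) {x : ℝ} (hx : x ∈ J) :
    HasDerivWithinAt (Uu u j) (Uu u (j + 1) x) J x := by
  have d1 := hu.hasDerivWithinAt (j + 1) hx
  have d0 := hu.hasDerivWithinAt j hx
  have s1 := (sg_hasDerivAt x).hasDerivWithinAt (s := J)
  have s2 := (sg'_hasDerivAt x).hasDerivWithinAt (s := J)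
  rcases Nat.eq_zero_or_pos j with rfl | hj
  · have : Uu u 0 = fun x => sg x * D 1 u x := by
      funext y; simp [Uu]
    rw [this]
    refine (s1.mul d1).congr_deriv ?_
    simp [Uu]; ring
  · have dm := hu.hasDerivWithinAt (j - 1) hx
    rw [Nat.sub_add_cancel hj] at dm
    have := ((s1.mul d1).add ((s2.const_mul (j : ℝ)).mul d0)).sub
      (dm.const_mul ((j : ℝ) * (j - 1)))
    refine this.congr_deriv ?_
    simp only [Uu, Nat.add_sub_cancel]
    push_cast; ring

theorem sm_Uu {u : ℝ → ℝ} (hu : Sm u) (j : ℕ) : Sm (Uu u j) :=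
  sm_of_chain (fun k _ hx => Uu_chain hu k hx) j

theorem D_Uu {u : ℝ → ℝ} (hu : Sm u) (k j : ℕ) {x : ℝ} (hx : x ∈ J) :
    D k (Uu u j) x = Uu u (j + k) x :=
  D_eq_of_chain (fun k _ hx => Uu_chain hu k hx) k j hx

theorem I_energy {p u : ℝ → ℝ} (hp : Sm p) (hu : Sm u) (j : ℕ) :
    I (fun x => sg x ^ j * D j p x * Uu u (j + 1) x) =
      I (fun x => -(sg x ^ (j + 1) * D (j + 1) p x * D (j + 1) u x)
        - j * (j + 1) * (sg x ^ j * D j p x * D j u x)) := by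
  have c1 := continuousOn_sg
  have c2 := continuousOn_sg'
  have p0 := hp.continuousOn_D j
  have p1 := hp.continuousOn_D (j + 1)
  have u0 := hu.continuousOn_D j
  have u1 := hu.continuousOn_D (j + 1)
  have u2 := hu.continuousOn_D (j + 1 + 1)
  have key := I_ibp (u := D j p) (v := fun x => sg x ^ (j + 1) * D (j + 1) u x)
    (u' := D (j + 1) p)
    (v' := fun x => ((j + 1 : ℕ) * sg x ^ j * sg' x) * D (j + 1) u x
      + sg x ^ (j + 1) * D (j + 1 + 1) u x)
    (fun x hx => hp.hasDerivWithinAt j hx) (fun x hx => by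
      refine (((sg_hasDerivAt x).hasDerivWithinAt.pow (j + 1)).mul
        (hu.hasDerivWithinAt (j + 1) hx)).congr_deriv ?_
      simp) p1 (by fun_prop) (by simp [sg_one]) (by simp [sg_b])
  rw [I_sub (by fun_prop) (by fun_prop), I_congr (f := fun x =>
    -(sg x ^ (j + 1) * D (j + 1) p x * D (j + 1) u x)) (g := fun x => (-1) * (D (j + 1) p x *
      (sg x ^ (j + 1) * D (j + 1) u x))) (fun x _ => by ring), I_smul, neg_one_mul, ← key,
    ← I_sub (by fun_prop) (by fun_prop)]
  refine I_congr fun x _ => ?_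
  simp only [Uu, Nat.add_sub_cancel]
  push_cast; ring

theorem wt_sq {x : ℝ} (hx : x ∈ J) (p : ℝ → ℝ) (l : ℕ) :
    wt (√(sg x)) p x l ^ 2 = sg x ^ l * D l p x ^ 2 := by
  unfold wt
  rw [mul_pow, sq_abs, ← pow_mul, mul_comm l 2, pow_mul, Real.sq_sqrt (sg_nonneg hx)]

theorem sqrt_sg_le {x : ℝ} (hx : x ∈ J) : √(sg x) ≤ 1 := by
  exact Real.sqrt_le_iff.2 ⟨by norm_num, by simpa using sg_le_one hx⟩

theorem dissip_pointwise (j : ℕ) (M : ℝ) : ∃ C, 0 ≤ C ∧ ∀ f p x,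
    Adm M f p (√(sg x)) x (j - 1) →
    -(sg x ^ (j + 1) * D (j + 1) p x * D (j + 1) (Th f p) x)
      - j * (j + 1) * (sg x ^ j * D j p x * D j (Th f p) x)
    ≤ C * (1 + sg x ^ j * D j p x ^ 2 + (sg x ^ (j - 1) * D (j - 1) p x ^ 2) ^ 2) := by
  obtain ⟨C1, hC1, h1⟩ := rem_bound sm3_Hf M j
  obtain ⟨C2, hC2, h2⟩ := D_cp_bound j Hf sm3_Hf M
  refine ⟨(1 + M ^ 2) * (3 * C1 ^ 2) + j * (j + 1) * (3 * C2), by positivity,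
    fun f p x A => ?_⟩
  have hx := A.hx
  set s := √(sg x) with hs
  have hs2 : sg x = s ^ 2 := (Real.sq_sqrt (sg_nonneg hx)).symm
  have b1 := h1 f p s x A
  have b2 := h2 f p s x A
  rw [← wt_sq hx, ← wt_sq hx, ← hs]
  set w := wt s p x j with hw
  set v := wt s p x (j - 1) with hv
  have w0 : 0 ≤ w := wt_nonneg A.s0 p x j
  have v0 : 0 ≤ v := wt_nonneg A.s0 p x (j - 1)
  have hT : D (j + 1) (Th f p) x = 1 / (1 + p x ^ 2) * D (j + 1) p x + rem Hf f p j x := by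
    unfold rem; rw [show cp (GP Hf) f p x = 1 / (1 + p x ^ 2) from GP_Hf _]; ring
  set Y := s ^ (j + 1) * D (j + 1) p x with hY
  set r := s ^ (j + 1) * rem Hf f p j x with hr
  have hrabs : |r| ≤ C1 * (1 + w + v ^ 2) := by
    rw [hr, abs_mul, abs_of_nonneg (pow_nonneg A.s0 _)]; exact b1
  have e1 : -(sg x ^ (j + 1) * D (j + 1) p x * D (j + 1) (Th f p) x)
      = -(1 / (1 + p x ^ 2) * Y ^ 2) - Y * r := by
    rw [hT, hs2, hY, hr]; ring
  have hM2 : p x ^ 2 ≤ M ^ 2 := sq_le_sq' (abs_le.1 A.bp).1 (abs_le.1 A.bp).2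
  have ha : 1 / (1 + M ^ 2) ≤ 1 / (1 + p x ^ 2) := by gcongr
  have e2 : -(1 / (1 + p x ^ 2) * Y ^ 2) - Y * r ≤ (1 + M ^ 2) * r ^ 2 := by
    have a0 : 0 < 1 + M ^ 2 := by positivity
    have q1 : 1 / (1 + M ^ 2) * Y ^ 2 ≤ 1 / (1 + p x ^ 2) * Y ^ 2 := by gcongr
    have q2 : 0 ≤ 1 / (1 + M ^ 2) * (Y + (1 + M ^ 2) * r) ^ 2 := by positivity
    have q3 : 1 / (1 + M ^ 2) * (Y + (1 + M ^ 2) * r) ^ 2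
        = 1 / (1 + M ^ 2) * Y ^ 2 + 2 * (Y * r) + (1 + M ^ 2) * r ^ 2 := by
      field_simp; ring
    have q4 : 0 ≤ 1 / (1 + M ^ 2) * Y ^ 2 := by positivity
    have q5 : 0 ≤ (1 + M ^ 2) * r ^ 2 := by positivity
    nlinarith
  have e3 : r ^ 2 ≤ 3 * C1 ^ 2 * (1 + w ^ 2 + (v ^ 2) ^ 2) := by
    have : r ^ 2 ≤ (C1 * (1 + w + v ^ 2)) ^ 2 := sq_le_sq' (by linarith [(abs_le.1 hrabs).1])
      (abs_le.1 hrabs).2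
    refine this.trans ?_
    rw [mul_pow, mul_comm 3, mul_assoc]
    refine mul_le_mul_of_nonneg_left ?_ (sq_nonneg C1)
    nlinarith [sq_nonneg (1 - w), sq_nonneg (1 - v ^ 2), sq_nonneg (w - v ^ 2)]
  have e4 : -(sg x ^ j * D j p x * D j (Th f p) x) ≤ 3 * C2 * (1 + w ^ 2 + (v ^ 2) ^ 2) := by
    calc -(sg x ^ j * D j p x * D j (Th f p) x) ≤ |sg x ^ j * D j p x * D j (Th f p) x| :=
          neg_le_abs _
      _ = w * (s ^ j * |D j (Th f p) x|) := by
          rw [abs_mul, abs_mul, abs_of_nonneg (pow_nonneg (sg_nonneg hx) _), hs2, hw, wt]; ring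
      _ ≤ w * (C2 * (1 + v + w)) := by gcongr
      _ = C2 * (w * (1 + v + w)) := by ring
      _ ≤ C2 * (3 * (1 + w ^ 2 + (v ^ 2) ^ 2)) := by
          refine mul_le_mul_of_nonneg_left ?_ hC2
          nlinarith [sq_nonneg (1 - w), sq_nonneg (1 - v ^ 2), sq_nonneg (w - v),
            sq_nonneg (v - 1), sq_nonneg (v ^ 2)]
      _ = _ := by ring
  rw [e1]
  have j0 : (0 : ℝ) ≤ j * (j + 1) := by positivity
  have e5 := mul_le_mul_of_nonneg_left e4 j0
  have e6 := mul_le_mul_of_nonneg_left e3 (show 0 ≤ 1 + M ^ 2 by positivity)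
  linarith

theorem dissip (j : ℕ) (M : ℝ) : ∃ C, 0 ≤ C ∧ ∀ f p, Sm f → Sm p →
    (∀ x ∈ J, HasDerivWithinAt f (p x) J x) → (∀ x ∈ J, |f x| ≤ M) →
    (∀ x ∈ J, ∀ l < max 2 (j - 1), wt (√(sg x)) p x l ≤ M) → (3 ≤ j → En (j - 1) p ≤ M) →
    I (fun x => sg x ^ j * D j p x * Uu (Th f p) (j + 1) x) ≤ C * (1 + En j p) := by
  obtain ⟨C1, hC1, h1⟩ := dissip_pointwise j M
  obtain ⟨C2, hC2, h2⟩ := sobolev (j - 2)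
  refine ⟨C1 * (1 + M ^ 4 + C2 * (1 + |M|) * |M|), by positivity,
    fun f p hf hp hd bf bw hE => ?_⟩
  have hT : Sm (Th f p) := sm3_Hf.cp hf hp
  have c1 := continuousOn_sg
  have p0 := hp.continuousOn_D j
  have p1 := hp.continuousOn_D (j + 1)
  have pm := hp.continuousOn_D (j - 1)
  have u0 := hT.continuousOn_D j
  have u1 := hT.continuousOn_D (j + 1)
  rw [I_energy hp hT j]
  have hA : ∀ x ∈ J, Adm M f p (√(sg x)) x (j - 1) := fun x hx =>
    ⟨hf, hp, hd, hx, Real.sqrt_nonneg _, sqrt_sg_le hx, bf x hx, bw x hx⟩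
  have e1 := I_mono (by fun_prop) (by fun_prop) fun x hx => h1 f p x (hA x hx)
  rw [I_smul, I_add (by fun_prop) (by fun_prop), I_add (by fun_prop) (by fun_prop), I_const] at e1
  change _ ≤ C1 * (1 / 100 + En j p + _) at e1
  refine e1.trans ?_
  rw [mul_assoc]
  refine mul_le_mul_of_nonneg_left ?_ hC1
  have hE0 : 0 ≤ En j p := Nw_nonneg _ _ _
  have e2 : I (fun x => (sg x ^ (j - 1) * D (j - 1) p x ^ 2) ^ 2)
      ≤ M ^ 4 + C2 * (1 + |M|) * |M| * (1 + En j p) := by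
    by_cases hj : 3 ≤ j
    · have hM := hE hj
      have hE1 : 0 ≤ En (j - 1) p := Nw_nonneg _ _ _
      have habs : En (j - 1) p ≤ |M| := hM.trans (le_abs_self _)
      have : ∀ x ∈ J, (sg x ^ (j - 1) * D (j - 1) p x ^ 2) ^ 2 ≤
          (C2 * (|M| + En j p)) * (sg x ^ (j - 1) * D (j - 1) p x ^ 2) := by
        intro x hx
        have := h2 p hp (j - 1) x hx
        rw [show j - 2 + 1 = j - 1 by omega, show j - 2 + 2 = j by omega,
          show j - 1 + 1 = j by omega] at this
        have h0 : 0 ≤ sg x ^ (j - 1) * D (j - 1) p x ^ 2 :=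
          mul_nonneg (pow_nonneg (sg_nonneg hx) _) (sq_nonneg _)
        rw [sq]
        refine mul_le_mul_of_nonneg_right (this.trans ?_) h0
        gcongr
      have := I_mono (by fun_prop) (by fun_prop) this
      rw [I_smul] at this
      have e3 : C2 * (|M| + En j p) * En (j - 1) p ≤ C2 * (|M| + En j p) * |M| := by gcongr
      have e4 : C2 * (|M| + En j p) * |M| ≤ C2 * (1 + |M|) * |M| * (1 + En j p) := by
        have : |M| + En j p ≤ (1 + |M|) * (1 + En j p) := by
          nlinarith [mul_nonneg (abs_nonneg M) hE0]
        calc C2 * (|M| + En j p) * |M| ≤ C2 * ((1 + |M|) * (1 + En j p)) * |M| := by gcongr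
          _ = _ := by ring
      have : 0 ≤ M ^ 4 := by positivity
      unfold En Nw at *
      linarith
    · have : ∀ x ∈ J, (sg x ^ (j - 1) * D (j - 1) p x ^ 2) ^ 2 ≤ M ^ 4 := by
        intro x hx
        rw [← wt_sq hx, ← pow_mul]
        exact pow_le_pow_left₀ (wt_nonneg (Real.sqrt_nonneg _) _ _ _)
          (bw x hx (j - 1) (lt_max_of_lt_left (by omega))) 4
      have := I_mono (by fun_prop) continuousOn_const this
      rw [I_const] at this
      have h4 : 0 ≤ M ^ 4 := by positivity
      have : 0 ≤ C2 * (1 + |M|) * |M| * (1 + En j p) := by positivity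
      linarith
  have h4 : 0 ≤ M ^ 4 * En j p := by positivity
  nlinarith

end LBMCF

namespace LBMCF
open scoped Topology ContDiff
open Polynomial (C X derivative)

/-- A polynomial as a function. -/
noncomputable abbrev ev (P : Polynomial ℝ) (x : ℝ) : ℝ := P.eval x

theorem cont_ev (P : Polynomial ℝ) (s : Set ℝ) : ContinuousOn (ev P) s := P.continuous.continuousOn

theorem ev_chain (P : Polynomial ℝ) (k : ℕ) (x : ℝ) :
    HasDerivAt (ev (derivative^[k] P)) (ev (derivative^[k + 1] P) x) x := by
  rw [Function.iterate_succ_apply']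
  exact (derivative^[k] P).hasDerivAt x

theorem sm_ev (P : Polynomial ℝ) : Sm (ev P) :=
  sm_of_chain (u := fun k => ev (derivative^[k] P))
    (fun k x _ => (ev_chain P k x).hasDerivWithinAt) 0

theorem D_ev (P : Polynomial ℝ) (k : ℕ) {x : ℝ} (hx : x ∈ J) :
    D k (ev P) x = ev (derivative^[k] P) x := by
  have := D_eq_of_chain (u := fun k => ev (derivative^[k] P))
    (fun k x _ => (ev_chain P k x).hasDerivWithinAt) k 0 hx
  simpa using this

/-- The antiderivative of `P` with value `1/10` at `1`. -/
noncomputable def FF (P : Polynomial ℝ) (x : ℝ) : ℝ := 1 / 10 + ∫ y in (1 : ℝ)..x, P.eval y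

theorem FF_hasDerivAt (P : Polynomial ℝ) (x : ℝ) : HasDerivAt (FF P) (ev P x) x :=
  (intervalIntegral.integral_hasDerivAt_right (P.continuous.intervalIntegrable _ _)
    P.continuous.aestronglyMeasurable.stronglyMeasurableAtFilter
    P.continuous.continuousAt).const_add _

theorem FF_one (P : Polynomial ℝ) : FF P 1 = 1 / 10 := by simp [FF]

theorem sm_FF (P : Polynomial ℝ) : Sm (FF P) :=
  sm_of_chain (u := fun k => Nat.casesOn k (FF P) (fun k => ev (derivative^[k] P)))
    (fun k x _ => by
      cases k with
      | zero => exact (FF_hasDerivAt P x).hasDerivWithinAt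
      | succ k => exact (ev_chain P k x).hasDerivWithinAt) 0

/-- The phase of a polynomial slope. -/
noncomputable abbrev TP (P : Polynomial ℝ) : ℝ → ℝ := Th (FF P) (ev P)

theorem sm_TP (P : Polynomial ℝ) : Sm (TP P) := sm3_Hf.cp (sm_FF P) (sm_ev P)

/-- `sg` as a polynomial. -/
noncomputable def SP : Polynomial ℝ := (X - C 1) * (C (101 / 100) - X)

theorem ev_SP (x : ℝ) : SP.eval x = sg x := by simp [SP, sg]

theorem natDegree_SP : SP.natDegree ≤ 2 := by unfold SP; compute_degree

theorem ibp_iter (j : ℕ) : ∀ (Q : Polynomial ℝ), SP ^ j ∣ Q → ∀ v, Sm v →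
    I (fun x => ev (derivative^[j] Q) x * v x) = (-1) ^ j * I (fun x => ev Q x * D j v x) := by
  induction j with
  | zero =>
    intro Q _ v _
    simp only [Function.iterate_zero, id, pow_zero, one_mul]
    exact I_congr fun x _ => by rw [D_zero]
  | succ j ih =>
    intro Q hQ v hv
    have hd := Polynomial.pow_sub_one_dvd_derivative_of_pow_dvd hQ
    rw [Nat.add_sub_cancel] at hd
    have h1 := ih _ hd v hv
    rw [Function.iterate_succ_apply, h1, pow_succ, mul_assoc]
    congr 1
    have hz : ∀ x, sg x = 0 → ev Q x = 0 := by
      intro x hx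
      obtain ⟨R, rfl⟩ := hQ
      simp [ev, ev_SP, hx]
    have := I_ibp (u := ev Q) (v := D j v) (u' := ev (derivative Q)) (v' := D (j + 1) v)
      (fun x _ => (Q.hasDerivAt x).hasDerivWithinAt) (fun x hx => hv.hasDerivWithinAt j hx)
      (cont_ev _ _) (hv.continuousOn_D _) (by rw [hz _ sg_one, zero_mul])
      (by rw [hz _ sg_b, zero_mul])
    rw [this]; simp

/-- The polynomial `(-1)^j (S^j P^{(j)})^{(j)}`. -/
noncomputable def psi (j : ℕ) (P : Polynomial ℝ) : Polynomial ℝ :=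
  C ((-1) ^ j) * derivative^[j] (SP ^ j * derivative^[j] P)

theorem natDegree_psi {N : ℕ} {P : Polynomial ℝ} (hP : P.natDegree ≤ N) (j : ℕ) :
    (psi j P).natDegree ≤ N := by
  unfold psi
  refine (Polynomial.natDegree_C_mul_le _ _).trans ?_
  by_cases hj : derivative^[j] P = 0
  · simp [hj]
  have hjN : j ≤ P.natDegree := by
    by_contra h
    exact hj (Polynomial.iterate_derivative_eq_zero (by omega))
  refine (Polynomial.natDegree_iterate_derivative _ _).trans ?_
  have h1 := Polynomial.natDegree_mul_le (p := SP ^ j) (q := derivative^[j] P)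
  have h2 := Polynomial.natDegree_iterate_derivative P j
  have h3 : (SP ^ j).natDegree ≤ j * 2 := Polynomial.natDegree_pow_le_of_le j natDegree_SP
  omega

theorem I_psi (j : ℕ) (P : Polynomial ℝ) {v : ℝ → ℝ} (hv : Sm v) :
    I (fun x => ev (psi j P) x * v x) = I (fun x => sg x ^ j * D j (ev P) x * D j v x) := by
  have h := ibp_iter j (SP ^ j * derivative^[j] P) (dvd_mul_right _ _) v hv
  have : ∀ x, ev (psi j P) x * v x
      = (-1) ^ j * (ev (derivative^[j] (SP ^ j * derivative^[j] P)) x * v x) := by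
    intro x; simp [psi, ev, mul_assoc]
  simp only [this]
  rw [I_smul, h, ← mul_assoc, ← mul_pow]
  simp only [mul_neg, mul_one, neg_neg, one_pow, one_mul]
  refine I_congr fun x hx => ?_
  rw [D_ev P j hx]
  simp [ev, ev_SP]

/-- The operator `ψ ↦ ∂ₓ (S ∂ₓ ψ)`. -/
noncomputable def LP (P : Polynomial ℝ) : Polynomial ℝ := derivative (SP * derivative P)

theorem I_LP (P : Polynomial ℝ) {v : ℝ → ℝ} (hv : Sm v) :
    I (fun x => ev (LP P) x * v x) = I (fun x => ev P x * Uu v 1 x) := by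
  have h1 := ibp_iter 1 (SP * derivative P) (by simp) v hv
  have hz : ∀ x, sg x = 0 → Uu v 0 x = 0 := by intro x hx; simp [Uu, hx]
  have h2 := I_ibp (u := ev P) (v := Uu v 0) (u' := ev (derivative P)) (v' := Uu v 1)
    (fun x _ => (P.hasDerivAt x).hasDerivWithinAt) (fun x hx => Uu_chain hv 0 hx)
    (cont_ev _ _) (sm_Uu hv 1).continuousOn (by rw [hz _ sg_one, mul_zero])
    (by rw [hz _ sg_b, mul_zero])
  rw [h2]
  simp only [Function.iterate_one] at h1
  unfold LP
  rw [h1]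
  simp only [pow_one, neg_mul, one_mul, neg_inj]
  refine I_congr fun x _ => ?_
  simp [ev, ev_SP, Uu]; ring

theorem eq_zero_of_I_sq {g : ℝ → ℝ} (hg : ContinuousOn g J) (h : I (fun x => g x ^ 2) = 0) :
    ∀ x ∈ J, g x = 0 := by
  by_contra! hne
  obtain ⟨x, hx, hgx⟩ := hne
  have := intervalIntegral.integral_pos (f := fun x => g x ^ 2) (a := 1) (b := 101 / 100)
    (by norm_num) (hg.pow 2) (fun x _ => sq_nonneg _) ⟨x, hx, by positivity⟩
  exact this.ne' h

theorem poly_eq_zero_of_J {P : Polynomial ℝ} (h : ∀ x ∈ J, P.eval x = 0) : P = 0 :=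
  P.eq_zero_of_infinite_isRoot ((Set.Icc_infinite (by norm_num)).mono fun x hx => h x hx)

end LBMCF

namespace LBMCF
open scoped Topology ContDiff NNReal
open Polynomial (C X derivative)

theorem abs_arctan_sub_le (a b : ℝ) : |arctan a - arctan b| ≤ |a - b| := by
  have h : LipschitzWith 1 arctan :=
    lipschitzWith_of_nnnorm_deriv_le differentiable_arctan fun x => by
      rw [← NNReal.coe_le_coe, coe_nnnorm, Real.deriv_arctan, Real.norm_eq_abs,
        abs_of_nonneg (by positivity)]
      rw [NNReal.coe_one, div_le_one (by positivity)]
      nlinarith [sq_nonneg x]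
  simpa [Real.dist_eq] using h.dist_le_mul a b

theorem abs_arctan_le (a : ℝ) : |arctan a| ≤ 2 := by
  have h1 := arctan_lt_pi_div_two a
  have h2 := neg_pi_div_two_lt_arctan a
  have h3 := pi_lt_four
  rw [abs_le]; constructor <;> linarith

/-- The polynomial with a given coefficient vector. -/
noncomputable def pol {N : ℕ} (c : Fin (N + 1) → ℝ) : Polynomial ℝ := ∑ i, C (c i) * X ^ (i : ℕ)

theorem ev_pol {N : ℕ} (c : Fin (N + 1) → ℝ) (x : ℝ) : ev (pol c) x = ∑ i, c i * x ^ (i : ℕ) := by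
  simp [ev, pol, Polynomial.eval_finsetSum]

theorem natDegree_pol {N : ℕ} (c : Fin (N + 1) → ℝ) : (pol c).natDegree ≤ N := by
  unfold pol
  refine Polynomial.natDegree_sum_le_of_forall_le _ _ fun i _ => ?_
  exact (Polynomial.natDegree_C_mul_X_pow_le _ _).trans (Nat.lt_succ_iff.1 i.2)

theorem coeff_pol {N : ℕ} (c : Fin (N + 1) → ℝ) (k : ℕ) :
    (pol c).coeff k = if h : k < N + 1 then c ⟨k, h⟩ else 0 := by
  unfold pol
  simp only [Polynomial.finsetSum_coeff, Polynomial.coeff_C_mul, Polynomial.coeff_X_pow]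
  split_ifs with h
  · rw [Finset.sum_eq_single ⟨k, h⟩]
    · simp
    · intro i _ hi
      rw [if_neg, mul_zero]
      rintro rfl; exact hi rfl
    · simp
  · refine Finset.sum_eq_zero fun i _ => ?_
    rw [if_neg, mul_zero]
    rintro rfl; exact h i.2

theorem pol_coeff {N : ℕ} {P : Polynomial ℝ} (hP : P.natDegree ≤ N) :
    pol (N := N) (fun i => P.coeff i) = P := by
  ext k
  rw [coeff_pol]
  split_ifs with h
  · rfl
  · exact (Polynomial.coeff_eq_zero_of_natDegree_lt (by omega)).symm

theorem I_mul_pol {N : ℕ} {g : ℝ → ℝ} (hg : ContinuousOn g J) (c : Fin (N + 1) → ℝ) :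
    I (fun x => g x * ev (pol c) x) = ∑ i, c i * I (fun x => g x * x ^ (i : ℕ)) := by
  have : I (fun x => g x * ev (pol c) x) = I (fun x => ∑ i, c i * (g x * x ^ (i : ℕ))) :=
    I_congr fun x _ => by
      rw [ev_pol, Finset.mul_sum]
      exact Finset.sum_congr rfl fun i _ => by ring
  rw [this]
  unfold I
  rw [intervalIntegral.integral_finsetSum fun i _ => ii (by fun_prop)]
  exact Finset.sum_congr rfl fun i _ => intervalIntegral.integral_const_mul _ _

/-- The Gram operator of the monomials on `J`. -/
noncomputable def gram (N : ℕ) : (Fin (N + 1) → ℝ) →ₗ[ℝ] (Fin (N + 1) → ℝ) where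
  toFun c i := I (fun x => x ^ (i : ℕ) * ev (pol c) x)
  map_add' c d := by
    funext i
    have h : ContinuousOn (fun x : ℝ => x ^ (i : ℕ)) J := by fun_prop
    simp only [I_mul_pol h, Pi.add_apply, add_mul, Finset.sum_add_distrib]
  map_smul' r c := by
    funext i
    have h : ContinuousOn (fun x : ℝ => x ^ (i : ℕ)) J := by fun_prop
    simp only [I_mul_pol h, Pi.smul_apply, smul_eq_mul, Finset.mul_sum, mul_assoc, RingHom.id_apply]

theorem gram_injective (N : ℕ) : Function.Injective (gram N) := by
  rw [injective_iff_map_eq_zero]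
  intro c hc
  have h1 : I (fun x => ev (pol c) x ^ 2) = 0 := by
    have := I_mul_pol (cont_ev (pol c) J) c
    simp only [← sq] at this
    rw [this]
    refine Finset.sum_eq_zero fun i _ => ?_
    have := congrFun hc i
    simp only [gram, LinearMap.coe_mk, AddHom.coe_mk, Pi.zero_apply] at this
    rw [I_congr (g := fun x => x ^ (i : ℕ) * ev (pol c) x) (fun x _ => mul_comm _ _), this,
      mul_zero]
  have h2 := poly_eq_zero_of_J (eq_zero_of_I_sq (cont_ev _ _) h1)
  funext i
  have := coeff_pol c i
  rw [h2] at this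
  rw [dif_pos i.2] at this
  simpa using this.symm

/-- The Galerkin right-hand side before inverting the Gram operator. -/
noncomputable def galH (N : ℕ) (c : Fin (N + 1) → ℝ) (i : Fin (N + 1)) : ℝ :=
  I (fun x => ev (LP (X ^ (i : ℕ))) x * TP (pol c) x)

theorem abs_TP_le (P : Polynomial ℝ) (x : ℝ) : |TP P x| ≤ 6 := by
  simp only [cp, Hf]
  have h1 := abs_arctan_le (ev P x)
  have h2 := abs_arctan_le (x⁻¹ * FF P x)
  calc _ ≤ |arctan (ev P x)| + |2 * arctan (x⁻¹ * FF P x)| := abs_add_le _ _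
    _ ≤ 2 + 2 * 2 := by rw [abs_mul, abs_two]; gcongr
    _ = 6 := by norm_num

theorem abs_ev_pol_sub_le {N : ℕ} (c d : Fin (N + 1) → ℝ) {x : ℝ} (hx : x ∈ J) :
    |ev (pol c) x - ev (pol d) x| ≤ (∑ i : Fin (N + 1), (2 : ℝ) ^ (i : ℕ)) * ‖c - d‖ := by
  obtain ⟨x1, x2, x0⟩ := J_bounds hx
  rw [ev_pol, ev_pol, ← Finset.sum_sub_distrib, Finset.sum_mul]
  refine (Finset.abs_sum_le_sum_abs _ _).trans (Finset.sum_le_sum fun i _ => ?_)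
  rw [← sub_mul, abs_mul, mul_comm, abs_of_nonneg (by positivity : 0 ≤ x ^ (i : ℕ))]
  have := norm_le_pi_norm (c - d) i
  simp only [Pi.sub_apply, Real.norm_eq_abs] at this
  gcongr
  linarith

theorem abs_TP_sub_le {N : ℕ} (c d : Fin (N + 1) → ℝ) {x : ℝ} (hx : x ∈ J) :
    |TP (pol c) x - TP (pol d) x|
      ≤ 3 * ((∑ i : Fin (N + 1), (2 : ℝ) ^ (i : ℕ)) * ‖c - d‖) := by
  obtain ⟨x1, x2, x0⟩ := J_bounds hx
  set B := (∑ i : Fin (N + 1), (2 : ℝ) ^ (i : ℕ)) * ‖c - d‖ with hB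
  have hB0 : 0 ≤ B := by positivity
  have hF : |FF (pol c) x - FF (pol d) x| ≤ B := by
    unfold FF
    rw [add_sub_add_left_eq_sub, ← intervalIntegral.integral_sub
      ((pol c).continuous.intervalIntegrable _ _) ((pol d).continuous.intervalIntegrable _ _)]
    have := intervalIntegral.norm_integral_le_of_norm_le_const (a := 1) (b := x) (C := B)
      (f := fun y => (pol c).eval y - (pol d).eval y) (fun y hy => by
        rw [uIoc_of_le x1] at hy
        exact abs_ev_pol_sub_le c d ⟨hy.1.le, hy.2.trans x2⟩)
    rw [Real.norm_eq_abs] at this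
    refine this.trans ?_
    rw [abs_of_nonneg (by linarith)]
    nlinarith
  have hx1 : |x⁻¹ * FF (pol c) x - x⁻¹ * FF (pol d) x| ≤ B := by
    rw [← mul_sub, abs_mul, abs_of_pos (inv_pos.2 x0)]
    have : x⁻¹ ≤ 1 := inv_le_one_of_one_le₀ x1
    calc x⁻¹ * |FF (pol c) x - FF (pol d) x| ≤ 1 * B := by gcongr
      _ = B := one_mul B
  have h1 := (abs_arctan_sub_le (ev (pol c) x) (ev (pol d) x)).trans (abs_ev_pol_sub_le c d hx)
  have h2 := (abs_arctan_sub_le (x⁻¹ * FF (pol c) x) (x⁻¹ * FF (pol d) x)).trans hx1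
  simp only [cp, Hf]
  rw [abs_le] at h1 h2 ⊢
  constructor <;> linarith [h1.1, h1.2, h2.1, h2.2]

theorem galH_bound (N : ℕ) : ∃ K : ℝ≥0, (∀ c, ‖galH N c‖ ≤ K) ∧ LipschitzWith K (galH N) := by
  have hK : ∀ i : Fin (N + 1), ∃ K, 0 ≤ K ∧ ∀ x ∈ J, |ev (LP (X ^ (i : ℕ))) x| ≤ K := by
    intro i
    obtain ⟨K, hK⟩ := isCompact_Icc.exists_bound_of_continuousOn (cont_ev (LP (X ^ (i : ℕ))) J)
    exact ⟨|K|, abs_nonneg _, fun x hx => (hK x hx).trans (le_abs_self _)⟩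
  choose K hK0 hK using hK
  set B := ∑ i : Fin (N + 1), (2 : ℝ) ^ (i : ℕ) with hB
  have hB0 : 0 ≤ B := by positivity
  set L : ℝ := (∑ i, K i) * (6 + 3 * B) with hL
  have hS : ∀ i, K i ≤ ∑ i, K i := fun i => Finset.single_le_sum (fun i _ => hK0 i)
    (Finset.mem_univ i)
  have hS0 : 0 ≤ ∑ i, K i := Finset.sum_nonneg fun i _ => hK0 i
  have hL0 : 0 ≤ L := by positivity
  have habs : ∀ (g : ℝ → ℝ) (M : ℝ), 0 ≤ M → (∀ x ∈ J, |g x| ≤ M) → |I g| ≤ M := by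
    intro g M hM hg
    have := intervalIntegral.norm_integral_le_of_norm_le_const (a := 1) (b := 101 / 100) (C := M)
      (f := g) (fun y hy => by
        rw [uIoc_of_le one_le_b] at hy
        exact hg y ⟨hy.1.le, hy.2⟩)
    refine this.trans ?_
    rw [abs_of_nonneg (by norm_num)]
    linarith
  refine ⟨⟨L, hL0⟩, fun c => ?_, LipschitzWith.of_dist_le_mul fun c d => ?_⟩
  · refine (pi_norm_le_iff_of_nonneg hL0).2 fun i => habs _ _ hL0 fun x hx => ?_
    rw [abs_mul]
    calc _ ≤ K i * 6 := by
          gcongr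
          · exact hK0 i
          · exact hK i x hx
          · exact abs_TP_le _ _
      _ ≤ (∑ i, K i) * (6 + 3 * B) := by
          have := hS i
          have : 0 ≤ (∑ i, K i) * (3 * B) := by positivity
          nlinarith
  · rw [dist_eq_norm, dist_eq_norm]
    have hR : 0 ≤ L * ‖c - d‖ := by positivity
    refine (pi_norm_le_iff_of_nonneg hR).2 fun i => ?_
    change |galH N c i - galH N d i| ≤ _
    unfold galH
    have hcont : ∀ c : Fin (N + 1) → ℝ,
        ContinuousOn (fun x => ev (LP (X ^ (i : ℕ))) x * TP (pol c) x) J := fun c =>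
      (cont_ev _ _).mul (sm_TP _).continuousOn
    rw [← I_sub (hcont c) (hcont d)]
    refine habs _ _ hR fun x hx => ?_
    rw [← mul_sub, abs_mul]
    calc _ ≤ K i * (3 * (B * ‖c - d‖)) := by
          gcongr
          · exact hK0 i
          · exact hK i x hx
          · exact abs_TP_sub_le c d hx
      _ ≤ (∑ i, K i) * (6 + 3 * B) * ‖c - d‖ := by
          have h1 : K i * (3 * (B * ‖c - d‖)) ≤ (∑ i, K i) * (3 * (B * ‖c - d‖)) :=
            mul_le_mul_of_nonneg_right (hS i) (by positivity)
          have : 0 ≤ (∑ i, K i) * 6 * ‖c - d‖ := by positivity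
          linarith

/-- Galerkin solutions of degree at most `N` on the time interval `[0, N]`. -/
structure Gal (P0 : Polynomial ℝ) (N : ℕ) (P Q : ℝ → Polynomial ℝ) : Prop where
  degP : ∀ t, (P t).natDegree ≤ N
  degQ : ∀ t, (Q t).natDegree ≤ N
  init : P 0 = P0
  der : ∀ t ∈ Icc (0 : ℝ) N, ∀ k,
    HasDerivWithinAt (fun t => (P t).coeff k) ((Q t).coeff k) (Icc (0 : ℝ) N) t
  weak : ∀ t, ∀ ψ : Polynomial ℝ, ψ.natDegree ≤ N →
    I (fun x => ev ψ x * ev (Q t) x) = I (fun x => ev ψ x * Uu (TP (P t)) 1 x)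

theorem exists_Gal {P0 : Polynomial ℝ} {N : ℕ} (h0 : P0.natDegree ≤ N) :
    ∃ P Q, Gal P0 N P Q := by
  obtain ⟨K, hb, hl⟩ := galH_bound N
  let e := LinearEquiv.ofInjectiveEndo (gram N) (gram_injective N)
  let g : (Fin (N + 1) → ℝ) →L[ℝ] (Fin (N + 1) → ℝ) :=
    LinearMap.toContinuousLinearMap e.symm.toLinearMap
  have hg : ∀ y, gram N (g y) = y := fun y => e.apply_symm_apply y
  let v : (Fin (N + 1) → ℝ) → (Fin (N + 1) → ℝ) := fun c => g (galH N c)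
  have hv : LipschitzWith (‖g‖₊ * K) v := g.lipschitz.comp hl
  have hvb : ∀ c, ‖v c‖ ≤ ‖g‖₊ * K := fun c =>
    (g.le_opNorm _).trans (mul_le_mul_of_nonneg_left (hb c) (norm_nonneg _))
  have hpl : IsPicardLindelof (fun _ => v) (tmin := 0) (tmax := N)
      ⟨0, by simp⟩ (fun i : Fin (N + 1) => P0.coeff i) (‖g‖₊ * K * N) 0 (‖g‖₊ * K)
      (‖g‖₊ * K) := by
    refine .of_time_independent (fun c _ => by simpa using hvb c) hv.lipschitzOnWith ?_
    simp
  obtain ⟨α, ha0, ha⟩ := hpl.exists_eq_forall_mem_Icc_hasDerivWithinAt₀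
  refine ⟨fun t => pol (α t), fun t => pol (v (α t)), fun t => natDegree_pol _,
    fun t => natDegree_pol _, ?_, fun t ht k => ?_, fun t ψ hψ => ?_⟩
  · simp only at ha0
    simp only [ha0]
    exact pol_coeff h0
  · simp only [coeff_pol]
    split_ifs with h
    · exact (hasDerivWithinAt_pi.1 (ha t ht)) ⟨k, h⟩
    · exact hasDerivWithinAt_const _ _ _
  · rw [← pol_coeff hψ]
    set d : Fin (N + 1) → ℝ := fun i => ψ.coeff i
    have e1 := I_mul_pol (cont_ev (pol (v (α t))) J) d
    have e2 := I_mul_pol ((sm_Uu (sm_TP (pol (α t))) 1).continuousOn) d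
    rw [I_congr (g := fun x => ev (pol (v (α t))) x * ev (pol d) x) (fun x _ => mul_comm _ _), e1,
      I_congr (f := fun x => ev (pol d) x * Uu (TP (pol (α t))) 1 x)
        (g := fun x => Uu (TP (pol (α t))) 1 x * ev (pol d) x) (fun x _ => mul_comm _ _), e2]
    refine Finset.sum_congr rfl fun i _ => ?_
    congr 1
    have h3 := congrFun (hg (galH N (α t))) i
    have h4 := I_LP (X ^ (i : ℕ)) (sm_TP (pol (α t)))
    change I (fun x => x ^ (i : ℕ) * ev (pol (v (α t))) x) = I _ at h3
    rw [h4] at h3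
    rw [I_congr (g := fun x => x ^ (i : ℕ) * ev (pol (v (α t))) x) (fun x _ => mul_comm _ _), h3]
    refine I_congr fun x _ => ?_
    simp [ev]; ring

end LBMCF

namespace LBMCF
open scoped Topology ContDiff
open Polynomial (C X derivative)

theorem hasDerivWithinAt_lin {N : ℕ} {P : ℝ → Polynomial ℝ} {R : Polynomial ℝ} {s : Set ℝ} {t : ℝ}
    (hP : ∀ t, (P t).natDegree ≤ N) (hR : R.natDegree ≤ N)
    (h : ∀ k, HasDerivWithinAt (fun t => (P t).coeff k) (R.coeff k) s t)
    (L : Polynomial ℝ →ₗ[ℝ] ℝ) : HasDerivWithinAt (fun t => L (P t)) (L R) s t := by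
  have key : ∀ S : Polynomial ℝ, S.natDegree ≤ N →
      L S = ∑ k ∈ Finset.range (N + 1), S.coeff k * L (X ^ k) := by
    intro S hS
    conv_lhs => rw [S.as_sum_range' (N + 1) (by omega)]
    rw [map_sum]
    refine Finset.sum_congr rfl fun k _ => ?_
    rw [← Polynomial.C_mul_X_pow_eq_monomial, ← Polynomial.smul_eq_C_mul, map_smul, smul_eq_mul]
  rw [key R hR]
  simp only [fun t => key (P t) (hP t)]
  exact HasDerivWithinAt.fun_sum fun k _ => (h k).mul_const _

/-- The energy bilinear form on polynomials. -/
noncomputable def bil (j : ℕ) : Polynomial ℝ →ₗ[ℝ] Polynomial ℝ →ₗ[ℝ] ℝ :=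
  have hc : ∀ P Q : Polynomial ℝ, ContinuousOn
      (fun x => sg x ^ j * (ev (derivative^[j] P) x * ev (derivative^[j] Q) x)) J := fun P Q =>
    (continuousOn_sg.pow j).mul ((cont_ev _ _).mul (cont_ev _ _))
  LinearMap.mk₂ ℝ
    (fun P Q => I (fun x => sg x ^ j * (ev (derivative^[j] P) x * ev (derivative^[j] Q) x)))
    (fun P P' Q => by
      rw [← I_add (hc _ _) (hc _ _)]
      exact I_congr fun x _ => by
        simp only [ev, iterate_map_add, Polynomial.eval_add]
        ring)
    (fun c P Q => by
      rw [smul_eq_mul, ← I_smul]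
      exact I_congr fun x _ => by
        simp only [ev, Polynomial.iterate_derivative_smul, Polynomial.eval_smul, smul_eq_mul]
        ring)
    (fun P Q Q' => by
      rw [← I_add (hc _ _) (hc _ _)]
      exact I_congr fun x _ => by
        simp only [ev, iterate_map_add, Polynomial.eval_add]
        ring)
    (fun c P Q => by
      rw [smul_eq_mul, ← I_smul]
      exact I_congr fun x _ => by
        simp only [ev, Polynomial.iterate_derivative_smul, Polynomial.eval_smul, smul_eq_mul]
        ring)

theorem bil_apply (j : ℕ) (P Q : Polynomial ℝ) :
    bil j P Q = I (fun x => sg x ^ j * D j (ev P) x * D j (ev Q) x) := by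
  unfold bil
  rw [LinearMap.mk₂_apply]
  exact I_congr fun x hx => by rw [D_ev _ _ hx, D_ev _ _ hx]; ring

theorem En_eq_bil (j : ℕ) (P : Polynomial ℝ) : En j (ev P) = bil j P P := by
  rw [bil_apply]
  exact I_congr fun x _ => by ring

theorem hasDerivWithinAt_bil {N : ℕ} {P : ℝ → Polynomial ℝ} {R : Polynomial ℝ} {s : Set ℝ} {t : ℝ}
    (hP : ∀ t, (P t).natDegree ≤ N) (hR : R.natDegree ≤ N)
    (h : ∀ k, HasDerivWithinAt (fun t => (P t).coeff k) (R.coeff k) s t) (j : ℕ) :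
    HasDerivWithinAt (fun t => En j (ev (P t))) (2 * bil j (P t) R) s t := by
  have key : ∀ S T : Polynomial ℝ, S.natDegree ≤ N →
      bil j S T = ∑ k ∈ Finset.range (N + 1), S.coeff k * bil j (X ^ k) T := by
    intro S T hS
    conv_lhs => rw [S.as_sum_range' (N + 1) (by omega)]
    rw [map_sum, LinearMap.sum_apply]
    refine Finset.sum_congr rfl fun k _ => ?_
    rw [← Polynomial.C_mul_X_pow_eq_monomial, ← Polynomial.smul_eq_C_mul, map_smul,
      LinearMap.smul_apply, smul_eq_mul]
  have hsymm : ∀ S T, bil j S T = bil j T S := by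
    intro S T
    rw [bil_apply, bil_apply]
    exact I_congr fun x _ => by ring
  have h1 : (fun t => En j (ev (P t)))
      = fun t => ∑ k ∈ Finset.range (N + 1), (P t).coeff k * bil j (X ^ k) (P t) := by
    funext t
    rw [En_eq_bil, key _ _ (hP t)]
  rw [h1]
  have h2 : HasDerivWithinAt
      (fun t => ∑ k ∈ Finset.range (N + 1), (P t).coeff k * bil j (X ^ k) (P t))
      (∑ k ∈ Finset.range (N + 1), (R.coeff k * bil j (X ^ k) (P t)
        + (P t).coeff k * bil j (X ^ k) R)) s t :=
    HasDerivWithinAt.fun_sum fun k _ => (h k).mul (hasDerivWithinAt_lin hP hR h (bil j (X ^ k)))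
  refine h2.congr_deriv ?_
  rw [Finset.sum_add_distrib, ← key _ _ hR, ← key _ _ (hP t), hsymm R]
  ring

section
variable {P0 : Polynomial ℝ} {N : ℕ} {P Q : ℝ → Polynomial ℝ}

theorem Gal.weak_psi (g : Gal P0 N P Q) (t : ℝ) {R : Polynomial ℝ} (hR : R.natDegree ≤ N) (j : ℕ) :
    bil j R (Q t) = I (fun x => sg x ^ j * D j (ev R) x * Uu (TP (P t)) (j + 1) x) := by
  have hT := sm_TP (P t)
  rw [bil_apply, ← I_psi j R (sm_ev (Q t)), g.weak t _ (natDegree_psi hR j),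
    I_psi j R (sm_Uu hT 1)]
  exact I_congr fun x hx => by rw [D_Uu hT j 1 hx, add_comm 1 j]

theorem Gal.en_deriv (g : Gal P0 N P Q) {t : ℝ} (ht : t ∈ Icc (0 : ℝ) N) (j : ℕ) :
    HasDerivWithinAt (fun t => En j (ev (P t)))
      (2 * I (fun x => sg x ^ j * D j (ev (P t)) x * Uu (TP (P t)) (j + 1) x))
      (Icc (0 : ℝ) N) t := by
  rw [← g.weak_psi t (g.degP t) j]
  exact hasDerivWithinAt_bil g.degP (g.degQ t) (g.der t ht) j

theorem Gal.en_Q_le (g : Gal P0 N P Q) (t : ℝ) (j : ℕ) :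
    En j (ev (Q t)) ≤ I (fun x => sg x ^ j * Uu (TP (P t)) (j + 1) x ^ 2) := by
  have h := g.weak_psi t (g.degQ t) j
  rw [← En_eq_bil] at h
  have hT := sm_TP (P t)
  have c1 := continuousOn_sg
  have c2 := (sm_ev (Q t)).continuousOn_D j
  have c3 := (sm_Uu hT (j + 1)).continuousOn
  have := I_le_lin (f := fun x => sg x ^ j * D j (ev (Q t)) x * Uu (TP (P t)) (j + 1) x)
    (g := fun x => sg x ^ j * D j (ev (Q t)) x ^ 2)
    (h := fun x => sg x ^ j * Uu (TP (P t)) (j + 1) x ^ 2) 0 (1 / 2) (1 / 2)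
    (by fun_prop) (by fun_prop) (by fun_prop) (fun x hx => by
      have := pow_nonneg (sg_nonneg hx) j
      nlinarith [mul_nonneg this (sq_nonneg (D j (ev (Q t)) x - Uu (TP (P t)) (j + 1) x))])
  rw [← h] at this
  change _ ≤ 0 / 100 + 1 / 2 * En j (ev (Q t)) + _ at this
  linarith
end

theorem FF_der (P : Polynomial ℝ) : ∀ x ∈ J, HasDerivWithinAt (FF P) (ev P x) J x :=
  fun x _ => (FF_hasDerivAt P x).hasDerivWithinAt

theorem FF_bound {P : Polynomial ℝ} {M : ℝ} (h : ∀ x ∈ J, |ev P x| ≤ M) :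
    ∀ x ∈ J, |FF P x| ≤ M + 1 := by
  intro x hx
  have := abs_sub_le_I (FF_der P) (cont_ev P J) (continuousOn_const (c := M)) h
    (show (1 : ℝ) ∈ J by constructor <;> norm_num) hx
  rw [FF_one, I_const] at this
  have hM : 0 ≤ M := (abs_nonneg _).trans (h x hx)
  rw [abs_le] at *
  constructor <;> linarith

theorem energy_ineq_C1 (j : ℕ) (hj : j ≤ 3) (M : ℝ) : ∃ C, 0 ≤ C ∧ ∀ P : Polynomial ℝ,
    (∀ x ∈ J, |ev P x| ≤ M) → (∀ x ∈ J, wt (√(sg x)) (ev P) x 1 ≤ M) →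
    (3 ≤ j → En (j - 1) (ev P) ≤ M) →
    I (fun x => sg x ^ j * D j (ev P) x * Uu (TP P) (j + 1) x) ≤ C * (1 + En j (ev P)) := by
  obtain ⟨C, hC, h⟩ := dissip j (M + 1)
  refine ⟨C, hC, fun P h0 h1 hE => h (FF P) (ev P) (sm_FF P) (sm_ev P) (FF_der P) (FF_bound h0)
    (fun x hx l hl => ?_) (fun h3 => (hE h3).trans (by linarith))⟩
  have hl2 : l < 2 := by omega
  interval_cases l
  · have := h0 x hx
    simp only [wt, pow_zero, one_mul, D_zero]; linarith
  · have := h1 x hx; linarith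

theorem sup_of_En (M : ℝ) : ∃ K, ∀ u, Sm u → (∀ i < 3, En i u ≤ M) →
    ∀ x ∈ J, |u x| ≤ K ∧ wt (√(sg x)) u x 1 ≤ K := by
  obtain ⟨C0, hC0, h0⟩ := hardy 0
  obtain ⟨C1, hC1, h1⟩ := sobolev 0
  refine ⟨(101 * (M + C0 * (M + M)) + C1 * (M + M)) + 1, fun u hu hM x hx => ?_⟩
  have e0 := hM 0 (by norm_num)
  have e1 := hM 1 (by norm_num)
  have e2 := hM 2 (by norm_num)
  have p0 : 0 ≤ M := (Nw_nonneg _ _ _).trans e0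
  have s0 := sobolev_zero hu 0 hx
  rw [D_zero] at s0
  have s1 : Nw 0 (0 + 1) u ≤ C0 * (M + M) := (h0 u hu 1).trans (by gcongr)
  have s2 : sg x ^ (0 + 1) * D 1 u x ^ 2 ≤ C1 * (M + M) := (h1 u hu 1 x hx).trans (by gcongr)
  have w2 := wt_sq hx u 1
  rw [zero_add] at s2
  have hq1 : 0 ≤ C0 * (M + M) := by positivity
  have hq2 : 0 ≤ C1 * (M + M) := by positivity
  have aux : ∀ y Z : ℝ, 0 ≤ Z → y ^ 2 ≤ Z → y ≤ Z + 1 := fun y Z hZ h => by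
    nlinarith [sq_nonneg (y - 1)]
  constructor
  · refine aux _ _ (by positivity) ?_
    rw [sq_abs]; linarith
  · refine (aux _ (C1 * (M + M)) hq2 ?_).trans (by linarith)
    rw [w2]; exact s2

theorem energy_ineq (j : ℕ) (M : ℝ) : ∃ C, 0 ≤ C ∧ ∀ P : Polynomial ℝ,
    (∀ i < max 3 j, En i (ev P) ≤ M) →
    I (fun x => sg x ^ j * D j (ev P) x * Uu (TP P) (j + 1) x) ≤ C * (1 + En j (ev P)) := by
  obtain ⟨K, hK⟩ := sup_of_En M
  have hW : ∃ W, ∀ u, Sm u → (∀ i < max 3 j, En i u ≤ M) →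
      ∀ x ∈ J, ∀ l < max 2 (j - 1), wt (√(sg x)) u x l ≤ W := by
    have : ∀ l : ℕ, ∃ Wl, 0 ≤ Wl ∧ ∀ u, Sm u → (∀ i < max 3 j, En i u ≤ M) →
      ∀ x ∈ J, l < max 2 (j - 1) → wt (√(sg x)) u x l ≤ Wl := by
      intro l
      rcases Nat.eq_zero_or_pos l with rfl | hl
      · refine ⟨|K|, abs_nonneg _, fun u hu h x hx _ => ?_⟩
        simp only [wt, pow_zero, one_mul, D_zero]
        exact ((hK u hu (fun i hi => h i (lt_max_of_lt_left hi)) x hx).1).trans (le_abs_self _)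
      · obtain ⟨C1, hC1, h1⟩ := sobolev (l - 1)
        refine ⟨|K| + (C1 * (|M| + |M|) + 1), by positivity, fun u hu h x hx hlt => ?_⟩
        rcases Nat.lt_or_ge l 2 with h2 | h2
        · have : l = 1 := by omega
          subst this
          have := ((hK u hu (fun i hi => h i (lt_max_of_lt_left hi)) x hx).2).trans
            (le_abs_self _)
          have : 0 ≤ C1 * (|M| + |M|) + 1 := by positivity
          linarith
        · have hs := h1 u hu l x hx
          rw [show l - 1 + 1 = l by omega, show l - 1 + 2 = l + 1 by omega] at hs
          have a1 := (h l (by omega)).trans (le_abs_self _)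
          have a2 := (h (l + 1) (by omega)).trans (le_abs_self _)
          have hs' : sg x ^ l * D l u x ^ 2 ≤ C1 * (|M| + |M|) := hs.trans (by gcongr)
          rw [← wt_sq hx] at hs'
          have := abs_nonneg K
          nlinarith [sq_nonneg (wt (√(sg x)) u x l - 1)]
    choose Wl hW0 hWl using this
    refine ⟨∑ l ∈ Finset.range (max 2 (j - 1)), Wl l, fun u hu h x hx l hl => ?_⟩
    exact (hWl l u hu h x hx hl).trans
      (Finset.single_le_sum (fun i _ => hW0 i) (Finset.mem_range.2 hl))
  obtain ⟨W, hW⟩ := hW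
  obtain ⟨C, hC, h⟩ := dissip j (|K| + 1 + |W| + |M|)
  have k0 := abs_nonneg K
  have w0 := abs_nonneg W
  have m0 := abs_nonneg M
  refine ⟨C, hC, fun P hE => h (FF P) (ev P) (sm_FF P) (sm_ev P) (FF_der P)
    (fun x hx => ?_) (fun x hx l hl => ?_) (fun h3 => ?_)⟩
  · have := FF_bound (M := |K|) (fun x hx => ((hK _ (sm_ev P)
      (fun i hi => hE i (lt_max_of_lt_left hi)) x hx).1).trans (le_abs_self _)) x hx
    linarith
  · have := (hW _ (sm_ev P) hE x hx l hl).trans (le_abs_self _)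
    linarith
  · have := (hE (j - 1) (by omega)).trans (le_abs_self _)
    linarith

/-- The sum of the three lowest energies. -/
noncomputable def F2 (u : ℝ → ℝ) : ℝ := En 0 u + En 1 u + En 2 u

theorem En_le_F2 (u : ℝ → ℝ) {i : ℕ} (hi : i < 3) : En i u ≤ F2 u := by
  have h0 := Nw_nonneg 0 0 u
  have h1 := Nw_nonneg 1 1 u
  have h2 := Nw_nonneg 2 2 u
  unfold F2 En
  interval_cases i <;> linarith

theorem deriv_Ici_of_Icc {E : ℝ → ℝ} {E' : ℝ} {N t : ℝ} (h : HasDerivWithinAt E E' (Icc 0 N) t)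
    (h0 : 0 ≤ t) (h1 : t < N) : HasDerivWithinAt E E' (Ici t) t :=
  h.mono_of_mem_nhdsWithin
    (mem_of_superset (Icc_mem_nhdsGE h1) (Icc_subset_Icc_left h0))

theorem gronwall_barrier {E E' : ℝ → ℝ} {T N C : ℝ} (hTN : T ≤ N) (hC : 0 ≤ C)
    (h : ∀ t ∈ Icc 0 N, HasDerivWithinAt E (E' t) (Icc 0 N) t) (h0 : 0 ≤ E 0)
    (hb : ∀ t ∈ Icc 0 T, E' t ≤ C * (1 + E t)) :
    ∀ t ∈ Icc 0 T, E t ≤ (1 + E 0) * exp ((C + C + 1) * T) := by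
  intro t ht
  have hB : ∀ t, HasDerivAt (fun t => (1 + E 0) * exp ((C + C + 1) * t))
      ((1 + E 0) * (exp ((C + C + 1) * t) * (C + C + 1))) t := fun t => by
    have := (((hasDerivAt_id t).const_mul (C + C + 1)).exp).const_mul (1 + E 0)
    simpa using this
  have hlt : ∀ t ∈ Ico 0 T, t < N := fun t ht => lt_of_lt_of_le ht.2 hTN
  have key := image_le_of_deriv_right_lt_deriv_boundary' (f := E) (f' := E') (a := 0) (b := T)
    (B := fun t => (1 + E 0) * exp ((C + C + 1) * t))
    (B' := fun t => (1 + E 0) * (exp ((C + C + 1) * t) * (C + C + 1)))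
    (fun s hs => ((h s ⟨hs.1, hs.2.trans hTN⟩).continuousWithinAt).mono
      (Icc_subset_Icc_right hTN))
    (fun s hs => deriv_Ici_of_Icc (h s ⟨hs.1, (hlt s hs).le⟩) hs.1 (hlt s hs)) (by simp)
    (fun s _ => (hB s).continuousAt.continuousWithinAt) (fun s _ => (hB s).hasDerivWithinAt)
    (fun s hs he => by
      have e1 := hb s ⟨hs.1, hs.2.le⟩
      have e2 : 1 ≤ (1 + E 0) * exp ((C + C + 1) * s) := by
        have : 1 ≤ exp ((C + C + 1) * s) := one_le_exp (by have := hs.1; positivity)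
        nlinarith
      rw [he] at e1
      nlinarith) ht
  refine key.trans ?_
  have := ht.2
  gcongr

section
variable {P0 : Polynomial ℝ}

theorem Gal.En_bound (T K : ℝ) (j : ℕ) : ∃ M, ∀ (N : ℕ) P Q, T ≤ N → Gal P0 N P Q →
    (∀ t ∈ Icc 0 T, F2 (ev (P t)) ≤ K) → ∀ t ∈ Icc 0 T, En j (ev (P t)) ≤ M := by
  induction j using Nat.strong_induction_on with
  | _ j ih =>
  rcases Nat.lt_or_ge j 3 with h3 | h3
  · exact ⟨K, fun N P Q _ _ h t ht => (En_le_F2 _ h3).trans (h t ht)⟩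
  choose! M hM using ih
  have hM0 : ∀ i < j, M i ≤ ∑ i ∈ Finset.range j, |M i| := fun i hi => (le_abs_self _).trans
    (Finset.single_le_sum (f := fun i => |M i|) (fun i _ => abs_nonneg _) (Finset.mem_range.2 hi))
  obtain ⟨C, hC, h⟩ := energy_ineq j (∑ i ∈ Finset.range j, |M i|)
  refine ⟨(1 + En j (ev P0)) * exp ((2 * C + 2 * C + 1) * T), fun N P Q hTN g hF t ht => ?_⟩
  have := gronwall_barrier (E := fun t => En j (ev (P t))) hTN (mul_nonneg zero_le_two hC)
    (fun t ht => g.en_deriv ht j) (Nw_nonneg _ _ _) (fun t ht => by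
      have := h (P t) (fun i hi => (hM i (by omega) N P Q hTN g hF t ht).trans (hM0 i (by omega)))
      linarith) t ht
  simpa only [g.init] using this

theorem Gal.F2_local (K : ℝ) : ∃ τ > 0, ∀ (N : ℕ) P Q, Gal P0 N P Q → ∀ t1, 0 ≤ t1 →
    F2 (ev (P t1)) ≤ K → ∀ t, t1 ≤ t → t ≤ t1 + τ → t ≤ N → F2 (ev (P t)) ≤ K + 1 := by
  obtain ⟨C0, hC0, h0⟩ := energy_ineq 0 (K + 1)
  obtain ⟨C1, hC1, h1⟩ := energy_ineq 1 (K + 1)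
  obtain ⟨C2, hC2, h2⟩ := energy_ineq 2 (K + 1)
  set L : ℝ := 2 * (C0 + C1 + C2) * (1 + |K + 1|) + 1 with hL
  have hL0 : 0 < L := by positivity
  refine ⟨1 / L, by positivity, fun N P Q g t1 ht1 hK t htt1 htτ htN => ?_⟩
  rcases htt1.eq_or_lt with rfl | hlt
  · linarith
  have hd : ∀ s ∈ Icc (0 : ℝ) N, HasDerivWithinAt (fun t => F2 (ev (P t))) _ (Icc (0 : ℝ) N) s :=
    fun s hs => ((g.en_deriv hs 0).add (g.en_deriv hs 1)).add (g.en_deriv hs 2)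
  have hB : ∀ s, HasDerivAt (fun t => K + L * (t - t1)) L s := fun s => by
    have := (((hasDerivAt_id s).sub_const t1).const_mul L).const_add K
    simpa using this
  have key := image_le_of_deriv_right_lt_deriv_boundary' (f := fun t => F2 (ev (P t)))
    (a := t1) (b := t) (B := fun t => K + L * (t - t1)) (B' := fun _ => L)
    (fun s hs => ((hd s ⟨ht1.trans hs.1, hs.2.trans htN⟩).continuousWithinAt).mono
      (Icc_subset_Icc ht1 htN))
    (fun s hs => deriv_Ici_of_Icc (hd s ⟨ht1.trans hs.1, hs.2.le.trans htN⟩) (ht1.trans hs.1)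
      (hs.2.trans_le htN)) (by simpa using hK)
    (fun s _ => (hB s).continuousAt.continuousWithinAt) (fun s _ => (hB s).hasDerivWithinAt)
    (fun s hs he => by
      have hle : F2 (ev (P s)) ≤ K + 1 := by
        rw [he]
        have : L * (s - t1) ≤ L * (1 / L) := by
          have := hs.2
          gcongr; linarith
        rw [mul_one_div_cancel hL0.ne'] at this
        linarith
      have hi : ∀ j, j < 3 → ∀ i < max 3 j, En i (ev (P s)) ≤ K + 1 := fun j hj i hi =>
        (En_le_F2 _ (by omega)).trans hle
      have hb : ∀ j < 3, 1 + En j (ev (P s)) ≤ 1 + |K + 1| := fun j hj => by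
        have := (hi j hj j (by omega)).trans (le_abs_self _)
        linarith
      have a0 := (h0 (P s) (hi 0 (by norm_num))).trans
        (mul_le_mul_of_nonneg_left (hb 0 (by norm_num)) hC0)
      have a1 := (h1 (P s) (hi 1 (by norm_num))).trans
        (mul_le_mul_of_nonneg_left (hb 1 (by norm_num)) hC1)
      have a2 := (h2 (P s) (hi 2 (by norm_num))).trans
        (mul_le_mul_of_nonneg_left (hb 2 (by norm_num)) hC2)
      rw [hL]
      linarith) (right_mem_Icc.2 hlt.le)
  refine key.trans ?_
  have : L * (t - t1) ≤ L * (1 / L) := by gcongr; linarith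
  rw [mul_one_div_cancel hL0.ne'] at this
  linarith

theorem Gal.F2_of_C1 (T' M : ℝ) : ∃ K, ∀ (N : ℕ) P Q T, T ≤ T' → T ≤ N → Gal P0 N P Q →
    (∀ t ∈ Icc 0 T, ∀ x ∈ J, |ev (P t) x| ≤ M ∧ |D 1 (ev (P t)) x| ≤ M) →
    ∀ t ∈ Icc 0 T, F2 (ev (P t)) ≤ K := by
  obtain ⟨C, hC, h⟩ := energy_ineq_C1 2 (by norm_num) M
  refine ⟨M ^ 2 / 100 + M ^ 2 / 100 + (1 + En 2 (ev P0)) * exp ((2 * C + 2 * C + 1) * T'),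
    fun N P Q T hTT hTN g hM t ht => ?_⟩
  have h2 := gronwall_barrier (E := fun t => En 2 (ev (P t))) hTN (mul_nonneg zero_le_two hC)
    (fun t ht => g.en_deriv ht 2) (Nw_nonneg _ _ _) (fun t ht => by
      have := h (P t) (fun x hx => (hM t ht x hx).1) (fun x hx => by
        have h1 := (hM t ht x hx).2
        rw [wt, pow_one]
        exact (mul_le_of_le_one_left (abs_nonneg _) (sqrt_sg_le hx)).trans h1) (by norm_num)
      linarith) t ht
  rw [g.init] at h2
  have he : (1 + En 2 (ev P0)) * exp ((2 * C + 2 * C + 1) * T) ≤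
      (1 + En 2 (ev P0)) * exp ((2 * C + 2 * C + 1) * T') := by
    have := Nw_nonneg 2 2 (ev P0)
    refine mul_le_mul_of_nonneg_left (exp_le_exp.2 ?_) (by unfold En; linarith)
    exact mul_le_mul_of_nonneg_left hTT (by positivity)
  have hsq : ∀ y : ℝ, |y| ≤ M → y ^ 2 ≤ M ^ 2 := fun y hy =>
    sq_le_sq' (abs_le.1 hy).1 (abs_le.1 hy).2
  have h0 : En 0 (ev (P t)) ≤ M ^ 2 / 100 := by
    rw [← I_const]
    refine I_mono (Nw_cont (sm_ev _) 0 0) continuousOn_const fun x hx => ?_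
    rw [pow_zero, one_mul, D_zero]
    exact hsq _ (hM t ht x hx).1
  have h1 : En 1 (ev (P t)) ≤ M ^ 2 / 100 := by
    rw [← I_const]
    refine I_mono (Nw_cont (sm_ev _) 1 1) continuousOn_const fun x hx => ?_
    rw [pow_one]
    exact (mul_le_of_le_one_left (sq_nonneg _) (sg_le_one hx)).trans (hsq _ (hM t ht x hx).2)
  unfold F2
  linarith

theorem TP_D_bound (k : ℕ) (M : ℝ) : ∃ K, ∀ P : Polynomial ℝ,
    (∀ i ≤ max 2 k, ∀ x ∈ J, |D i (ev P) x| ≤ M) → ∀ x ∈ J, |D k (TP P) x| ≤ K := by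
  obtain ⟨C, hC, h⟩ := D_cp_bound k Hf sm3_Hf (M + 1)
  refine ⟨C * (1 + M + M), fun P hP x hx => ?_⟩
  have hb := FF_bound (P := P) (M := M) (fun x hx => by
    have := hP 0 (by omega) x hx
    rwa [D_zero] at this)
  have hw : ∀ l, wt 1 (ev P) x l = |D l (ev P) x| := fun l => by simp [wt]
  have := h (FF P) (ev P) 1 x ⟨sm_FF P, sm_ev P, FF_der P, hx, zero_le_one, le_rfl, hb x hx,
    fun l hl => by
      rw [hw]
      have := hP l (by omega) x hx
      linarith⟩
  rw [hw, hw, one_pow, one_mul] at this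
  refine this.trans (mul_le_mul_of_nonneg_left ?_ hC)
  have a := hP (k - 1) (by omega) x hx
  have b := hP k (by omega) x hx
  linarith

theorem Uu_bound (k : ℕ) (M : ℝ) : ∃ K, ∀ u : ℝ → ℝ,
    (∀ i ≤ k + 1, ∀ x ∈ J, |D i u x| ≤ M) → ∀ x ∈ J, |Uu u k x| ≤ K := by
  refine ⟨M + k * M + |(k : ℝ) * (k - 1)| * M, fun u hu x hx => ?_⟩
  have a := hu (k + 1) le_rfl x hx
  have b := hu k (by omega) x hx
  have c := hu (k - 1) (by omega) x hx
  have m0 : 0 ≤ M := (abs_nonneg _).trans a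
  have s1 := sg_le_one hx
  have s0 := sg_nonneg hx
  have s2 := abs_sg'_le hx
  unfold Uu
  refine (abs_sub _ _).trans (add_le_add ((abs_add_le _ _).trans (add_le_add ?_ ?_)) ?_)
  · rw [abs_mul, abs_of_nonneg s0]
    calc _ ≤ 1 * M := by gcongr
      _ = M := one_mul M
  · rw [abs_mul, abs_mul, Nat.abs_cast]
    calc _ ≤ (k : ℝ) * 1 * M := by gcongr
      _ = _ := by ring
  · rw [abs_mul]; gcongr

theorem Gal.D_bound (T K : ℝ) (j : ℕ) : ∃ M, ∀ (N : ℕ) P Q, T ≤ N → Gal P0 N P Q →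
    (∀ t ∈ Icc 0 T, F2 (ev (P t)) ≤ K) → ∀ t ∈ Icc 0 T, ∀ x ∈ J,
      |D j (ev (P t)) x| ≤ M ∧ |D j (ev (Q t)) x| ≤ M := by
  choose ME hME using Gal.En_bound (P0 := P0) T K
  choose MP hMP using fun i => D_bound_of_En i ME
  have hP : ∀ i, ∀ (N : ℕ) P Q, T ≤ N → Gal P0 N P Q →
      (∀ t ∈ Icc 0 T, F2 (ev (P t)) ≤ K) → ∀ t ∈ Icc 0 T, ∀ x ∈ J, |D i (ev (P t)) x| ≤ MP i :=
    fun i N P Q hT g h t ht => hMP i _ (sm_ev _) fun j _ => hME j N P Q hT g h t ht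
  have hTh : ∀ k, ∃ MT, ∀ (N : ℕ) P Q, T ≤ N → Gal P0 N P Q →
      (∀ t ∈ Icc 0 T, F2 (ev (P t)) ≤ K) → ∀ t ∈ Icc 0 T, ∀ x ∈ J, |D k (TP (P t)) x| ≤ MT := by
    intro k
    obtain ⟨MT, h⟩ := TP_D_bound k (∑ i ∈ Finset.range (max 2 k + 1), |MP i|)
    refine ⟨MT, fun N P Q hT g hF t ht => h (P t) fun i hi x hx => ?_⟩
    exact (hP i N P Q hT g hF t ht x hx).trans ((le_abs_self _).trans
      (Finset.single_le_sum (f := fun i => |MP i|) (fun i _ => abs_nonneg _)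
        (Finset.mem_range.2 (by omega))))
  choose MT hMT using hTh
  have hU : ∀ k, ∃ MU, ∀ (N : ℕ) P Q, T ≤ N → Gal P0 N P Q →
      (∀ t ∈ Icc 0 T, F2 (ev (P t)) ≤ K) → ∀ t ∈ Icc 0 T, ∀ x ∈ J, |Uu (TP (P t)) k x| ≤ MU := by
    intro k
    obtain ⟨MU, h⟩ := Uu_bound k (∑ i ∈ Finset.range (k + 2), |MT i|)
    refine ⟨MU, fun N P Q hT g hF t ht => h (TP (P t)) fun i hi x hx => ?_⟩
    exact (hMT i N P Q hT g hF t ht x hx).trans ((le_abs_self _).trans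
      (Finset.single_le_sum (f := fun i => |MT i|) (fun i _ => abs_nonneg _)
        (Finset.mem_range.2 (by omega))))
  choose MU hMU using hU
  obtain ⟨MQ, hMQ⟩ := D_bound_of_En j (fun i => MU (i + 1) ^ 2 / 100)
  refine ⟨max (MP j) MQ, fun N P Q hT g hF t ht x hx => ⟨(hP j N P Q hT g hF t ht x hx).trans
    (le_max_left _ _), (hMQ _ (sm_ev _) (fun i _ => ?_) x hx).trans (le_max_right _ _)⟩⟩
  refine (g.en_Q_le t i).trans ?_
  rw [← I_const]
  refine I_mono ((continuousOn_sg.pow i).mul ((sm_Uu (sm_TP _) _).continuousOn.pow 2))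
    continuousOn_const fun x hx => ?_
  have := hMU (i + 1) N P Q hT g hF t ht x hx
  refine (mul_le_of_le_one_left (sq_nonneg _) (pow_le_one₀ (sg_nonneg hx) (sg_le_one hx))).trans ?_
  exact sq_le_sq' (abs_le.1 this).1 (abs_le.1 this).2
end

end LBMCF

namespace LBMCF
open scoped Topology ContDiff
open Polynomial (C X derivative)

theorem uniform_of_lipschitz {E ι : Type*} [PseudoMetricSpace E] {S : Set E} (hS : IsCompact S)
    {l : Filter ι} [l.NeBot] {u : ι → E → ℝ} {g : E → ℝ} {M : ℝ}
    (hu : ∀ᶠ i in l, ∀ y ∈ S, ∀ z ∈ S, |u i y - u i z| ≤ M * dist y z)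
    (hg : ∀ z ∈ S, Tendsto (fun i => u i z) l (𝓝 (g z))) {ε : ℝ} (hε : 0 < ε) :
    ∀ᶠ i in l, ∀ z ∈ S, |u i z - g z| ≤ ε := by
  have hgl : ∀ y ∈ S, ∀ z ∈ S, |g y - g z| ≤ M * dist y z := fun y hy z hz =>
    le_of_tendsto ((hg y hy).sub (hg z hz)).abs (hu.mono fun i h => h y hy z hz)
  set r := ε / (4 * (|M| + 1)) with hr
  have hM := abs_nonneg M
  have hr0 : 0 < r := by positivity
  have hMr : M * r ≤ ε / 4 := by
    have : M * r ≤ (|M| + 1) * r := by gcongr; linarith [le_abs_self M]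
    refine this.trans (le_of_eq ?_)
    rw [hr]; field_simp
  obtain ⟨t, htS, htf, ht⟩ := hS.finite_cover_balls hr0
  have h1 : ∀ᶠ i in l, ∀ y ∈ t, |u i y - g y| ≤ ε / 4 := by
    rw [htf.eventually_all]
    intro y hy
    have := (hg y (htS hy)).sub_const (g y)
    rw [sub_self] at this
    have := this.abs
    rw [abs_zero] at this
    exact this.eventually (ge_mem_nhds (by positivity))
  filter_upwards [h1, hu] with i h1 h2 z hz
  obtain ⟨y, hy, hzy⟩ := mem_iUnion₂.1 (ht hz)
  rw [Metric.mem_ball] at hzy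
  have hd : M * dist z y ≤ ε / 4 := by
    rcases le_or_gt 0 M with h | h
    · exact (mul_le_mul_of_nonneg_left hzy.le h).trans hMr
    · have : M * dist z y ≤ 0 := mul_nonpos_of_nonpos_of_nonneg h.le dist_nonneg
      linarith
  have a := (h2 z hz y (htS hy)).trans hd
  have b := h1 y hy
  have c := (hgl z hz y (htS hy)).trans hd
  rw [abs_le] at *
  constructor <;> linarith [a.1, a.2, b.1, b.2, c.1, c.2]

theorem taylor_one {u v : ℝ → ℝ} {s : Set ℝ} (hs : Convex ℝ s) {M : ℝ}
    (hu : ∀ x ∈ s, HasDerivWithinAt u (v x) s x) {x : ℝ} (hx : x ∈ s)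
    (hv : ∀ y ∈ s, |v y - v x| ≤ M * |y - x|) (hM : 0 ≤ M) {y : ℝ} (hy : y ∈ s) :
    |u y - u x - (y - x) * v x| ≤ M * |y - x| ^ 2 := by
  have hseg : segment ℝ x y ⊆ s := hs.segment_subset hx hy
  have := (convex_segment (𝕜 := ℝ) x y).norm_image_sub_le_of_norm_hasDerivWithin_le
    (f := fun z => u z - z * v x) (f' := fun z => v z - v x) (C := M * |y - x|)
    (fun z hz => by
      have := ((hu z (hseg hz)).mono hseg).fun_sub
        ((hasDerivWithinAt_id z (segment ℝ x y)).mul_const (v x))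
      simpa using this)
    (fun z hz => by
      refine (hv z (hseg hz)).trans ?_
      have : |z - x| ≤ |y - x| := by
        rw [segment_eq_uIcc] at hz
        exact abs_sub_left_of_mem_uIcc hz
      gcongr) (left_mem_segment ℝ x y) (right_mem_segment ℝ x y)
  rw [Real.norm_eq_abs, Real.norm_eq_abs] at this
  calc _ = |u y - y * v x - (u x - x * v x)| := by congr 1; ring
    _ ≤ M * |y - x| * |y - x| := this
    _ = _ := by ring

theorem hasDerivWithinAt_of_quadratic {u : ℝ → ℝ} {d M : ℝ} {s : Set ℝ} {x : ℝ}
    (h : ∀ y ∈ s, |u y - u x - (y - x) * d| ≤ M * |y - x| ^ 2) : HasDerivWithinAt u d s x := by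
  rw [hasDerivWithinAt_iff_isLittleO]
  have h1 : (fun y => u y - u x - (y - x) • d) =O[𝓝[s] x] fun y => (y - x) ^ 2 :=
    Asymptotics.IsBigO.of_bound M (by
      filter_upwards [self_mem_nhdsWithin] with y hy
      simpa [Real.norm_eq_abs] using h y hy)
  refine h1.trans_isLittleO ?_
  have h2 : (fun y : ℝ => y - x) =o[𝓝[s] x] fun _ => (1 : ℝ) := by
    rw [Asymptotics.isLittleO_one_iff]
    have : Tendsto (fun y : ℝ => y - x) (𝓝 x) (𝓝 (x - x)) := tendsto_id.sub_const x
    rw [sub_self] at this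
    exact this.mono_left nhdsWithin_le_nhds
  have := h2.mul_isBigO (Asymptotics.isBigO_refl (fun y : ℝ => y - x) (𝓝[s] x))
  simpa [sq] using this

theorem lipschitz_of_chain {u v : ℝ → ℝ} {s : Set ℝ} (hs : Convex ℝ s) {M : ℝ}
    (hu : ∀ x ∈ s, HasDerivWithinAt u (v x) s x) (hv : ∀ x ∈ s, |v x| ≤ M) :
    ∀ y ∈ s, ∀ z ∈ s, |u y - u z| ≤ M * dist y z := fun y hy z hz => by
  have := hs.norm_image_sub_le_of_norm_hasDerivWithin_le hu (fun x hx => hv x hx) hz hy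
  simpa [Real.dist_eq] using this

theorem abs_I_le {g : ℝ → ℝ} {M : ℝ} (hg : ∀ x ∈ J, |g x| ≤ M) : |I g| ≤ M := by
  have hM : 0 ≤ M := (abs_nonneg _).trans (hg 1 (by constructor <;> norm_num))
  have := intervalIntegral.norm_integral_le_of_norm_le_const (a := 1) (b := 101 / 100) (C := M)
    (f := g) (fun y hy => by
      rw [uIoc_of_le one_le_b] at hy
      exact hg y ⟨hy.1.le, hy.2⟩)
  refine this.trans ?_
  rw [abs_of_nonneg (by norm_num)]
  linarith

/-- A family of chains, eventually bounded at every order along an ultrafilter. -/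
structure UChain {ι : Type*} (l : Ultrafilter ι) (u : ι → ℕ → ℝ → ℝ) : Prop where
  chain : ∀ᶠ i in (l : Filter ι), ∀ k, ∀ x ∈ J, HasDerivWithinAt (u i k) (u i (k + 1) x) J x
  bound : ∀ k, ∃ M, ∀ᶠ i in (l : Filter ι), ∀ x ∈ J, |u i k x| ≤ M

/-- The ultralimit of a family of chains. -/
noncomputable def ulim {ι : Type*} (l : Ultrafilter ι) (u : ι → ℕ → ℝ → ℝ) (k : ℕ) (x : ℝ) : ℝ :=
  limUnder (l : Filter ι) (fun i => u i k x)

theorem tendsto_ulim_of_bound {ι : Type*} (l : Ultrafilter ι) {u : ι → ℝ} {M : ℝ}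
    (h : ∀ᶠ i in (l : Filter ι), |u i| ≤ M) : Tendsto u l (𝓝 (limUnder (l : Filter ι) u)) := by
  have hmem : Icc (-M) M ∈ (l.map u) := by
    rw [Ultrafilter.mem_map]
    exact h.mono fun i hi => abs_le.1 hi
  obtain ⟨z, _, hz⟩ := (isCompact_Icc (a := -M) (b := M)).ultrafilter_le_nhds (l.map u)
    (le_principal_iff.2 hmem)
  exact tendsto_nhds_limUnder ⟨z, hz⟩

section
variable {ι : Type*} {l : Ultrafilter ι} {u : ι → ℕ → ℝ → ℝ}

theorem UChain.tendsto (h : UChain l u) (k : ℕ) {x : ℝ} (hx : x ∈ J) :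
    Tendsto (fun i => u i k x) l (𝓝 (ulim l u k x)) := by
  obtain ⟨M, hM⟩ := h.bound k
  exact tendsto_ulim_of_bound l (hM.mono fun i hi => hi x hx)

theorem UChain.lipschitz (h : UChain l u) (k : ℕ) : ∃ M, 0 ≤ M ∧ ∀ᶠ i in (l : Filter ι), ∀ y ∈ J,
    ∀ z ∈ J, |u i k y - u i k z| ≤ M * dist y z := by
  obtain ⟨M, hM⟩ := h.bound (k + 1)
  refine ⟨|M|, abs_nonneg _, ?_⟩
  filter_upwards [hM, h.chain] with i hi hc
  exact lipschitz_of_chain (convex_Icc _ _) (hc k) fun x hx => (hi x hx).trans (le_abs_self _)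

theorem UChain.ulim_chain (h : UChain l u) (k : ℕ) {x : ℝ} (hx : x ∈ J) :
    HasDerivWithinAt (ulim l u k) (ulim l u (k + 1) x) J x := by
  obtain ⟨M, hM0, hM⟩ := h.lipschitz (k + 1)
  refine hasDerivWithinAt_of_quadratic (M := M) fun y hy => ?_
  have ht := (((h.tendsto k hy).sub (h.tendsto k hx)).sub
    ((h.tendsto (k + 1) hx).const_mul (y - x))).abs
  refine le_of_tendsto ht ?_
  filter_upwards [hM, h.chain] with i hi hc
  exact taylor_one (convex_Icc _ _) (hc k) hx
    (fun y hy => by simpa [Real.dist_eq] using hi y hy x hx) hM0 hy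

theorem UChain.uniform (h : UChain l u) (k : ℕ) {ε : ℝ} (hε : 0 < ε) :
    ∀ᶠ i in (l : Filter ι), ∀ x ∈ J, |u i k x - ulim l u k x| ≤ ε := by
  obtain ⟨M, _, hM⟩ := h.lipschitz k
  exact uniform_of_lipschitz isCompact_Icc hM (fun x hx => h.tendsto k hx) hε

theorem UChain.sm (h : UChain l u) (k : ℕ) : Sm (ulim l u k) :=
  sm_of_chain (fun k _ hx => h.ulim_chain k hx) k

theorem UChain.tendsto_I (h : UChain l u) (k : ℕ) {φ : ℝ → ℝ} (hφ : ContinuousOn φ J) :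
    Tendsto (fun i => I (fun x => φ x * u i k x)) l (𝓝 (I (fun x => φ x * ulim l u k x))) := by
  obtain ⟨K, hK⟩ := isCompact_Icc.exists_bound_of_continuousOn hφ
  have hK0 : 0 ≤ |K| := abs_nonneg K
  rw [Metric.tendsto_nhds]
  intro ε hε
  filter_upwards [h.uniform k (show 0 < ε / (2 * (|K| + 1)) by positivity), h.chain] with i hi hc
  have hcu : ContinuousOn (u i k) J := fun x hx => (hc k x hx).continuousWithinAt
  have hcl : ContinuousOn (ulim l u k) J := (h.sm k).continuousOn
  rw [Real.dist_eq, ← I_sub (f := fun x => φ x * u i k x)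
    (g := fun x => φ x * ulim l u k x) (hφ.mul hcu) (hφ.mul hcl)]
  refine lt_of_le_of_lt (abs_I_le (M := (|K| + 1) * (ε / (2 * (|K| + 1)))) fun x hx => ?_) ?_
  · rw [← mul_sub, abs_mul]
    have h1 := (hK x hx).trans (le_abs_self K)
    rw [Real.norm_eq_abs] at h1
    have h2 := hi x hx
    gcongr
    linarith
  · have : (|K| + 1) * (ε / (2 * (|K| + 1))) = ε / 2 := by field_simp
    rw [this]; linarith
end

theorem eqOn_of_moments {g h : ℝ → ℝ} (hg : ContinuousOn g J) (hh : ContinuousOn h J)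
    (H : ∀ ψ : Polynomial ℝ, I (fun x => ev ψ x * g x) = I (fun x => ev ψ x * h x)) :
    ∀ x ∈ J, g x = h x := by
  set d : ℝ → ℝ := fun x => g x - h x with hd
  have cd : ContinuousOn d J := hg.sub hh
  have H0 : ∀ ψ : Polynomial ℝ, I (fun x => ev ψ x * d x) = 0 := fun ψ => by
    have := I_sub (f := fun x => ev ψ x * g x) (g := fun x => ev ψ x * h x)
      ((cont_ev ψ J).mul hg) ((cont_ev ψ J).mul hh)
    rw [H ψ, sub_self] at this
    rw [← this]
    exact I_congr fun x _ => by simp only [hd]; ring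
  have hz : I (fun x => d x ^ 2) = 0 := by
    have h0 : 0 ≤ I (fun x => d x ^ 2) := I_nonneg fun x _ => sq_nonneg _
    refine le_antisymm (le_of_forall_pos_le_add fun ε hε => ?_) h0
    obtain ⟨K, hK⟩ := isCompact_Icc.exists_bound_of_continuousOn cd
    obtain ⟨ψ, hψ⟩ := exists_polynomial_near_of_continuousOn 1 (101 / 100) d cd
      (ε / (|K| + 1)) (by positivity)
    have e1 : I (fun x => d x ^ 2) = I (fun x => (d x - ev ψ x) * d x) := by
      have := I_sub (f := fun x => d x ^ 2) (g := fun x => ev ψ x * d x)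
        (cd.pow 2) ((cont_ev ψ J).mul cd)
      rw [H0, sub_zero] at this
      rw [← this]
      exact I_congr fun x _ => by ring
    rw [e1, zero_add]
    refine (le_abs_self _).trans (abs_I_le fun x hx => ?_)
    have h1 := (hK x hx).trans (le_abs_self K)
    rw [Real.norm_eq_abs] at h1
    have h2 := hψ x hx
    rw [abs_sub_comm] at h2
    rw [abs_mul]
    calc _ ≤ ε / (|K| + 1) * (|K| + 1) := by
          exact mul_le_mul h2.le (by linarith) (abs_nonneg _) (by positivity)
      _ = ε := by have := abs_nonneg K; field_simp
  intro x hx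
  exact sub_eq_zero.1 (eq_zero_of_I_sq cd hz x hx)

end LBMCF

namespace LBMCF
open scoped Topology ContDiff
open Polynomial (C X derivative)

/-- The chain of `x`-derivatives starting from the primitive of a polynomial. -/
noncomputable def pc (P : Polynomial ℝ) : ℕ → ℝ → ℝ
  | 0 => FF P
  | k + 1 => ev (derivative^[k] P)

theorem pc_chain (P : Polynomial ℝ) (k : ℕ) {x : ℝ} (hx : x ∈ J) :
    HasDerivWithinAt (pc P k) (pc P (k + 1) x) J x := by
  cases k with
  | zero => exact FF_der P x hx
  | succ k => exact (ev_chain P k x).hasDerivWithinAt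

theorem pc_succ (P : Polynomial ℝ) (k : ℕ) {x : ℝ} (hx : x ∈ J) : pc P (k + 1) x = D k (ev P) x :=
  (D_ev P k hx).symm

theorem abs_Th_sub_le {f g p q : ℝ → ℝ} {x M : ℝ} (hx : x ∈ J) (hf : |f x - g x| ≤ M)
    (hp : |p x - q x| ≤ M) : |Th f p x - Th g q x| ≤ 3 * M := by
  have h1 := (abs_arctan_sub_le (p x) (q x)).trans hp
  have h2 := abs_arctan_sub_le (x⁻¹ * f x) (x⁻¹ * g x)
  have hx1 : x⁻¹ ≤ 1 := inv_le_one_of_one_le₀ hx.1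
  have h0 := (J_bounds hx).2.2
  rw [← mul_sub, abs_mul, abs_of_pos (inv_pos.2 h0)] at h2
  have h3 : x⁻¹ * |f x - g x| ≤ 1 * M := mul_le_mul hx1 hf (abs_nonneg _) zero_le_one
  simp only [cp, Hf]
  rw [abs_le] at h1 h2 ⊢
  constructor <;> linarith [h1.1, h1.2, h2.1, h2.2]

/-- Galerkin approximations on `[0, T]`, bounded along an ultrafilter. -/
structure Fam (P0 : Polynomial ℝ) (P Q : ℕ → ℝ → Polynomial ℝ) (T : ℝ) (l : Ultrafilter ℕ) :
    Prop where
  gal : ∀ᶠ N in (l : Filter ℕ), Gal P0 N (P N) (Q N)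
  le : ∀ n : ℝ, ∀ᶠ N : ℕ in (l : Filter ℕ), n ≤ N
  bd : ∃ K, ∀ᶠ N in (l : Filter ℕ), ∀ t ∈ Icc 0 T, F2 (ev (P N t)) ≤ K

/-- The limit of the Galerkin approximations. -/
noncomputable def gl (P : ℕ → ℝ → Polynomial ℝ) (l : Ultrafilter ℕ) (j : ℕ) (t x : ℝ) : ℝ :=
  ulim l (fun N => pc (P N t)) j x

section
variable {P0 : Polynomial ℝ} {P Q : ℕ → ℝ → Polynomial ℝ} {T : ℝ} {l : Ultrafilter ℕ}

theorem Fam.D_bound (h : Fam P0 P Q T l) (j : ℕ) : ∃ M, ∀ᶠ N in (l : Filter ℕ), ∀ t ∈ Icc 0 T,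
    ∀ x ∈ J, |D j (ev (P N t)) x| ≤ M ∧ |D j (ev (Q N t)) x| ≤ M := by
  obtain ⟨K, hK⟩ := h.bd
  obtain ⟨M, hM⟩ := Gal.D_bound (P0 := P0) T K j
  refine ⟨M, ?_⟩
  filter_upwards [hK, h.gal, h.le T] with N h1 h2 h3
  exact hM N _ _ h3 h2 h1

theorem Fam.pc_bound (h : Fam P0 P Q T l) (j : ℕ) : ∃ M, ∀ᶠ N in (l : Filter ℕ), ∀ t ∈ Icc 0 T,
    ∀ x ∈ J, |pc (P N t) j x| ≤ M := by
  cases j with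
  | zero =>
    obtain ⟨M, hM⟩ := h.D_bound 0
    refine ⟨M + 1, ?_⟩
    filter_upwards [hM] with N h1 t ht x hx
    exact FF_bound (fun x hx => by have := (h1 t ht x hx).1; rwa [D_zero] at this) x hx
  | succ j =>
    obtain ⟨M, hM⟩ := h.D_bound j
    refine ⟨M, ?_⟩
    filter_upwards [hM] with N h1 t ht x hx
    rw [pc_succ _ _ hx]
    exact (h1 t ht x hx).1

theorem pc_time_lip {N : ℕ} {p q : ℝ → Polynomial ℝ} (g : Gal P0 N p q) (hT : T ≤ N) {j : ℕ} {M : ℝ}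
    (hM : ∀ t ∈ Icc 0 T, ∀ x ∈ J, |D j (ev (q t)) x| ≤ M) {x : ℝ} (hx : x ∈ J) :
    ∀ t ∈ Icc 0 T, ∀ s ∈ Icc 0 T, |pc (p t) (j + 1) x - pc (p s) (j + 1) x| ≤ M * dist t s := by
  refine lipschitz_of_chain (v := fun t => D j (ev (q t)) x) (convex_Icc 0 T) (fun t ht => ?_)
    fun t ht => hM t ht x hx
  have ht' : t ∈ Icc (0 : ℝ) N := ⟨ht.1, ht.2.trans hT⟩
  have := hasDerivWithinAt_lin g.degP (g.degQ t) (g.der t ht')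
    ((Polynomial.leval x).comp (derivative ^ j))
  rw [D_ev _ _ hx]
  simpa [pc, Module.End.pow_apply] using this.mono (Icc_subset_Icc_right hT)

theorem Fam.time_lip (h : Fam P0 P Q T l) (j : ℕ) : ∃ M, 0 ≤ M ∧ ∀ᶠ N in (l : Filter ℕ),
    ∀ t ∈ Icc 0 T, ∀ s ∈ Icc 0 T, ∀ x ∈ J, |pc (P N t) j x - pc (P N s) j x| ≤ M * dist t s := by
  obtain ⟨M, hM⟩ := h.D_bound (j - 1)
  refine ⟨|M|, abs_nonneg _, ?_⟩
  filter_upwards [hM, h.gal, h.le T] with N h1 h2 h3 t ht s hs x hx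
  have h4 := fun x hx => pc_time_lip (j := j - 1) (M := |M|) h2 h3
    (fun t ht x hx => ((h1 t ht x hx).2).trans (le_abs_self M)) hx t ht s hs (x := x)
  cases j with
  | succ j => exact h4 x hx
  | zero =>
    have h5 := lipschitz_of_chain (u := fun x => FF (P N t) x - FF (P N s) x)
      (v := fun x => ev (P N t) x - ev (P N s) x) (convex_Icc 1 (101 / 100))
      (fun x hx => (FF_der _ x hx).fun_sub (FF_der _ x hx)) (fun x hx => h4 x hx) x hx 1
      (by constructor <;> norm_num)
    simp only [FF_one, sub_self, sub_zero] at h5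
    refine h5.trans ?_
    have : dist x 1 ≤ 1 := by
      rw [Real.dist_eq, abs_of_nonneg (by linarith [hx.1])]; linarith [hx.2]
    have h6 : 0 ≤ |M| * dist t s := by positivity
    nlinarith

theorem Fam.uchain (h : Fam P0 P Q T l) {t : ℝ} (ht : t ∈ Icc 0 T) :
    UChain l (fun N => pc (P N t)) where
  chain := Eventually.of_forall fun N k x hx => pc_chain _ k hx
  bound k := by
    obtain ⟨M, hM⟩ := h.pc_bound k
    exact ⟨M, hM.mono fun N h1 => h1 t ht⟩

theorem Fam.tendsto (h : Fam P0 P Q T l) (j : ℕ) {t : ℝ} (ht : t ∈ Icc 0 T) {x : ℝ} (hx : x ∈ J) :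
    Tendsto (fun N => pc (P N t) j x) l (𝓝 (gl P l j t x)) := (h.uchain ht).tendsto j hx

theorem Fam.gl_chain (h : Fam P0 P Q T l) (j : ℕ) {t : ℝ} (ht : t ∈ Icc 0 T) {x : ℝ} (hx : x ∈ J) :
    HasDerivWithinAt (gl P l j t) (gl P l (j + 1) t x) J x := (h.uchain ht).ulim_chain j hx

theorem Fam.gl_bound (h : Fam P0 P Q T l) (j : ℕ) : ∃ M, ∀ t ∈ Icc 0 T, ∀ x ∈ J,
    |gl P l j t x| ≤ M := by
  obtain ⟨M, hM⟩ := h.pc_bound j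
  exact ⟨M, fun t ht x hx => le_of_tendsto (h.tendsto j ht hx).abs (hM.mono fun N h => h t ht x hx)⟩

theorem Fam.gl_time_lip (h : Fam P0 P Q T l) (j : ℕ) : ∃ M, 0 ≤ M ∧ ∀ t ∈ Icc 0 T, ∀ s ∈ Icc 0 T,
    ∀ x ∈ J, |gl P l j t x - gl P l j s x| ≤ M * dist t s := by
  obtain ⟨M, hM0, hM⟩ := h.time_lip j
  exact ⟨M, hM0, fun t ht s hs x hx => le_of_tendsto
    ((h.tendsto j ht hx).sub (h.tendsto j hs hx)).abs (hM.mono fun N h => h t ht s hs x hx)⟩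

theorem Fam.gl_sm (h : Fam P0 P Q T l) (j : ℕ) {t : ℝ} (ht : t ∈ Icc 0 T) : Sm (gl P l j t) :=
  (h.uchain ht).sm j

theorem Fam.gl_one (h : Fam P0 P Q T l) {t : ℝ} (ht : t ∈ Icc 0 T) : gl P l 0 t 1 = 1 / 10 := by
  refine tendsto_nhds_unique (h.tendsto 0 ht (by constructor <;> norm_num)) ?_
  simp only [pc, FF_one]
  exact tendsto_const_nhds

theorem Fam.gl_init (h : Fam P0 P Q T l) (hT : 0 ≤ T) (j : ℕ) {x : ℝ} (hx : x ∈ J) :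
    gl P l j 0 x = pc P0 j x := by
  refine tendsto_nhds_unique (h.tendsto j ⟨le_rfl, hT⟩ hx) ?_
  refine tendsto_const_nhds.congr' ?_
  filter_upwards [h.gal] with N h1
  rw [h1.init]

theorem Fam.tendsto_TP (h : Fam P0 P Q T l) {t : ℝ} (ht : t ∈ Icc 0 T) {x : ℝ} (hx : x ∈ J) :
    Tendsto (fun N => TP (P N t) x) l (𝓝 (Th (gl P l 0 t) (gl P l 1 t) x)) := by
  have h0 := h.tendsto 0 ht hx
  have h1 := h.tendsto 1 ht hx
  have := (continuous_arctan.tendsto _).comp h1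
  have h2 := ((continuous_arctan.tendsto _).comp (h0.const_mul x⁻¹)).const_mul 2
  exact this.add h2

theorem Fam.uchain_TP (h : Fam P0 P Q T l) {t : ℝ} (ht : t ∈ Icc 0 T) :
    UChain l (fun N k => D k (TP (P N t))) where
  chain := Eventually.of_forall fun N k x hx => (sm_TP _).hasDerivWithinAt k hx
  bound k := by
    choose M hM using h.D_bound
    set M' := ∑ i ∈ Finset.range (max 2 k + 1), |M i| with hM'
    obtain ⟨K, hK⟩ := TP_D_bound k M'
    refine ⟨K, ?_⟩
    have : ∀ᶠ N in (l : Filter ℕ), ∀ i ∈ Finset.range (max 2 k + 1), ∀ t ∈ Icc 0 T,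
      ∀ x ∈ J, |D i (ev (P N t)) x| ≤ M i ∧ |D i (ev (Q N t)) x| ≤ M i :=
      (eventually_all_finset _).2 fun i _ => hM i
    filter_upwards [this] with N h1
    refine hK _ fun i hi x hx => ?_
    have hi' : i ∈ Finset.range (max 2 k + 1) := Finset.mem_range.2 (by omega)
    refine ((h1 i hi' t ht x hx).1.trans (le_abs_self _)).trans ?_
    exact Finset.single_le_sum (f := fun i => |M i|) (fun _ _ => abs_nonneg _) hi'

theorem Fam.tendsto_I_TP (h : Fam P0 P Q T l) {t : ℝ} (ht : t ∈ Icc 0 T) (ψ : Polynomial ℝ) :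
    Tendsto (fun N => I (fun x => ev ψ x * TP (P N t) x)) l
      (𝓝 (I (fun x => ev ψ x * Th (gl P l 0 t) (gl P l 1 t) x))) := by
  have h1 := (h.uchain_TP ht).tendsto_I 0 (cont_ev ψ J)
  simp only [D_zero] at h1
  convert h1 using 2
  refine I_congr fun x hx => ?_
  congr 1
  refine tendsto_nhds_unique (h.tendsto_TP ht hx) ?_
  have := (h.uchain_TP ht).tendsto 0 hx
  simpa only [D_zero] using this

theorem Fam.moment_quadratic (h : Fam P0 P Q T l) (ψ : Polynomial ℝ) : ∃ M, ∀ t ∈ Icc 0 T,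
    ∀ s ∈ Icc 0 T, |I (fun x => ev ψ x * gl P l 1 t x) - I (fun x => ev ψ x * gl P l 1 s x)
      - (t - s) * I (fun x => ev (LP ψ) x * Th (gl P l 0 s) (gl P l 1 s) x)| ≤ M * |t - s| ^ 2 := by
  obtain ⟨M0, h00, h0⟩ := h.time_lip 0
  obtain ⟨M1, h10, h1⟩ := h.time_lip 1
  obtain ⟨K, hK⟩ := isCompact_Icc.exists_bound_of_continuousOn (cont_ev (LP ψ) J)
  refine ⟨|K| * (3 * (M0 + M1)), fun t ht s hs => ?_⟩
  have hlim := (((h.uchain ht).tendsto_I 1 (cont_ev ψ J)).sub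
    ((h.uchain hs).tendsto_I 1 (cont_ev ψ J))).sub
      ((h.tendsto_I_TP hs (LP ψ)).const_mul (t - s))
  refine le_of_tendsto hlim.abs ?_
  filter_upwards [h0, h1, h.gal, h.le T, h.le ψ.natDegree] with N a0 a1 g hT hψ
  have hψ' : ψ.natDegree ≤ N := by exact_mod_cast hψ
  refine taylor_one (u := fun t => I (fun x => ev ψ x * pc (P N t) 1 x))
    (v := fun t => I (fun x => ev (LP ψ) x * TP (P N t) x)) (convex_Icc 0 T) (fun τ hτ => ?_)
    hs (fun τ hτ => ?_) (by positivity) ht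
  · have hτ' : τ ∈ Icc (0 : ℝ) N := ⟨hτ.1, hτ.2.trans hT⟩
    have := (hasDerivWithinAt_lin g.degP (g.degQ τ) (g.der τ hτ') (bil 0 ψ)).mono
      (Icc_subset_Icc_right hT)
    rw [g.weak_psi τ hψ' 0] at this
    simp only [bil_apply, pow_zero, one_mul, D_zero, zero_add] at this
    rw [I_LP ψ (sm_TP _)]
    exact this
  · have c : ∀ τ, ContinuousOn (fun x => ev (LP ψ) x * TP (P N τ) x) J := fun τ =>
      (cont_ev _ _).mul (sm_TP _).continuousOn
    rw [← I_sub (c τ) (c s)]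
    refine abs_I_le fun x hx => ?_
    rw [← mul_sub, abs_mul]
    have hd : 0 ≤ dist τ s := dist_nonneg
    have b := abs_Th_sub_le (M := (M0 + M1) * dist τ s) hx
      ((a0 τ hτ s hs x hx).trans (by nlinarith)) ((a1 τ hτ s hs x hx).trans (by nlinarith))
    have k := (hK x hx).trans (le_abs_self K)
    rw [Real.norm_eq_abs] at k
    rw [Real.dist_eq] at b
    calc _ ≤ |K| * (3 * ((M0 + M1) * |τ - s|)) :=
          mul_le_mul k b (abs_nonneg _) (abs_nonneg _)
      _ = _ := by ring

end
end LBMCF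

namespace LBMCF
open scoped Topology ContDiff
open Polynomial (C X derivative)

section
variable {P0 : Polynomial ℝ} {P Q : ℕ → ℝ → Polynomial ℝ} {T : ℝ} {l : Ultrafilter ℕ}

theorem Fam.uchain_quot (h : Fam P0 P Q T l) {s : ℝ} (hs : s ∈ Icc 0 T) {v : Ultrafilter ℝ}
    (hv : (v : Filter ℝ) ≤ 𝓝[Icc 0 T \ {s}] s) :
    UChain v (fun t j x => (t - s)⁻¹ * (gl P l j t x - gl P l j s x)) where
  chain := by
    filter_upwards [hv self_mem_nhdsWithin] with t ht k x hx
    exact ((h.gl_chain k ht.1 hx).fun_sub (h.gl_chain k hs hx)).const_mul _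
  bound k := by
    obtain ⟨M, hM0, hM⟩ := h.gl_time_lip k
    refine ⟨M, ?_⟩
    filter_upwards [hv self_mem_nhdsWithin] with t ht x hx
    have h1 := hM t ht.1 s hs x hx
    have h2 : 0 < |t - s| := abs_pos.2 (sub_ne_zero.2 ht.2)
    rw [Real.dist_eq] at h1
    rw [abs_mul, abs_inv, inv_mul_le_iff₀ h2, mul_comm]
    exact h1

theorem Fam.gl_deriv_aux (h : Fam P0 P Q T l) {s : ℝ} (hs : s ∈ Icc 0 T) {v : Ultrafilter ℝ}
    (hv : (v : Filter ℝ) ≤ 𝓝[Icc 0 T \ {s}] s) (j : ℕ) {x : ℝ} (hx : x ∈ J) :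
    Tendsto (fun t => (t - s)⁻¹ * (gl P l j t x - gl P l j s x)) v
      (𝓝 (Uu (Th (gl P l 0 s) (gl P l 1 s)) j x)) := by
  have U := h.uchain_quot hs hv
  set Θ := Th (gl P l 0 s) (gl P l 1 s) with hΘ
  have sΘ : Sm Θ := sm3_Hf.cp (h.gl_sm 0 hs) (h.gl_sm 1 hs)
  set Z := ulim v (fun t j x => (t - s)⁻¹ * (gl P l j t x - gl P l j s x)) with hZ
  have cg : ∀ t ∈ Icc 0 T, ∀ ψ, ContinuousOn (fun x => ev ψ x * gl P l 1 t x) J := fun t ht ψ =>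
    (cont_ev _ _).mul (h.gl_sm 1 ht).continuousOn
  have hts : Tendsto (fun t => |t - s|) v (𝓝 0) := by
    have h1 : Tendsto (fun t : ℝ => |t - s|) (𝓝 s) (𝓝 |s - s|) :=
      ((continuous_id.sub continuous_const).abs).tendsto s
    rw [sub_self, abs_zero] at h1
    exact h1.mono_left (hv.trans nhdsWithin_le_nhds)
  have hm : ∀ ψ, I (fun x => ev ψ x * Z 1 x) = I (fun x => ev ψ x * Uu Θ 1 x) := fun ψ => by
    rw [← I_LP ψ sΘ]
    refine tendsto_nhds_unique (U.tendsto_I 1 (cont_ev ψ J)) ?_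
    obtain ⟨M, hM⟩ := h.moment_quadratic ψ
    rw [tendsto_iff_norm_sub_tendsto_zero]
    have h0 : Tendsto (fun t => M * |t - s|) v (𝓝 0) := by
      simpa using hts.const_mul M
    refine squeeze_zero' (Eventually.of_forall fun t => norm_nonneg _) ?_ h0
    filter_upwards [hv self_mem_nhdsWithin] with t ht
    have h1 := hM t ht.1 s hs
    have hne : t - s ≠ 0 := sub_ne_zero.2 ht.2
    have h2 : 0 < |t - s| := abs_pos.2 hne
    rw [← I_sub (cg t ht.1 ψ) (cg s hs ψ)] at h1
    have e : I (fun x => ev ψ x * ((t - s)⁻¹ * (gl P l 1 t x - gl P l 1 s x))) =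
        (t - s)⁻¹ * I (fun x => ev ψ x * gl P l 1 t x - ev ψ x * gl P l 1 s x) := by
      rw [← I_smul]
      exact I_congr fun x _ => by ring
    rw [e, Real.norm_eq_abs]
    set A := I (fun x => ev ψ x * gl P l 1 t x - ev ψ x * gl P l 1 s x)
    set B := I (fun x => ev (LP ψ) x * Θ x)
    have e2 : (t - s)⁻¹ * A - B = (t - s)⁻¹ * (A - (t - s) * B) := by field_simp
    rw [e2, abs_mul, abs_inv, inv_mul_le_iff₀ h2]
    calc _ ≤ M * |t - s| ^ 2 := h1
      _ = _ := by ring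
  have h1 : ∀ x ∈ J, Z 1 x = Uu Θ 1 x :=
    eqOn_of_moments (U.sm 1).continuousOn (sm_Uu sΘ 1).continuousOn hm
  have h2 : ∀ j, ∀ x ∈ J, Z j x = Uu Θ j x := by
    intro j
    cases j with
    | succ j =>
      intro x hx
      have a := D_eq_of_chain (u := Z) (fun k x hx => U.ulim_chain k hx) j 1 hx
      rw [add_comm j 1, ← a, D_congr (fun y hy => h1 y hy) j hx, D_Uu sΘ j 1 hx]
    | zero =>
      have o : (1 : ℝ) ∈ J := by constructor <;> norm_num
      have z0 : Z 0 1 = 0 := by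
        refine tendsto_nhds_unique (U.tendsto 0 o) ?_
        refine tendsto_const_nhds.congr' ?_
        filter_upwards [hv self_mem_nhdsWithin] with t ht
        rw [h.gl_one ht.1, h.gl_one hs, sub_self, mul_zero]
      have u0 : Uu Θ 0 1 = 0 := by simp [Uu, sg_one]
      intro x hx
      have := lipschitz_of_chain (M := 0) (convex_Icc 1 (101 / 100))
        (fun x hx => (U.ulim_chain 0 hx).fun_sub (Uu_chain sΘ 0 hx))
        (fun x hx => by rw [zero_add, ← hZ, h1 x hx, sub_self, abs_zero]) x hx 1 o
      rw [← hZ, z0, u0, zero_mul, sub_zero, sub_zero] at this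
      exact sub_eq_zero.1 (abs_eq_zero.1 (le_antisymm this (abs_nonneg _)))
  rw [← h2 j x hx]
  exact U.tendsto j hx

theorem Fam.gl_deriv (h : Fam P0 P Q T l) (j : ℕ) {s : ℝ} (hs : s ∈ Icc 0 T) {x : ℝ} (hx : x ∈ J) :
    HasDerivWithinAt (fun t => gl P l j t x) (Uu (Th (gl P l 0 s) (gl P l 1 s)) j x) (Icc 0 T) s := by
  rw [hasDerivWithinAt_iff_tendsto_slope, tendsto_iff_ultrafilter]
  intro v hv
  exact h.gl_deriv_aux hs hv j hx

end

/-- A smooth solution of the flow on `[0, T]`, with all its `x`-derivatives. -/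
structure IsSol (P0 : Polynomial ℝ) (T : ℝ) (F : ℕ → ℝ → ℝ → ℝ) : Prop where
  chain : ∀ j, ∀ t ∈ Icc 0 T, ∀ x ∈ J, HasDerivWithinAt (F j t) (F (j + 1) t x) J x
  der : ∀ j, ∀ t ∈ Icc 0 T, ∀ x ∈ J,
    HasDerivWithinAt (fun s => F j s x) (Uu (Th (F 0 t) (F 1 t)) j x) (Icc 0 T) t
  bound : ∀ j, ∃ M, ∀ t ∈ Icc 0 T, ∀ x ∈ J, |F j t x| ≤ M
  one : ∀ t ∈ Icc 0 T, F 0 t 1 = 1 / 10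
  init : ∀ j, ∀ x ∈ J, F j 0 x = pc P0 j x
  lip : ∀ j, ∃ M, 0 ≤ M ∧ ∀ t ∈ Icc 0 T, ∀ s ∈ Icc 0 T, ∀ x ∈ J, |F j t x - F j s x| ≤ M * dist t s

theorem Fam.isSol {P0 : Polynomial ℝ} {P Q : ℕ → ℝ → Polynomial ℝ} {T : ℝ} {l : Ultrafilter ℕ}
    (h : Fam P0 P Q T l) (hT : 0 ≤ T) : IsSol P0 T (gl P l) where
  chain j _ ht _ hx := h.gl_chain j ht hx
  der j _ ht _ hx := h.gl_deriv j ht hx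
  bound j := h.gl_bound j
  one _ ht := h.gl_one ht
  init j _ hx := h.gl_init hT j hx
  lip j := h.gl_time_lip j

end LBMCF

namespace LBMCF
open scoped Topology ContDiff

section
variable {P0 : Polynomial ℝ} {T : ℝ} {F : ℕ → ℝ → ℝ → ℝ}

/-- The phase of a solution. -/
noncomputable abbrev TF (F : ℕ → ℝ → ℝ → ℝ) (t : ℝ) : ℝ → ℝ := Th (F 0 t) (F 1 t)

theorem IsSol.sm (h : IsSol P0 T F) (j : ℕ) {t : ℝ} (ht : t ∈ Icc 0 T) : Sm (F j t) :=
  sm_of_chain (u := fun j => F j t) (fun k x hx => h.chain k t ht x hx) j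

theorem IsSol.sm_TF (h : IsSol P0 T F) {t : ℝ} (ht : t ∈ Icc 0 T) : Sm (TF F t) :=
  sm3_Hf.cp (h.sm 0 ht) (h.sm 1 ht)

theorem IsSol.D_eq (h : IsSol P0 T F) (k j : ℕ) {t : ℝ} (ht : t ∈ Icc 0 T) {x : ℝ} (hx : x ∈ J) :
    D k (F j t) x = F (j + k) t x :=
  D_eq_of_chain (u := fun j => F j t) (fun k x hx => h.chain k t ht x hx) k j hx

theorem IsSol.hasFDerivWithinAt (h : IsSol P0 T F) (j : ℕ) {z : ℝ × ℝ} (hz : z ∈ Icc 0 T ×ˢ J) :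
    HasFDerivWithinAt (fun z : ℝ × ℝ => F j z.1 z.2)
      (Uu (TF F z.1) j z.2 • ContinuousLinearMap.fst ℝ ℝ ℝ +
        F (j + 1) z.1 z.2 • ContinuousLinearMap.snd ℝ ℝ ℝ) (Icc 0 T ×ˢ J) z := by
  obtain ⟨s, x⟩ := z
  obtain ⟨hs, hx⟩ := hz
  simp only at hs hx ⊢
  obtain ⟨M2, hM2⟩ := h.bound (j + 2)
  obtain ⟨M1, hM1, hL⟩ := h.lip (j + 1)
  have hM2' : 0 ≤ M2 := (abs_nonneg _).trans (hM2 s hs x hx)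
  rw [hasFDerivWithinAt_iff_isLittleO]
  have fst0 : Tendsto (fun z : ℝ × ℝ => z.1) (𝓝[Icc 0 T ×ˢ J] (s, x)) (𝓝[Icc 0 T] s) := by
    refine tendsto_nhdsWithin_iff.2 ⟨continuous_fst.continuousWithinAt, ?_⟩
    filter_upwards [self_mem_nhdsWithin] with z hz using hz.1
  have ht := (hasDerivWithinAt_iff_isLittleO.1 (h.der j s hs x hx)).comp_tendsto fst0
  have hfst : (fun z : ℝ × ℝ => z.1 - s) =O[𝓝[Icc 0 T ×ˢ J] (s, x)] fun z => z - (s, x) :=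
    Asymptotics.IsBigO.of_bound 1 (Eventually.of_forall fun z => by
      rw [one_mul]; exact norm_fst_le (z - (s, x)))
  have e1 := ht.trans_isBigO hfst
  have e2 : (fun z : ℝ × ℝ => F j z.1 z.2 - F j z.1 x - (z.2 - x) * F (j + 1) s x)
      =o[𝓝[Icc 0 T ×ˢ J] (s, x)] fun z => z - (s, x) := by
    have b : (fun z : ℝ × ℝ => F j z.1 z.2 - F j z.1 x - (z.2 - x) * F (j + 1) s x)
        =O[𝓝[Icc 0 T ×ˢ J] (s, x)] fun z => ‖z - (s, x)‖ * ‖z - (s, x)‖ := by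
      refine Asymptotics.IsBigO.of_bound (M2 + M1) ?_
      filter_upwards [self_mem_nhdsWithin] with z hz
      have a1 := taylor_one (convex_Icc _ _) (h.chain j z.1 hz.1) hx
        (lipschitz_of_chain (convex_Icc _ _) (h.chain (j + 1) z.1 hz.1) (hM2 z.1 hz.1) · · x hx)
        hM2' hz.2
      have a2 := hL z.1 hz.1 s hs x hx
      have n1 : |z.1 - s| ≤ ‖z - (s, x)‖ := norm_fst_le (z - (s, x))
      have n2 : |z.2 - x| ≤ ‖z - (s, x)‖ := norm_snd_le (z - (s, x))
      set r := ‖z - (s, x)‖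
      have r0 : 0 ≤ r := norm_nonneg _
      rw [Real.dist_eq] at a2
      rw [Real.norm_eq_abs, Real.norm_eq_abs, abs_of_nonneg (mul_nonneg r0 r0)]
      have e : F j z.1 z.2 - F j z.1 x - (z.2 - x) * F (j + 1) s x =
        (F j z.1 z.2 - F j z.1 x - (z.2 - x) * F (j + 1) z.1 x) +
          (z.2 - x) * (F (j + 1) z.1 x - F (j + 1) s x) := by ring
      rw [e]
      refine (abs_add_le _ _).trans ?_
      rw [abs_mul]
      have b1 : M2 * |z.2 - x| ^ 2 ≤ M2 * r ^ 2 :=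
        mul_le_mul_of_nonneg_left (pow_le_pow_left₀ (abs_nonneg _) n2 2) hM2'
      have b2 : |z.2 - x| * |F (j + 1) z.1 x - F (j + 1) s x| ≤ r * (M1 * r) :=
        mul_le_mul n2 (a2.trans (mul_le_mul_of_nonneg_left n1 hM1)) (abs_nonneg _) r0
      calc _ ≤ M2 * r ^ 2 + r * (M1 * r) := add_le_add (a1.trans b1) b2
        _ = _ := by ring
    refine b.trans_isLittleO ?_
    have o : (fun z : ℝ × ℝ => ‖z - (s, x)‖) =o[𝓝[Icc 0 T ×ˢ J] (s, x)] fun _ => (1 : ℝ) := by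
      rw [Asymptotics.isLittleO_one_iff]
      have : Tendsto (fun z : ℝ × ℝ => ‖z - (s, x)‖) (𝓝 (s, x)) (𝓝 ‖(s, x) - (s, x)‖) :=
        ((continuous_id.sub continuous_const).norm).tendsto _
      rw [sub_self, norm_zero] at this
      exact this.mono_left nhdsWithin_le_nhds
    have := o.mul_isBigO (Asymptotics.isBigO_refl (fun z : ℝ × ℝ => ‖z - (s, x)‖)
      (𝓝[Icc 0 T ×ˢ J] (s, x)))
    simp only [one_mul] at this
    exact this.of_norm_right
  refine (e1.add e2).congr_left fun z => ?_
  simp only [Function.comp, add_apply, smul_apply,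
    ContinuousLinearMap.coe_fst', ContinuousLinearMap.coe_snd', smul_eq_mul, Prod.fst_sub,
    Prod.snd_sub]
  ring

theorem IsSol.contDiffOn_cp (h : IsSol P0 T F) {m : WithTop ℕ∞} (hm : m ≤ ∞)
    (hF : ∀ j, ContDiffOn ℝ m (fun z : ℝ × ℝ => F j z.1 z.2) (Icc 0 T ×ˢ J)) (k : ℕ) :
    ∀ G, Sm3 G → ContDiffOn ℝ m (fun z : ℝ × ℝ => D k (cp G (F 0 z.1) (F 1 z.1)) z.2)
      (Icc 0 T ×ˢ J) := by
  induction k using Nat.strong_induction_on with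
  | _ k ih =>
  intro G hG
  cases k with
  | zero =>
    simp only [D_zero, cp]
    have hi : ContDiffOn ℝ m (fun z : ℝ × ℝ => z.2⁻¹) (Icc 0 T ×ˢ J) :=
      contDiffOn_snd.inv fun z hz => (J_bounds hz.2).2.2.ne'
    exact (ContDiff.of_le hG hm).comp_contDiffOn (hi.prodMk ((hF 0).prodMk (hF 1)))
  | succ k =>
    have e : ∀ z ∈ Icc 0 T ×ˢ J, D (k + 1) (cp G (F 0 z.1) (F 1 z.1)) z.2 =
        D k (cp (KG G) (F 0 z.1) (F 1 z.1)) z.2 + ∑ l ∈ Finset.range (k + 1),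
          (k.choose l : ℝ) * D l (cp (GP G) (F 0 z.1) (F 1 z.1)) z.2 * F (k - l + 2) z.1 z.2 := by
      intro z hz
      rw [D_cp_succ hG (h.sm 0 hz.1) (h.sm 1 hz.1) (h.chain 0 z.1 hz.1) k hz.2]
      congr 1
      refine Finset.sum_congr rfl fun l _ => ?_
      rw [h.D_eq _ _ hz.1 hz.2]
      congr 2; omega
    refine ContDiffOn.congr ?_ e
    refine (ih k (by omega) _ hG.KG).add (ContDiffOn.sum fun l hl => ?_)
    rw [Finset.mem_range] at hl
    exact (contDiffOn_const.mul (ih l (by omega) _ hG.GP)).mul (hF _)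

theorem contDiff_sg {n : WithTop ℕ∞} : ContDiff ℝ n sg := by unfold sg; fun_prop
theorem contDiff_sg' {n : WithTop ℕ∞} : ContDiff ℝ n sg' := by unfold sg'; fun_prop

theorem IsSol.contDiffOn_nat (h : IsSol P0 T F) (hT : 0 < T) (m : ℕ) : ∀ j,
    ContDiffOn ℝ m (fun z : ℝ × ℝ => F j z.1 z.2) (Icc 0 T ×ˢ J) := by
  induction m with
  | zero =>
    intro j
    rw [Nat.cast_zero, contDiffOn_zero]
    exact fun z hz => (h.hasFDerivWithinAt j hz).continuousWithinAt
  | succ m ih =>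
    intro j
    push_cast
    rw [contDiffOn_succ_iff_hasFDerivWithinAt_of_uniqueDiffOn
      ((uniqueDiffOn_Icc hT).prod uniqueDiffOn_J)]
    refine ⟨by simp, _, ?_, fun z hz => h.hasFDerivWithinAt j hz⟩
    have hc := fun k => h.contDiffOn_cp (by exact_mod_cast le_top) ih k Hf sm3_Hf
    have hU : ContDiffOn ℝ m (fun z : ℝ × ℝ => Uu (TF F z.1) j z.2) (Icc 0 T ×ˢ J) := by
      unfold Uu
      exact (((contDiff_sg.comp contDiff_snd).contDiffOn.mul (hc (j + 1))).add
        ((contDiffOn_const.mul (contDiff_sg'.comp contDiff_snd).contDiffOn).mul (hc j))).sub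
          (contDiffOn_const.mul (hc (j - 1)))
    exact (hU.smul contDiffOn_const).add ((ih (j + 1)).smul contDiffOn_const)

theorem IsSol.contDiffOn (h : IsSol P0 T F) (hT : 0 < T) (j : ℕ) :
    ContDiffOn ℝ ∞ (fun z : ℝ × ℝ => F j z.1 z.2) (Icc 0 T ×ˢ J) :=
  contDiffOn_infty.2 fun m => h.contDiffOn_nat hT m j

theorem IsSol.continuousOn_D_cp (h : IsSol P0 T F) (hT : 0 < T) (k : ℕ) {G : ℝ × ℝ × ℝ → ℝ}
    (hG : Sm3 G) : ContinuousOn (fun z : ℝ × ℝ => D k (cp G (F 0 z.1) (F 1 z.1)) z.2)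
      (Icc 0 T ×ˢ J) :=
  (h.contDiffOn_cp le_rfl (fun j => h.contDiffOn hT j) k G hG).continuousOn

theorem IsSol.contDiffOn_Ici {F : ℕ → ℝ → ℝ → ℝ} (h : ∀ T > 0, IsSol P0 T F) (j : ℕ) :
    ContDiffOn ℝ ∞ (fun z : ℝ × ℝ => F j z.1 z.2) (Ici 0 ×ˢ J) := by
  intro z hz
  have h1 := (h (z.1 + 1) (by linarith [show (0 : ℝ) ≤ z.1 from hz.1])).contDiffOn
    (by linarith [show (0 : ℝ) ≤ z.1 from hz.1]) j z ⟨⟨hz.1, by linarith⟩, hz.2⟩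
  refine h1.mono_of_mem_nhdsWithin ?_
  have : {w : ℝ × ℝ | w.1 < z.1 + 1} ∈ 𝓝 z :=
    (isOpen_lt continuous_fst continuous_const).mem_nhds (by simp)
  filter_upwards [self_mem_nhdsWithin, mem_nhdsWithin_of_mem_nhds this] with w hw hw1
  exact ⟨⟨hw.1, le_of_lt hw1⟩, hw.2⟩

end
end LBMCF

namespace LBMCF
open scoped Topology ContDiff

theorem interior_min_facts {u : ℝ → ℝ} (hu : Sm u) {x : ℝ} (hx : x ∈ Ioo (1 : ℝ) (101 / 100))
    (hmin : ∀ y ∈ J, u x ≤ u y) : D 1 u x = 0 ∧ 0 ≤ D 2 u x := by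
  have hJ : ∀ y ∈ Ioo (1 : ℝ) (101 / 100), J ∈ 𝓝 y := fun y hy => Icc_mem_nhds hy.1 hy.2
  have hd : ∀ k, ∀ y ∈ Ioo (1 : ℝ) (101 / 100), HasDerivAt (D k u) (D (k + 1) u y) y := fun k y hy =>
    (hu.hasDerivWithinAt k (Ioo_subset_Icc_self hy)).hasDerivAt (hJ y hy)
  have e0 : D 0 u = u := funext fun y => D_zero u y
  have hd0 := hd 0
  rw [e0] at hd0
  have hlm : IsLocalMin u x := by
    filter_upwards [hJ x hx] with y hy using hmin y hy
  have h1 : D 1 u x = 0 := hlm.hasDerivAt_eq_zero (hd0 x hx)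
  refine ⟨h1, le_of_not_gt fun h2 => ?_⟩
  have ed : deriv u =ᶠ[𝓝 x] D 1 u := by
    filter_upwards [isOpen_Ioo.mem_nhds hx] with y hy using (hd0 y hy).deriv
  have edd : deriv (deriv u) x = D 2 u x := by rw [ed.deriv_eq]; exact (hd 1 x hx).deriv
  have hmax : IsLocalMax u x := isLocalMax_of_deriv_deriv_neg (by rw [edd]; exact h2)
    (by rw [ed.eq_of_nhds, h1]) (hd0 x hx).continuousAt
  have hc : u =ᶠ[𝓝 x] fun _ => u x := by
    filter_upwards [hmax, hJ x hx] with y h3 h4 using le_antisymm h3 (hmin y h4)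
  have : deriv u =ᶠ[𝓝 x] fun _ => 0 := hc.deriv.trans (Eventually.of_forall fun y => by simp)
  rw [this.deriv_eq] at edd
  simp at edd
  exact h2.ne edd.symm

theorem deriv_nonneg_of_min_left {u : ℝ → ℝ} {d a b : ℝ} (hab : a < b)
    (hd : HasDerivWithinAt u d (Icc a b) a) (h : ∀ y ∈ Icc a b, u a ≤ u y) : 0 ≤ d := by
  rw [hasDerivWithinAt_iff_tendsto_slope] at hd
  have : (𝓝[Icc a b \ {a}] a).NeBot := by
    rw [Icc_sdiff_left]
    exact left_nhdsWithin_Ioc_neBot hab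
  refine ge_of_tendsto hd ?_
  filter_upwards [self_mem_nhdsWithin] with y hy
  have h1 : a < y := lt_of_le_of_ne hy.1.1 fun e => hy.2 e.symm
  rw [slope_def_field]
  exact div_nonneg (sub_nonneg.2 (h y hy.1)) (sub_nonneg.2 h1.le)

theorem deriv_nonpos_of_min_right {u : ℝ → ℝ} {d a b : ℝ} (hab : a < b)
    (hd : HasDerivWithinAt u d (Icc a b) b) (h : ∀ y ∈ Icc a b, u b ≤ u y) : d ≤ 0 := by
  rw [hasDerivWithinAt_iff_tendsto_slope] at hd
  have : (𝓝[Icc a b \ {b}] b).NeBot := by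
    rw [Icc_sdiff_right]
    exact right_nhdsWithin_Ico_neBot hab
  refine le_of_tendsto hd ?_
  filter_upwards [self_mem_nhdsWithin] with y hy
  have h1 : y < b := lt_of_le_of_ne hy.1.2 hy.2
  rw [slope_def_field]
  exact div_nonpos_of_nonneg_of_nonpos (sub_nonneg.2 (h y hy.1)) (sub_nonpos.2 h1.le)

theorem min_facts {u : ℝ → ℝ} (hu : Sm u) {x : ℝ} (hx : x ∈ J) (hmin : ∀ y ∈ J, u x ≤ u y) :
    sg x * D 1 u x = 0 ∧ 0 ≤ sg' x * D 1 u x ∧ 0 ≤ sg x * D 2 u x := by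
  have e0 : D 0 u = u := funext fun y => D_zero u y
  have hd := hu.hasDerivWithinAt 0 hx
  rw [e0, zero_add] at hd
  rcases eq_or_lt_of_le hx.1 with h | h
  · subst h
    have := deriv_nonneg_of_min_left (by norm_num) hd hmin
    rw [sg_one]
    refine ⟨by ring, mul_nonneg (by norm_num [sg']) this, by simp⟩
  rcases eq_or_lt_of_le hx.2 with h' | h'
  · subst h'
    have := deriv_nonpos_of_min_right (by norm_num) hd hmin
    rw [sg_b]
    refine ⟨by ring, mul_nonneg_of_nonpos_of_nonpos (by norm_num [sg']) this, by simp⟩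
  · have := interior_min_facts hu ⟨h, h'⟩ hmin
    rw [this.1]
    exact ⟨by ring, by simp, mul_nonneg (sg_nonneg hx) this.2⟩

theorem first_zero {T : ℝ} {v v' : ℝ → ℝ → ℝ}
    (hc : ContinuousOn (fun z : ℝ × ℝ => v z.1 z.2) (Icc 0 T ×ˢ J)) (h0 : ∀ x ∈ J, 0 < v 0 x)
    (hd : ∀ t ∈ Icc 0 T, ∀ x ∈ J, HasDerivWithinAt (fun s => v s x) (v' t x) (Icc 0 T) t)
    (hz : ∀ t ∈ Icc 0 T, ∀ x ∈ J, v t x = 0 → (∀ s ∈ Icc 0 t, ∀ y ∈ J, 0 ≤ v s y) → 0 < v' t x) :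
    ∀ t ∈ Icc 0 T, ∀ x ∈ J, 0 < v t x := by
  by_contra! hcon
  obtain ⟨t1, ht1, x1, hx1, hv1⟩ := hcon
  have hK : IsCompact (Icc 0 T ×ˢ J) := isCompact_Icc.prod isCompact_Icc
  have hZc : IsClosed ((Icc 0 T ×ˢ J) ∩ (fun z : ℝ × ℝ => v z.1 z.2) ⁻¹' Iic 0) :=
    hc.preimage_isClosed_of_isClosed (isClosed_Icc.prod isClosed_Icc) isClosed_Iic
  have hZ : IsCompact ((Icc 0 T ×ˢ J) ∩ (fun z : ℝ × ℝ => v z.1 z.2) ⁻¹' Iic 0) :=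
    hK.of_isClosed_subset hZc inter_subset_left
  obtain ⟨⟨t, x⟩, ⟨⟨ht, hx⟩, hvt⟩, hmin⟩ := hZ.exists_isMinOn ⟨(t1, x1), ⟨ht1, hx1⟩, hv1⟩
    continuous_fst.continuousOn
  simp only [mem_preimage, mem_Iic] at ht hx hvt
  have hlt : ∀ s ∈ Icc 0 T, s < t → ∀ y ∈ J, 0 < v s y := by
    intro s hs hst y hy
    by_contra! h
    have := hmin (show (s, y) ∈ (Icc 0 T ×ˢ J) ∩ _ from ⟨⟨hs, hy⟩, h⟩)
    simp only [mem_ofPred_eq] at this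
    linarith
  have ht0 : 0 < t := by
    rcases eq_or_lt_of_le ht.1 with h | h
    · rw [← h] at hvt; exact absurd hvt (not_le.2 (h0 x hx))
    · exact h
  have hsub : Icc 0 t ⊆ Icc 0 T := Icc_subset_Icc_right ht.2
  have hge : ∀ s ∈ Icc 0 t, ∀ y ∈ J, 0 ≤ v s y := by
    intro s hs y hy
    rcases lt_or_eq_of_le hs.2 with h | rfl
    · exact (hlt s (hsub hs) h y hy).le
    · have hcy := ((hd s ht y hy).continuousWithinAt).mono hsub
      have : (𝓝[Ico 0 s] s).NeBot := right_nhdsWithin_Ico_neBot ht0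
      refine ge_of_tendsto (hcy.tendsto.mono_left (nhdsWithin_mono s Ico_subset_Icc_self)) ?_
      filter_upwards [self_mem_nhdsWithin] with r hr
      exact (hlt r (hsub ⟨hr.1, hr.2.le⟩) hr.2 y hy).le
  have hv0 : v t x = 0 := le_antisymm hvt (hge t ⟨ht0.le, le_rfl⟩ x hx)
  have h1 := hz t ht x hx hv0 hge
  have h2 := deriv_nonpos_of_min_right ht0 ((hd t ht x hx).mono hsub)
    (fun s hs => by simp only [hv0]; exact hge s hs x hx)
  linarith

end LBMCF

namespace LBMCF
open scoped Topology ContDiff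

/-- The derivative of the phase in terms of `f`, its slope `p` and its second derivative `r`. -/
noncomputable def gE (f p r x : ℝ) : ℝ := r / (1 + p ^ 2) + 2 * (x * p - f) / (x ^ 2 + f ^ 2)

section
variable {f p r w v : ℝ → ℝ} {x : ℝ} {s : Set ℝ}

theorem hasDerivWithinAt_Th (hx : 0 < x) (hf : HasDerivWithinAt f (p x) s x)
    (hp : HasDerivWithinAt p (r x) s x) :
    HasDerivWithinAt (Th f p) (gE (f x) (p x) (r x) x) s x := by
  have h1 : HasDerivWithinAt (fun x : ℝ => x⁻¹) (-(x ^ 2)⁻¹) s x :=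
    (hasDerivAt_inv hx.ne').hasDerivWithinAt
  have h2 := hp.arctan.add ((h1.mul hf).arctan.const_mul 2)
  have hR : x ^ 2 + f x ^ 2 ≠ 0 := by positivity
  refine h2.congr_deriv ?_
  unfold gE
  simp only [Pi.mul_apply]
  have : 1 + (x⁻¹ * f x) ^ 2 = (x ^ 2 + f x ^ 2) / x ^ 2 := by field_simp
  rw [this]
  field_simp
  ring

theorem hasDerivWithinAt_gE (hx : 0 < x) (hf : HasDerivWithinAt f (p x) s x)
    (hp : HasDerivWithinAt p (r x) s x) (hr : HasDerivWithinAt r (w x) s x) :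
    HasDerivWithinAt (fun x => gE (f x) (p x) (r x) x)
      (w x / (1 + p x ^ 2) - r x * (2 * p x * r x) / (1 + p x ^ 2) ^ 2 +
        2 * x * r x / (x ^ 2 + f x ^ 2) -
        4 * (x * p x - f x) * (x + f x * p x) / (x ^ 2 + f x ^ 2) ^ 2) s x := by
  have hR : x ^ 2 + f x ^ 2 ≠ 0 := by positivity
  have hP : 1 + p x ^ 2 ≠ 0 := by positivity
  have hi := hasDerivWithinAt_id x s
  have h1 := (hr.fun_div ((hp.fun_pow 2).const_add 1) hP).fun_add
    ((((hi.fun_mul hp).fun_sub hf).const_mul 2).fun_div ((hi.fun_pow 2).fun_add (hf.fun_pow 2)) hR)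
  refine h1.congr_deriv ?_
  simp only [id]
  field_simp
  ring

theorem hasDerivWithinAt_gE' (hx : 0 < x) (hf : HasDerivWithinAt f (p x) s x)
    (hp : HasDerivWithinAt p (r x) s x) (hr : HasDerivWithinAt r (w x) s x)
    (hw : HasDerivWithinAt w (v x) s x) (h0 : r x = 0) :
    HasDerivWithinAt (fun x => w x / (1 + p x ^ 2) - r x * (2 * p x * r x) / (1 + p x ^ 2) ^ 2 +
        2 * x * r x / (x ^ 2 + f x ^ 2) -
        4 * (x * p x - f x) * (x + f x * p x) / (x ^ 2 + f x ^ 2) ^ 2)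
      (v x / (1 + p x ^ 2) + 2 * x * w x / (x ^ 2 + f x ^ 2) -
        4 * (x * p x - f x) * (1 + p x ^ 2) / (x ^ 2 + f x ^ 2) ^ 2 +
        16 * (x * p x - f x) * (x + f x * p x) ^ 2 / (x ^ 2 + f x ^ 2) ^ 3) s x := by
  have hR : x ^ 2 + f x ^ 2 ≠ 0 := by positivity
  have hP : 1 + p x ^ 2 ≠ 0 := by positivity
  have hi := hasDerivWithinAt_id x s
  have dP := (hp.fun_pow 2).const_add 1
  have dR := (hi.fun_pow 2).fun_add (hf.fun_pow 2)
  have h1 := (((hw.fun_div dP hP).fun_sub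
    ((hr.fun_mul ((hp.const_mul 2).fun_mul hr)).fun_div (dP.fun_pow 2) (pow_ne_zero 2 hP))).fun_add
    (((hi.const_mul 2).fun_mul hr).fun_div dR hR)).fun_sub
    ((((((hi.fun_mul hp).fun_sub hf).const_mul 4).fun_mul (hi.fun_add (hf.fun_mul hp)))).fun_div
      (dR.fun_pow 2) (pow_ne_zero 2 hR))
  refine h1.congr_deriv ?_
  simp only [id, h0]
  field_simp
  ring

end

theorem hasDerivWithinAt_gE_time {f p r : ℝ → ℝ} {x t f' p' r' : ℝ} {s : Set ℝ} (hx : 0 < x)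
    (hf : HasDerivWithinAt f f' s t) (hp : HasDerivWithinAt p p' s t)
    (hr : HasDerivWithinAt r r' s t) :
    HasDerivWithinAt (fun t => gE (f t) (p t) (r t) x)
      (r' / (1 + p t ^ 2) + (2 * x / (x ^ 2 + f t ^ 2) - 2 * p t * r t / (1 + p t ^ 2) ^ 2) * p' +
        (-2 / (x ^ 2 + f t ^ 2) - 4 * f t * (x * p t - f t) / (x ^ 2 + f t ^ 2) ^ 2) * f') s t := by
  have hR : x ^ 2 + f t ^ 2 ≠ 0 := by positivity
  have hP : 1 + p t ^ 2 ≠ 0 := by positivity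
  have h1 := (hr.fun_div ((hp.fun_pow 2).const_add 1) hP).fun_add
    ((((hp.const_mul x).fun_sub hf).const_mul 2).fun_div ((hf.fun_pow 2).const_add (x ^ 2)) hR)
  refine h1.congr_deriv ?_
  field_simp
  ring

section
variable {P0 : Polynomial ℝ} {T : ℝ} {F : ℕ → ℝ → ℝ → ℝ}

theorem IsSol.D1_TF (h : IsSol P0 T F) {t x : ℝ} (ht : t ∈ Icc 0 T) (hx : x ∈ J) :
    D 1 (TF F t) x = gE (F 0 t x) (F 1 t x) (F 2 t x) x := by
  rw [D_succ_eq (fun y hy => hasDerivWithinAt_Th (J_bounds hy).2.2 (h.chain 0 t ht y hy)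
    (h.chain 1 t ht y hy)) 0 hx, D_zero]

theorem IsSol.D2_TF (h : IsSol P0 T F) {t x : ℝ} (ht : t ∈ Icc 0 T) (hx : x ∈ J) :
    D 2 (TF F t) x = F 3 t x / (1 + F 1 t x ^ 2) -
        F 2 t x * (2 * F 1 t x * F 2 t x) / (1 + F 1 t x ^ 2) ^ 2 +
        2 * x * F 2 t x / (x ^ 2 + F 0 t x ^ 2) -
        4 * (x * F 1 t x - F 0 t x) * (x + F 0 t x * F 1 t x) / (x ^ 2 + F 0 t x ^ 2) ^ 2 := by
  rw [D_succ_eq (fun y hy => hasDerivWithinAt_Th (J_bounds hy).2.2 (h.chain 0 t ht y hy)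
    (h.chain 1 t ht y hy)) 1 hx, D_succ_eq (fun y hy => hasDerivWithinAt_gE (J_bounds hy).2.2
    (h.chain 0 t ht y hy) (h.chain 1 t ht y hy) (h.chain 2 t ht y hy)) 0 hx, D_zero]

theorem IsSol.D3_TF (h : IsSol P0 T F) {t x : ℝ} (ht : t ∈ Icc 0 T) (hx : x ∈ J)
    (h0 : F 2 t x = 0) :
    D 3 (TF F t) x = F 4 t x / (1 + F 1 t x ^ 2) + 2 * x * F 3 t x / (x ^ 2 + F 0 t x ^ 2) -
        4 * (x * F 1 t x - F 0 t x) * (1 + F 1 t x ^ 2) / (x ^ 2 + F 0 t x ^ 2) ^ 2 +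
        16 * (x * F 1 t x - F 0 t x) * (x + F 0 t x * F 1 t x) ^ 2 /
          (x ^ 2 + F 0 t x ^ 2) ^ 3 := by
  have h1 := ((h.sm_TF ht).hasDerivWithinAt 2 hx).congr (fun y hy => (h.D2_TF ht hy).symm)
    (h.D2_TF ht hx).symm
  exact (uniqueDiffOn_J x hx).eq_deriv _ h1 (hasDerivWithinAt_gE' (J_bounds hx).2.2
    (h.chain 0 t ht x hx) (h.chain 1 t ht x hx) (h.chain 2 t ht x hx) (h.chain 3 t ht x hx) h0)

theorem IsSol.contOn (h : IsSol P0 T F) (hT : 0 < T) (j : ℕ) :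
    ContinuousOn (fun z : ℝ × ℝ => F j z.1 z.2) (Icc 0 T ×ˢ J) := (h.contDiffOn hT j).continuousOn

theorem IsSol.phase_mono (h : IsSol P0 T F) (hT : 0 < T) (h0 : ∀ x ∈ J, 0 < D 1 (TF F 0) x) :
    ∀ t ∈ Icc 0 T, ∀ x ∈ J, 0 ≤ D 1 (TF F t) x := by
  have c0 := h.contOn hT 0
  have c1 := h.contOn hT 1
  have c2 := h.contOn hT 2
  have cs : ContinuousOn (fun z : ℝ × ℝ => sg z.2) (Icc 0 T ×ˢ J) :=
    ((contDiff_sg (n := 0)).continuous.comp continuous_snd).continuousOn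
  have cs' : ContinuousOn (fun z : ℝ × ℝ => sg' z.2) (Icc 0 T ×ˢ J) :=
    ((contDiff_sg' (n := 0)).continuous.comp continuous_snd).continuousOn
  have cR : ContinuousOn (fun z : ℝ × ℝ => z.2 ^ 2 + F 0 z.1 z.2 ^ 2) (Icc 0 T ×ˢ J) :=
    (continuousOn_snd.pow 2).add (c0.pow 2)
  have hR : ∀ z ∈ Icc 0 T ×ˢ J, z.2 ^ 2 + F 0 z.1 z.2 ^ 2 ≠ 0 := fun z hz => by
    have := (J_bounds hz.2).2.2
    positivity
  have cc : ContinuousOn (fun z : ℝ × ℝ =>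
      (2 * z.2 / (z.2 ^ 2 + F 0 z.1 z.2 ^ 2) -
        2 * F 1 z.1 z.2 * F 2 z.1 z.2 / (1 + F 1 z.1 z.2 ^ 2) ^ 2) * sg' z.2 +
      (-2 / (z.2 ^ 2 + F 0 z.1 z.2 ^ 2) - 4 * F 0 z.1 z.2 * (z.2 * F 1 z.1 z.2 - F 0 z.1 z.2) /
        (z.2 ^ 2 + F 0 z.1 z.2 ^ 2) ^ 2) * sg z.2) (Icc 0 T ×ˢ J) := by
    refine ((((continuousOn_const.mul continuousOn_snd).div cR hR).sub
      (((continuousOn_const.mul c1).mul c2).div ((continuousOn_const.add (c1.pow 2)).pow 2)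
        fun z _ => (by positivity : ((1:ℝ) + F 1 z.1 z.2 ^ 2) ^ 2 ≠ 0))).mul cs').add
      (((continuousOn_const.div cR hR).sub
      (((continuousOn_const.mul c0).mul ((continuousOn_snd.mul c1).sub c0)).div (cR.pow 2)
        fun z hz => pow_ne_zero 2 (hR z hz))).mul cs)
  obtain ⟨K, hK⟩ := (isCompact_Icc.prod isCompact_Icc).exists_bound_of_continuousOn cc
  have hK0 : 0 ≤ |K| := abs_nonneg K
  have key : ∀ δ > 0, ∀ t ∈ Icc 0 T, ∀ x ∈ J, 0 < D 1 (TF F t) x + δ * exp ((|K| + 1) * t) := by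
    intro δ hδ
    have cg := h.continuousOn_D_cp hT 1 sm3_Hf
    refine first_zero (v := fun t x => D 1 (TF F t) x + δ * exp ((|K| + 1) * t))
      (v' := fun t x => (Uu (TF F t) 2 x / (1 + F 1 t x ^ 2) +
        (2 * x / (x ^ 2 + F 0 t x ^ 2) - 2 * F 1 t x * F 2 t x / (1 + F 1 t x ^ 2) ^ 2) *
          Uu (TF F t) 1 x +
        (-2 / (x ^ 2 + F 0 t x ^ 2) - 4 * F 0 t x * (x * F 1 t x - F 0 t x) /
          (x ^ 2 + F 0 t x ^ 2) ^ 2) * Uu (TF F t) 0 x) +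
        δ * (exp ((|K| + 1) * t) * (|K| + 1)))
      (cg.add (by fun_prop)) (fun x hx => add_pos (h0 x hx) (by positivity))
      (fun t ht x hx => ?_) fun t ht x hx hz hge => ?_
    · have a1 := hasDerivWithinAt_gE_time (J_bounds hx).2.2 (h.der 0 t ht x hx)
        (h.der 1 t ht x hx) (h.der 2 t ht x hx)
      have a2 := a1.congr (fun s hs => h.D1_TF hs hx) (h.D1_TF ht hx)
      have a3 : HasDerivAt (fun t : ℝ => δ * exp ((|K| + 1) * t))
          (δ * (exp ((|K| + 1) * t) * (|K| + 1))) t := by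
        have := (((hasDerivAt_id t).const_mul (|K| + 1)).exp).const_mul δ
        simpa using this
      exact a2.fun_add a3.hasDerivWithinAt
    · have e1 : D 1 (D 1 (TF F t)) x = D 2 (TF F t) x := D_D 1 1 (h.sm_TF ht) hx
      have e2 : D 2 (D 1 (TF F t)) x = D 3 (TF F t) x := D_D 2 1 (h.sm_TF ht) hx
      obtain ⟨m1, m2, m3⟩ := min_facts ((h.sm_TF ht).D 1) hx (fun y hy => by
        have := hge t ⟨ht.1, le_rfl⟩ y hy
        linarith)
      rw [e1] at m1 m2
      rw [e2] at m3
      have hb := hK (t, x) ⟨ht, hx⟩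
      simp only [Real.norm_eq_abs] at hb
      have hb2 := hb.trans (le_abs_self K)
      set c1 := 2 * x / (x ^ 2 + F 0 t x ^ 2) - 2 * F 1 t x * F 2 t x / (1 + F 1 t x ^ 2) ^ 2
      set c0 := -2 / (x ^ 2 + F 0 t x ^ 2) - 4 * F 0 t x * (x * F 1 t x - F 0 t x) /
          (x ^ 2 + F 0 t x ^ 2) ^ 2
      set η := δ * exp ((|K| + 1) * t) with hη
      have hη0 : 0 < η := by positivity
      set g := D 1 (TF F t) x
      have hg : g = -η := by linarith
      have u0 : Uu (TF F t) 0 x = -(sg x * η) := by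
        simp only [Uu]; push_cast
        change sg x * g + _ - _ = _
        rw [hg]; ring
      have u1 : Uu (TF F t) 1 x = -(sg' x * η) := by
        simp only [Uu, Nat.sub_self]; push_cast
        change sg x * D 2 (TF F t) x + 1 * sg' x * g - _ = _
        rw [hg]; linarith
      have u2 : 0 ≤ Uu (TF F t) 2 x / (1 + F 1 t x ^ 2) := by
        refine div_nonneg ?_ (by positivity)
        simp only [Uu]; push_cast
        change 0 ≤ sg x * D 3 (TF F t) x + 2 * sg' x * D 2 (TF F t) x - 2 * (2 - 1) * g
        rw [hg]
        linarith
      rw [u0, u1]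
      have h3 : (c1 * sg' x + c0 * sg x) * η ≤ |K| * η :=
        mul_le_mul_of_nonneg_right ((le_abs_self _).trans hb2) hη0.le
      have h4 : δ * (exp ((|K| + 1) * t) * (|K| + 1)) = (|K| + 1) * η := by rw [hη]; ring
      rw [h4]
      linarith
  intro t ht x hx
  refine le_of_forall_pos_le_add fun ε hε => ?_
  have := key (ε / exp ((|K| + 1) * t)) (by positivity) t ht x hx
  rw [div_mul_cancel₀ _ (exp_pos _).ne'] at this
  exact this.le

end
end LBMCF

namespace LBMCF
open scoped Topology ContDiff
open Polynomial (C X)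

/-- The derivative of the initial function; `e` is the value of the initial function at the right
end point. -/
noncomputable def PI (e : ℝ) : Polynomial ℝ := C (100 * e - 799 / 100) - C 2 * X

theorem PI_eval (e x : ℝ) : (PI e).eval x = 100 * e - 799 / 100 - 2 * x := by simp [PI]

theorem PI_natDegree (e : ℝ) : (PI e).natDegree ≤ 1 := by
  unfold PI
  compute_degree

theorem FF_PI (e x : ℝ) : FF (PI e) x =
    1 / 10 + (100 * e - 10) * (x - 1) + (x - 1) * (101 / 100 - x) := by
  simp only [FF, PI_eval]
  rw [intervalIntegral.integral_sub (by simp) (Continuous.intervalIntegrable (by fun_prop) _ _),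
    intervalIntegral.integral_const, intervalIntegral.integral_const_mul, integral_id]
  simp only [smul_eq_mul]
  ring

theorem two_arctan_le {x f : ℝ} (hx : 1 ≤ x) (hf : 0 ≤ f) : 2 * arctan (x⁻¹ * f) ≤ 2 * f := by
  have h1 : x⁻¹ * f ≤ f := by
    have : x⁻¹ ≤ 1 := inv_le_one_of_one_le₀ hx
    nlinarith
  have h2 := abs_arctan_sub_le (x⁻¹ * f) 0
  rw [arctan_zero, sub_zero, sub_zero, abs_of_nonneg (by positivity : 0 ≤ x⁻¹ * f)] at h2
  linarith [le_abs_self (arctan (x⁻¹ * f))]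

theorem monotoneOn_of_D1 {u : ℝ → ℝ} (hu : Sm u) (h : ∀ x ∈ J, 0 ≤ D 1 u x) : MonotoneOn u J := by
  have e0 : D 0 u = u := funext fun y => D_zero u y
  have hd : ∀ x ∈ J, HasDerivWithinAt u (D 1 u x) J x := fun x hx => by
    have := hu.hasDerivWithinAt 0 hx
    rwa [e0] at this
  refine monotoneOn_of_hasDerivWithinAt_nonneg (f' := D 1 u) (convex_Icc _ _)
    (fun x hx => (hd x hx).continuousWithinAt)
    (fun x hx => (hd x (interior_subset hx)).mono interior_subset)
    fun x hx => h x (interior_subset hx)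

theorem one_mem_J : (1 : ℝ) ∈ J := ⟨le_rfl, by norm_num⟩
theorem end_mem_J : (101 / 100 : ℝ) ∈ J := ⟨by norm_num, le_rfl⟩

theorem TF_apply (F : ℕ → ℝ → ℝ → ℝ) (t x : ℝ) :
    TF F t x = arctan (F 1 t x) + 2 * arctan (x⁻¹ * F 0 t x) := rfl

theorem Uu_zero (u : ℝ → ℝ) (x : ℝ) : Uu u 0 x = sg x * D 1 u x := by
  simp [Uu]

theorem Uu_one (u : ℝ → ℝ) (x : ℝ) : Uu u 1 x = sg x * D 2 u x + sg' x * D 1 u x := by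
  simp [Uu]

section
variable {P0 : Polynomial ℝ} {e T : ℝ} {F : ℕ → ℝ → ℝ → ℝ}

theorem IsSol.mono_time (h : IsSol P0 T F) (j : ℕ) {x : ℝ} (hx : x ∈ J)
    (hU : ∀ t ∈ Icc 0 T, 0 ≤ Uu (TF F t) j x) : MonotoneOn (fun t => F j t x) (Icc 0 T) :=
  monotoneOn_of_hasDerivWithinAt_nonneg (f' := fun t => Uu (TF F t) j x) (convex_Icc _ _)
    (fun t ht => (h.der j t ht x hx).continuousWithinAt)
    (fun t ht => (h.der j t (interior_subset ht) x hx).mono interior_subset)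
    fun t ht => hU t (interior_subset ht)

theorem IsSol.end_const (h : IsSol P0 T F) {t : ℝ} (ht : t ∈ Icc 0 T) :
    F 0 t (101 / 100) = F 0 0 (101 / 100) := by
  have h0 : (0 : ℝ) ∈ Icc 0 T := ⟨le_rfl, ht.1.trans ht.2⟩
  have := lipschitz_of_chain (M := 0) (convex_Icc 0 T) (fun t ht => h.der 0 t ht _ end_mem_J)
    (fun t _ => by rw [Uu_zero, sg_b, zero_mul, abs_zero]) t ht 0 h0
  rw [zero_mul] at this
  exact sub_eq_zero.1 (abs_nonpos_iff.1 this)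

/-- A solution starting from the initial function determined by `PI e`. -/
structure IsFlow (e T : ℝ) (F : ℕ → ℝ → ℝ → ℝ) : Prop where
  sol : IsSol (PI e) T F
  pos : 0 < T
  lb : 17 / 100 ≤ e
  ub : e ≤ 21 / 100

namespace IsFlow
variable {t x : ℝ}

theorem zero_mem (h : IsFlow e T F) : (0 : ℝ) ∈ Icc 0 T := ⟨le_rfl, h.pos.le⟩

theorem f_init (h : IsFlow e T F) (hx : x ∈ J) :
    F 0 0 x = 1 / 10 + (100 * e - 10) * (x - 1) + (x - 1) * (101 / 100 - x) := by
  rw [h.sol.init 0 x hx, ← FF_PI]; rfl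

theorem p_init (h : IsFlow e T F) (hx : x ∈ J) : F 1 0 x = 100 * e - 799 / 100 - 2 * x := by
  rw [h.sol.init 1 x hx, ← PI_eval]; rfl

theorem r_init (h : IsFlow e T F) (hx : x ∈ J) : F 2 0 x = -2 := by
  rw [h.sol.init 2 x hx]
  change ((Polynomial.derivative (PI e))).eval x = -2
  simp [PI]

theorem init_phase (h : IsFlow e T F) (hx : x ∈ J) : 0 < D 1 (TF F 0) x := by
  rw [h.sol.D1_TF h.zero_mem hx, h.r_init hx, h.p_init hx, h.f_init hx, gE]
  obtain ⟨h1, h2, h3⟩ := J_bounds hx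
  have hl := h.lb
  have hu := h.ub
  set p := 100 * e - 799 / 100 - 2 * x with hp
  have hp6 : 6 ≤ p := by linarith
  set f := 1 / 10 + (100 * e - 10) * (x - 1) + (x - 1) * (101 / 100 - x) with hf
  have hf0 : 0 ≤ f := by
    have : 0 ≤ (100 * e - 10) * (x - 1) := mul_nonneg (by linarith) (by linarith)
    have : 0 ≤ (x - 1) * (101 / 100 - x) := mul_nonneg (by linarith) (by linarith)
    linarith
  have hf1 : f ≤ 1 / 2 := by nlinarith
  have hR : x ^ 2 + f ^ 2 ≤ 2 := by nlinarith
  have a1 : -2 ≤ -2 / (1 + p ^ 2) := by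
    rw [le_div_iff₀ (by positivity)]; nlinarith [sq_nonneg p]
  have a2 : 5 ≤ 2 * (x * p - f) / (x ^ 2 + f ^ 2) := by
    rw [le_div_iff₀ (by positivity)]; nlinarith
  linarith

theorem g_nonneg (h : IsFlow e T F) (ht : t ∈ Icc 0 T) (hx : x ∈ J) : 0 ≤ D 1 (TF F t) x :=
  h.sol.phase_mono h.pos (fun _ hx => h.init_phase hx) t ht x hx

theorem monotoneOn_time (h : IsFlow e T F) (hx : x ∈ J) :
    MonotoneOn (fun t => F 0 t x) (Icc 0 T) :=
  h.sol.mono_time 0 hx fun t ht => by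
    rw [Uu_zero]; exact mul_nonneg (sg_nonneg hx) (h.g_nonneg ht hx)

theorem f_end (h : IsFlow e T F) (ht : t ∈ Icc 0 T) : F 0 t (101 / 100) = e := by
  rw [h.sol.end_const ht, h.f_init end_mem_J]; ring

theorem f_one (h : IsFlow e T F) (ht : t ∈ Icc 0 T) : F 0 t 1 = 1 / 10 := h.sol.one t ht

theorem p_one_ge (h : IsFlow e T F) (ht : t ∈ Icc 0 T) : 7 ≤ F 1 t 1 := by
  have := h.sol.mono_time 1 one_mem_J (fun t ht => by
    rw [Uu_one, sg_one, zero_mul, zero_add]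
    exact mul_nonneg (by norm_num [sg']) (h.g_nonneg ht one_mem_J)) h.zero_mem ht ht.1
  simp only at this
  rw [h.p_init one_mem_J] at this
  linarith [h.lb]

theorem phase_mono (h : IsFlow e T F) (ht : t ∈ Icc 0 T) : MonotoneOn (TF F t) J :=
  monotoneOn_of_D1 (h.sol.sm_TF ht) fun _ hx => h.g_nonneg ht hx

theorem phase_gt (h : IsFlow e T F) (ht : t ∈ Icc 0 T) (hx : x ∈ J) : π / 2 < TF F t x := by
  refine lt_of_lt_of_le ?_ (h.phase_mono ht one_mem_J hx hx.1)
  rw [TF_apply, h.f_one ht, inv_one, one_mul, two_mul_arctan (by norm_num) (by norm_num)]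
  have h7 : arctan 7 ≤ arctan (F 1 t 1) := arctan_strictMono.monotone (h.p_one_ge ht)
  have h8 := arctan_inv_of_pos (x := 7) (by norm_num)
  have h9 : arctan 7⁻¹ < arctan (2 * (1 / 10) / (1 - (1 / 10) ^ 2)) :=
    arctan_strictMono (by norm_num)
  linarith

theorem f_bounds_of_mono (h : IsFlow e T F) (ht : t ∈ Icc 0 T) (hp : ∀ y ∈ J, 0 ≤ F 1 t y)
    (hx : x ∈ J) : 1 / 10 ≤ F 0 t x ∧ F 0 t x ≤ e := by
  have hm : MonotoneOn (F 0 t) J := monotoneOn_of_D1 (h.sol.sm 0 ht) fun y hy => by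
    rw [h.sol.D_eq 1 0 ht hy]; exact hp y hy
  rw [← h.f_one ht, ← h.f_end ht]
  exact ⟨hm one_mem_J hx hx.1, hm hx end_mem_J hx.2⟩

theorem p_pos (h : IsFlow e T F) : ∀ t ∈ Icc 0 T, ∀ x ∈ J, 0 < F 1 t x := by
  refine first_zero (h.sol.contOn h.pos 1) (fun x hx => ?_) (h.sol.der 1) fun t ht x hx h0 hge => ?_
  · rw [h.p_init hx]
    linarith [h.lb, hx.2]
  · exfalso
    obtain ⟨f1, f2⟩ := h.f_bounds_of_mono ht (hge t ⟨ht.1, le_rfl⟩) hx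
    have h1 := h.phase_gt ht hx
    rw [TF_apply, h0, arctan_zero] at h1
    have := two_arctan_le hx.1 (by linarith : 0 ≤ F 0 t x)
    linarith [h.ub, pi_gt_three]

theorem f_ge (h : IsFlow e T F) (ht : t ∈ Icc 0 T) (hx : x ∈ J) : 1 / 10 ≤ F 0 t x :=
  (h.f_bounds_of_mono ht (fun y hy => (h.p_pos t ht y hy).le) hx).1

theorem f_le (h : IsFlow e T F) (ht : t ∈ Icc 0 T) (hx : x ∈ J) : F 0 t x ≤ e :=
  (h.f_bounds_of_mono ht (fun y hy => (h.p_pos t ht y hy).le) hx).2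

theorem p_gt (h : IsFlow e T F) (ht : t ∈ Icc 0 T) (hx : x ∈ J) : 1 < F 1 t x := by
  have h1 := h.phase_gt ht hx
  rw [TF_apply] at h1
  have h2 := two_arctan_le hx.1 (by linarith [h.f_ge ht hx] : 0 ≤ F 0 t x)
  have h3 := h.f_le ht hx
  refine arctan_strictMono.lt_iff_lt.1 ?_
  rw [arctan_one]
  linarith [h.ub, pi_gt_three]

end IsFlow
end
end LBMCF

namespace LBMCF
open scoped Topology ContDiff

theorem concavity_factor {x f p : ℝ} (hx : 1 ≤ x) (hx' : x ≤ 101 / 100) (hf : 0 ≤ f)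
    (hf' : f ≤ 21 / 100) (hp : 1 < p) :
    3 * (x + f * p) ^ 2 - (x * p - f) ^ 2 ≤ 5 := by
  have c1 : x + f * p ≤ 101 / 100 + 21 / 100 * p := by nlinarith
  have c0 : 0 ≤ x + f * p := by nlinarith
  have c2 : p - 21 / 100 ≤ x * p - f := by nlinarith
  have c3 : (x + f * p) ^ 2 ≤ (101 / 100 + 21 / 100 * p) ^ 2 := pow_le_pow_left₀ c0 c1 2
  have c4 : (p - 21 / 100) ^ 2 ≤ (x * p - f) ^ 2 := pow_le_pow_left₀ (by linarith) c2 2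
  nlinarith [sq_nonneg (p - 1)]

theorem concavity_bracket {p s s' k m : ℝ} (hs : 0 ≤ s) (hs' : s ≤ 1 / 10000)
    (hk0 : 0 ≤ k) (hk1 : k ≤ 101 / 100 + 21 / 100 * p) (h : 3 * k ^ 2 - m ^ 2 ≤ 5)
    (h4 : 0 ≤ s' ∨ -(1 / 100) ≤ s' ∧ p ≤ 22) :
    4 * s * k ^ 2 - s * (m ^ 2 + k ^ 2) - 2 * s' * k - 1 < 0 := by
  have a4 : -2 * s' * k ≤ 1 / 2 := by
    rcases h4 with h | ⟨h, h'⟩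
    · nlinarith only [mul_nonneg h hk0]
    · have := mul_le_mul_of_nonneg_right h hk0
      linarith
  have a5 : s * (3 * k ^ 2 - m ^ 2) ≤ s * 5 := mul_le_mul_of_nonneg_left h hs
  linarith

/-- The sign of the time derivative of `∂ₓₓ f` at an interior maximum where `∂ₓₓ f = 0`. -/
theorem concavity_sign {f p w v x s s' : ℝ} (hx : 1 ≤ x) (hx' : x ≤ 101 / 100) (hf : 0 ≤ f)
    (hf' : f ≤ 21 / 100) (hp : 1 < p) (hs : 0 ≤ s) (hs' : s ≤ 1 / 10000)
    (h1 : s * w = 0) (h2 : s' * w ≤ 0) (h3 : s * v ≤ 0)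
    (h4 : 0 ≤ s' ∨ -(1 / 100) ≤ s' ∧ p ≤ 22) :
    s * (v / (1 + p ^ 2) + 2 * x * w / (x ^ 2 + f ^ 2) -
        4 * (x * p - f) * (1 + p ^ 2) / (x ^ 2 + f ^ 2) ^ 2 +
        16 * (x * p - f) * (x + f * p) ^ 2 / (x ^ 2 + f ^ 2) ^ 3) +
      2 * s' * (w / (1 + p ^ 2) - 4 * (x * p - f) * (x + f * p) / (x ^ 2 + f ^ 2) ^ 2) -
      2 * (2 * (x * p - f) / (x ^ 2 + f ^ 2)) < 0 := by
  have hR0 : 1 ≤ x ^ 2 + f ^ 2 := by nlinarith [sq_nonneg f]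
  obtain ⟨R, hR⟩ : ∃ R, R = x ^ 2 + f ^ 2 := ⟨_, rfl⟩
  rw [← hR] at hR0 ⊢
  have hRp : 0 < R := by linarith
  obtain ⟨m, hm⟩ : ∃ m, m = (x * p - f) / R := ⟨_, rfl⟩
  obtain ⟨k, hk⟩ : ∃ k, k = (x + f * p) / R := ⟨_, rfl⟩
  have hm0 : 0 < m := by
    rw [hm]; exact div_pos (by nlinarith) hRp
  have hk0 : 0 ≤ k := by
    rw [hk]; exact div_nonneg (by nlinarith) hRp.le
  have hk1 : k ≤ 101 / 100 + 21 / 100 * p := by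
    rw [hk, div_le_iff₀ hRp]
    nlinarith
  have hmk : (1 + p ^ 2) / R = m ^ 2 + k ^ 2 := by
    rw [hm, hk]
    field_simp
    rw [hR]; ring
  have e : s * (v / (1 + p ^ 2) + 2 * x * w / R - 4 * (x * p - f) * (1 + p ^ 2) / R ^ 2 +
        16 * (x * p - f) * (x + f * p) ^ 2 / R ^ 3) +
      2 * s' * (w / (1 + p ^ 2) - 4 * (x * p - f) * (x + f * p) / R ^ 2) -
      2 * (2 * (x * p - f) / R) = s * v / (1 + p ^ 2) + 2 * x * (s * w) / R +
      2 * (s' * w) / (1 + p ^ 2) +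
      4 * m * (4 * s * k ^ 2 - s * ((1 + p ^ 2) / R) - 2 * s' * k - 1) := by
    rw [hm, hk]
    have : 1 + p ^ 2 ≠ 0 := by positivity
    field_simp
    ring
  rw [e, h1, hmk]
  have a1 : s * v / (1 + p ^ 2) ≤ 0 := div_nonpos_of_nonpos_of_nonneg h3 (by positivity)
  have a2 : 2 * (s' * w) / (1 + p ^ 2) ≤ 0 :=
    div_nonpos_of_nonpos_of_nonneg (by linarith) (by positivity)
  have a3 : 3 * k ^ 2 - m ^ 2 ≤ 5 := by
    have b1 := concavity_factor hx hx' hf hf' hp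
    have b2 : 3 * k ^ 2 - m ^ 2 = (3 * (x + f * p) ^ 2 - (x * p - f) ^ 2) / R ^ 2 := by
      rw [hm, hk]; field_simp
    have b3 : 1 ≤ R ^ 2 := one_le_pow₀ hR0
    rw [b2, div_le_iff₀ (by positivity)]
    linarith
  have a6 := concavity_bracket hs hs' hk0 hk1 a3 h4
  have a7 := mul_neg_of_pos_of_neg (by linarith : 0 < 4 * m) a6
  simp only [mul_zero, zero_div]
  linarith

theorem sg_le {x : ℝ} : sg x ≤ 1 / 10000 := by
  unfold sg; nlinarith [sq_nonneg (x - 201 / 200)]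

section
variable {e T t x : ℝ} {F : ℕ → ℝ → ℝ → ℝ}
namespace IsFlow

theorem p_antitone_of (h : IsFlow e T F) (ht : t ∈ Icc 0 T) (hr : ∀ y ∈ J, F 2 t y ≤ 0) :
    AntitoneOn (F 1 t) J :=
  antitoneOn_of_hasDerivWithinAt_nonpos (f' := F 2 t) (convex_Icc _ _)
    (fun x hx => (h.sol.chain 1 t ht x hx).continuousWithinAt)
    (fun x hx => (h.sol.chain 1 t ht x (interior_subset hx)).mono interior_subset)
    fun x hx => hr x (interior_subset hx)

theorem f_sub_ge (h : IsFlow e T F) (ht : t ∈ Icc 0 T) (hp : AntitoneOn (F 1 t) J)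
    {y : ℝ} (hx : x ∈ J) (hy : y ∈ J) (hyx : y ≤ x) : F 1 t x * (x - y) ≤ F 0 t x - F 0 t y := by
  have hm : MonotoneOn (fun z => F 0 t z - F 1 t x * z) (Icc y x) := by
    have hsub : Icc y x ⊆ J := Icc_subset_Icc hy.1 hx.2
    refine monotoneOn_of_hasDerivWithinAt_nonneg (f' := fun z => F 1 t z - F 1 t x) (convex_Icc _ _)
      (fun z hz => ?_) (fun z hz => ?_) (fun z hz => ?_)
    · exact (((h.sol.chain 0 t ht z (hsub hz)).mono hsub).continuousWithinAt).sub
        (by fun_prop)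
    · have h1 := ((h.sol.chain 0 t ht z (hsub (interior_subset hz))).mono
        (interior_subset.trans hsub))
      exact (h1.fun_sub ((hasDerivWithinAt_id z _).const_mul (F 1 t x))).congr_deriv (by simp)
    · exact sub_nonneg.2 (hp (hsub (interior_subset hz)) hx (interior_subset hz).2)
  have := hm ⟨le_rfl, hyx⟩ ⟨hyx, le_rfl⟩ hyx
  simp only at this
  linarith

theorem r_neg (h : IsFlow e T F) : ∀ t ∈ Icc 0 T, ∀ x ∈ J, F 2 t x < 0 := by
  suffices hh : ∀ t ∈ Icc 0 T, ∀ x ∈ J, 0 < -F 2 t x from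
    fun t ht x hx => neg_pos.1 (hh t ht x hx)
  refine first_zero (v' := fun t x => -Uu (TF F t) 2 x) (h.sol.contOn h.pos 2).neg
    (fun x hx => by rw [h.r_init hx]; norm_num)
    (fun t ht x hx => (h.sol.der 2 t ht x hx).fun_neg) fun t ht x hx h0 hge => ?_
  have h0' : F 2 t x = 0 := neg_eq_zero.1 h0
  have hch : ∀ j, ∀ y ∈ J, HasDerivWithinAt (fun y => -F (2 + j) t y) (-F (2 + (j + 1)) t y) J y :=
    fun j y hy => (h.sol.chain (2 + j) t ht y hy).fun_neg
  have hD : ∀ k, D k (fun y => -F 2 t y) x = -F (2 + k) t x := fun k => by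
    have := D_eq_of_chain (u := fun j y => -F (2 + j) t y) hch k 0 hx
    simpa using this
  have hr := hge t ⟨ht.1, le_rfl⟩
  obtain ⟨m1, m2, m3⟩ := min_facts (u := fun y => -F 2 t y) (h.sol.sm 2 ht).neg hx
    (fun y hy => by rw [h0]; exact hr y hy)
  rw [hD] at m1 m2 m3
  simp only [Nat.reduceAdd] at m1 m2 m3
  have hanti := h.p_antitone_of ht fun y hy => by linarith [hr y hy]
  have key := concavity_sign (f := F 0 t x) (p := F 1 t x) (w := F 3 t x) (v := F 4 t x)
    (s := sg x) (s' := sg' x) hx.1 hx.2 (by linarith [h.f_ge ht hx])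
    ((h.f_le ht hx).trans h.ub) (h.p_gt ht hx) (sg_nonneg hx) sg_le (by linarith) (by linarith)
    (by linarith) (by
      by_cases hc : x ≤ 201 / 200
      · left; unfold sg'; linarith
      · right
        refine ⟨by unfold sg'; linarith [hx.2], ?_⟩
        have h1 := h.f_sub_ge ht hanti hx one_mem_J hx.1
        have h2 := h.f_le ht hx
        have h3 := h.ub
        rw [h.f_one ht] at h1
        have h4 := h.p_gt ht hx
        nlinarith)
  have hU : Uu (TF F t) 2 x = sg x * D 3 (TF F t) x + 2 * sg' x * D 2 (TF F t) x -
      2 * D 1 (TF F t) x := by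
    simp only [Uu]; push_cast
    norm_num
  rw [hU, h.sol.D3_TF ht hx h0', h.sol.D2_TF ht hx, h.sol.D1_TF ht hx, gE, h0']
  have e1 : F 3 t x / (1 + F 1 t x ^ 2) - 0 * (2 * F 1 t x * 0) / (1 + F 1 t x ^ 2) ^ 2 +
      2 * x * 0 / (x ^ 2 + F 0 t x ^ 2) - 4 * (x * F 1 t x - F 0 t x) *
      (x + F 0 t x * F 1 t x) / (x ^ 2 + F 0 t x ^ 2) ^ 2 = F 3 t x / (1 + F 1 t x ^ 2) -
      4 * (x * F 1 t x - F 0 t x) * (x + F 0 t x * F 1 t x) / (x ^ 2 + F 0 t x ^ 2) ^ 2 := by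
    ring
  rw [e1, zero_div, zero_add]
  linarith

theorem p_antitone (h : IsFlow e T F) (ht : t ∈ Icc 0 T) : AntitoneOn (F 1 t) J :=
  h.p_antitone_of ht fun y hy => (h.r_neg t ht y hy).le

theorem p_one_le (h : IsFlow e T F) (ht : t ∈ Icc 0 T) : F 1 t 1 ≤ 12 * exp t := by
  have hanti : AntitoneOn (fun t => F 1 t 1 * exp (-t)) (Icc 0 T) := by
    have hd : ∀ t ∈ Icc 0 T, HasDerivWithinAt (fun t => F 1 t 1 * exp (-t))
        (Uu (TF F t) 1 1 * exp (-t) + F 1 t 1 * (exp (-t) * (-1))) (Icc 0 T) t := fun t ht =>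
      (h.sol.der 1 t ht 1 one_mem_J).fun_mul
        ((hasDerivWithinAt_id t _).neg.exp)
    refine antitoneOn_of_hasDerivWithinAt_nonpos (convex_Icc _ _)
      (fun t ht => (hd t ht).continuousWithinAt)
      (fun t ht => (hd t (interior_subset ht)).mono interior_subset) fun t ht => ?_
    replace ht := interior_subset ht
    have h1 : Uu (TF F t) 1 1 ≤ F 1 t 1 := by
      rw [Uu_one, sg_one, zero_mul, zero_add, h.sol.D1_TF ht one_mem_J, gE, h.f_one ht]
      have h2 : F 2 t 1 / (1 + F 1 t 1 ^ 2) ≤ 0 :=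
        div_nonpos_of_nonpos_of_nonneg (h.r_neg t ht 1 one_mem_J).le (by positivity)
      have h3 := h.p_gt ht one_mem_J
      have h4 : 2 * (1 * F 1 t 1 - 1 / 10) / (1 ^ 2 + (1 / 10 : ℝ) ^ 2) ≤ 2 * F 1 t 1 := by
        rw [div_le_iff₀ (by norm_num)]
        linarith
      unfold sg'
      linarith
    have := mul_le_mul_of_nonneg_right h1 (exp_pos (-t)).le
    linarith
  have := hanti h.zero_mem ht ht.1
  simp only [neg_zero, exp_zero, mul_one] at this
  rw [h.p_init one_mem_J, exp_neg, ← div_eq_mul_inv, div_le_iff₀ (exp_pos t)] at this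
  have h2 := h.ub
  nlinarith [exp_pos t]

theorem p_le (h : IsFlow e T F) (ht : t ∈ Icc 0 T) (hx : x ∈ J) : F 1 t x ≤ 12 * exp t :=
  (h.p_antitone ht one_mem_J hx hx.1).trans (h.p_one_le ht)

theorem C1_bound (h : IsFlow e T F) {T' : ℝ} (hT : T ≤ T') (ht : t ∈ Icc 0 T) (hx : x ∈ J) :
    |F 1 t x| ≤ 4 * (12 * exp T') * (1 + (12 * exp T') ^ 2) ∧
      |F 2 t x| ≤ 4 * (12 * exp T') * (1 + (12 * exp T') ^ 2) := by
  have h1 : F 1 t x ≤ 12 * exp T' := (h.p_le ht hx).trans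
    (mul_le_mul_of_nonneg_left (exp_le_exp.2 (ht.2.trans hT)) (by norm_num))
  obtain ⟨M, hM⟩ : ∃ M, M = 12 * exp T' := ⟨_, rfl⟩
  rw [← hM] at h1 ⊢
  have hp := h.p_gt ht hx
  have hM0 : 1 < M := by linarith
  have hr := h.r_neg t ht x hx
  have hg := h.g_nonneg ht hx
  rw [h.sol.D1_TF ht hx, gE] at hg
  have hf := h.f_ge ht hx
  have hb : 2 * (x * F 1 t x - F 0 t x) / (x ^ 2 + F 0 t x ^ 2) ≤ 4 * M := by
    have h1x := hx.1
    have h2x := hx.2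
    rw [div_le_iff₀ (by positivity)]
    have : 1 ≤ x ^ 2 + F 0 t x ^ 2 := by nlinarith
    nlinarith
  refine ⟨?_, ?_⟩
  · rw [abs_of_pos (by linarith)]
    nlinarith [sq_nonneg M]
  · rw [abs_of_neg hr]
    have h2 : -(4 * M) ≤ F 2 t x / (1 + F 1 t x ^ 2) := by linarith
    rw [le_div_iff₀ (by positivity)] at h2
    have h3 : F 1 t x ^ 2 ≤ M ^ 2 := pow_le_pow_left₀ (by linarith) h1 2
    nlinarith

end IsFlow
end
end LBMCF

namespace LBMCF
open scoped Topology ContDiff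

section
variable {P0 : Polynomial ℝ} {P Q : ℕ → ℝ → Polynomial ℝ} {T : ℝ} {l : Ultrafilter ℕ}

theorem Fam.uniform (h : Fam P0 P Q T l) (j : ℕ) {ε : ℝ} (hε : 0 < ε) :
    ∀ᶠ N in (l : Filter ℕ), ∀ t ∈ Icc 0 T, ∀ x ∈ J, |pc (P N t) j x - gl P l j t x| ≤ ε := by
  obtain ⟨M1, hM1, h1⟩ := h.time_lip j
  obtain ⟨M2, h2⟩ := h.pc_bound (j + 1)
  have := uniform_of_lipschitz (S := Icc 0 T ×ˢ J) (isCompact_Icc.prod isCompact_Icc)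
    (l := (l : Filter ℕ)) (u := fun N (z : ℝ × ℝ) => pc (P N z.1) j z.2)
    (g := fun z => gl P l j z.1 z.2) (M := M1 + |M2|) (by
      filter_upwards [h1, h2] with N a1 a2 y hy z hz
      have b1 := a1 y.1 hy.1 z.1 hz.1 y.2 hy.2
      have b2 := lipschitz_of_chain (convex_Icc 1 (101 / 100))
        (fun x hx => pc_chain (P N z.1) j hx)
        (fun x hx => (a2 z.1 hz.1 x hx).trans (le_abs_self M2)) y.2 hy.2 z.2 hz.2
      have c1 : dist y.1 z.1 ≤ dist y z := by rw [Prod.dist_eq]; exact le_max_left _ _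
      have c2 : dist y.2 z.2 ≤ dist y z := by rw [Prod.dist_eq]; exact le_max_right _ _
      have d1 := mul_le_mul_of_nonneg_left c1 hM1
      have d2 := mul_le_mul_of_nonneg_left c2 (abs_nonneg M2)
      have := abs_sub_le (pc (P N y.1) j y.2) (pc (P N z.1) j y.2) (pc (P N z.1) j z.2)
      linarith) (fun z hz => h.tendsto j hz.1 hz.2) hε
  filter_upwards [this] with N hN t ht x hx using hN (t, x) ⟨ht, hx⟩

theorem Fam.extend {T' K τ : ℝ} (h : Fam P0 P Q T l) (hT : 0 ≤ T)
    (hK : ∀ᶠ N in (l : Filter ℕ), ∀ t ∈ Icc 0 T, F2 (ev (P N t)) ≤ K)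
    (hloc : ∀ (N : ℕ) P Q, Gal P0 N P Q → ∀ t1, 0 ≤ t1 →
      F2 (ev (P t1)) ≤ K → ∀ t, t1 ≤ t → t ≤ t1 + τ → t ≤ N → F2 (ev (P t)) ≤ K + 1)
    (hT' : T' ≤ T + τ) : Fam P0 P Q T' l where
  gal := h.gal
  le := h.le
  bd := by
    refine ⟨K + 1, ?_⟩
    filter_upwards [hK, h.gal, h.le T'] with N h1 h2 h3 t ht
    rcases le_total t T with htT | htT
    · linarith [h1 t ⟨ht.1, htT⟩]
    · exact hloc N _ _ h2 T hT (h1 T ⟨hT, le_rfl⟩) t htT (ht.2.trans hT') (ht.2.trans h3)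

theorem Fam.C1_bound {e T' : ℝ} (h : Fam (PI e) P Q T l) (hT : 0 < T) (hTT : T ≤ T')
    (he : 17 / 100 ≤ e) (he' : e ≤ 21 / 100) : ∀ᶠ N in (l : Filter ℕ), ∀ t ∈ Icc 0 T, ∀ x ∈ J,
      |ev (P N t) x| ≤ 4 * (12 * exp T') * (1 + (12 * exp T') ^ 2) + 1 ∧
      |D 1 (ev (P N t)) x| ≤ 4 * (12 * exp T') * (1 + (12 * exp T') ^ 2) + 1 := by
  have hF : IsFlow e T (gl P l) := ⟨h.isSol hT.le, hT, he, he'⟩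
  filter_upwards [h.uniform 1 one_pos, h.uniform 2 one_pos] with N h1 h2 t ht x hx
  obtain ⟨b1, b2⟩ := hF.C1_bound hTT ht hx
  have a1 := h1 t ht x hx
  have a2 := h2 t ht x hx
  rw [pc_succ _ 0 hx, D_zero] at a1
  rw [pc_succ _ 1 hx] at a2
  have c1 := abs_sub_abs_le_abs_sub (ev (P N t) x) (gl P l 1 t x)
  have c2 := abs_sub_abs_le_abs_sub (D 1 (ev (P N t)) x) (gl P l 2 t x)
  constructor <;> linarith

theorem Fam.all_time {e T' : ℝ} (h : Fam (PI e) P Q 0 l) (hT' : 0 < T') (he : 17 / 100 ≤ e)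
    (he' : e ≤ 21 / 100) : Fam (PI e) P Q T' l := by
  obtain ⟨K, hK⟩ := Gal.F2_of_C1 (P0 := PI e) T'
    (4 * (12 * exp T') * (1 + (12 * exp T') ^ 2) + 1)
  obtain ⟨τ, hτ, hloc⟩ := Gal.F2_local (P0 := PI e) K
  obtain ⟨τ₀, hτ₀, hloc₀⟩ := Gal.F2_local (P0 := PI e) (F2 (ev (PI e)))
  have main : ∀ n : ℕ, Fam (PI e) P Q (min (τ₀ + n * τ) T') l := by
    intro n
    induction n with
    | zero =>
      refine h.extend le_rfl ?_ hloc₀ ((min_le_left _ _).trans_eq (by simp))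
      filter_upwards [h.gal] with N h1 t ht
      have : t = 0 := le_antisymm ht.2 ht.1
      rw [this, h1.init]
    | succ n ih =>
      have hpos : 0 < min (τ₀ + n * τ) T' := lt_min (by positivity) hT'
      refine ih.extend hpos.le ?_ hloc ?_
      · filter_upwards [ih.gal, ih.le (min (τ₀ + n * τ) T'),
          ih.C1_bound hpos (min_le_right _ _) he he'] with N h1 h2 h3
        exact hK N _ _ _ (min_le_right _ _) h2 h1 h3
      · rcases le_total (τ₀ + n * τ) T' with hc | hc
        · rw [min_eq_left hc]
          refine (min_le_left _ _).trans ?_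
          push_cast
          linarith
        · rw [min_eq_right hc]
          exact (min_le_right _ _).trans (by linarith)
  obtain ⟨n, hn⟩ := exists_nat_gt (T' / τ)
  have := main n
  rwa [min_eq_right] at this
  rw [div_lt_iff₀ hτ] at hn
  linarith

end

/-- Long time existence for the reduced flow. -/
theorem exists_flow {e : ℝ} (he : 17 / 100 ≤ e) (he' : e ≤ 21 / 100) :
    ∃ F : ℕ → ℝ → ℝ → ℝ, ∀ T > 0, IsFlow e T F := by
  have hex : ∀ N : ℕ, ∃ PQ : (ℝ → Polynomial ℝ) × (ℝ → Polynomial ℝ),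
      1 ≤ N → Gal (PI e) N PQ.1 PQ.2 := fun N => by
    by_cases hN : 1 ≤ N
    · obtain ⟨P, Q, h⟩ := exists_Gal ((PI_natDegree e).trans hN)
      exact ⟨(P, Q), fun _ => h⟩
    · exact ⟨(fun _ => 0, fun _ => 0), fun h => absurd h hN⟩
  choose PQ hPQ using hex
  have hl : ((hyperfilter ℕ : Ultrafilter ℕ) : Filter ℕ) ≤ atTop := by
    rw [← Nat.cofinite_eq_atTop]; exact hyperfilter_le_cofinite
  have hgal : ∀ᶠ N in ((hyperfilter ℕ : Ultrafilter ℕ) : Filter ℕ),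
      Gal (PI e) N (PQ N).1 (PQ N).2 := hl ((eventually_ge_atTop 1).mono hPQ)
  have h0 : Fam (PI e) (fun N => (PQ N).1) (fun N => (PQ N).2) 0 (hyperfilter ℕ) := by
    refine ⟨hgal, fun n => hl ?_, ⟨F2 (ev (PI e)), ?_⟩⟩
    · obtain ⟨m, hm⟩ := exists_nat_ge n
      filter_upwards [eventually_ge_atTop m] with N hN
      exact hm.trans (by exact_mod_cast hN)
    · filter_upwards [hgal] with N h1 t ht
      have : t = 0 := le_antisymm ht.2 ht.1
      rw [this, h1.init]
  exact ⟨_, fun T hT => ⟨(h0.all_time hT he he').isSol hT.le, hT, he, he'⟩⟩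

end LBMCF

namespace LBMCF
open scoped Topology ContDiff

/-- The first integral `Re ((1 - i / 10) ^ 2 * (x + i * y) ^ 3)` of the limiting equation. -/
noncomputable def CC (x y : ℝ) : ℝ :=
  99 / 100 * (x ^ 3 - 3 * x * y ^ 2) + 1 / 5 * (3 * x ^ 2 * y - y ^ 3)

theorem hasDerivWithinAt_CC {f : ℝ → ℝ} {p x : ℝ} {s : Set ℝ} (hf : HasDerivWithinAt f p s x) :
    HasDerivWithinAt (fun x => CC x (f x))
      (3 * (99 / 100 * (x ^ 2 - f x ^ 2) + 2 / 5 * x * f x) -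
        6 * (f x - x / 10) * (x + f x / 10) * p) s x := by
  have hi := hasDerivWithinAt_id x s
  have h := (((hi.fun_pow 3).fun_sub ((hi.const_mul 3).fun_mul (hf.fun_pow 2))).const_mul
    (99 / 100)).fun_add (((((hi.fun_pow 2).const_mul 3).fun_mul hf).fun_sub
      (hf.fun_pow 3)).const_mul (1 / 5))
  refine h.congr_deriv ?_
  simp only [id]
  push_cast
  ring

theorem CC_strictAntiOn {x : ℝ} (hx : 0 < x) : StrictAntiOn (CC x) (Ici (x / 10)) := by
  have hd : ∀ y, HasDerivAt (CC x) (-6 * (y - x / 10) * (x + y / 10)) y := fun y => by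
    have hi := hasDerivAt_id y
    have h := ((((hi.fun_pow 2).const_mul (3 * x)).const_sub (x ^ 3)).const_mul
      (99 / 100)).fun_add (((hi.const_mul (3 * x ^ 2)).fun_sub (hi.fun_pow 3)).const_mul (1 / 5))
    refine h.congr_deriv ?_
    simp only [id]
    push_cast
    ring
  refine strictAntiOn_of_deriv_neg (convex_Ici _) (fun y _ => (hd y).continuousAt.continuousWithinAt)
    fun y hy => ?_
  rw [interior_Ici] at hy
  have hy' : x / 10 < y := hy
  rw [(hd y).deriv]
  have : 0 < (y - x / 10) * (x + y / 10) := mul_pos (by linarith) (by linarith)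
  linarith

theorem CC_lipschitz {x y x' y' : ℝ} (hx : x ∈ Icc (0 : ℝ) 2) (hy : y ∈ Icc (0 : ℝ) 1)
    (hx' : x' ∈ Icc (0 : ℝ) 2) (hy' : y' ∈ Icc (0 : ℝ) 1) :
    |CC x y - CC x' y'| ≤ 40 * (|x - x'| + |y - y'|) := by
  have e : CC x y - CC x' y' = (99 / 100 * (x ^ 2 + x * x' + x' ^ 2 - 3 * y ^ 2) +
      3 / 5 * (x + x') * y) * (x - x') +
      (-297 / 100 * x' * (y + y') + 3 / 5 * x' ^ 2 - 1 / 5 * (y ^ 2 + y * y' + y' ^ 2)) *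
        (y - y') := by
    unfold CC; ring
  obtain ⟨h1, h2⟩ := hx
  obtain ⟨h3, h4⟩ := hy
  obtain ⟨h5, h6⟩ := hx'
  obtain ⟨h7, h8⟩ := hy'
  have a1 : |99 / 100 * (x ^ 2 + x * x' + x' ^ 2 - 3 * y ^ 2) + 3 / 5 * (x + x') * y| ≤ 40 := by
    rw [abs_le]
    constructor
    · nlinarith [mul_nonneg h1 h5, mul_nonneg (add_nonneg h1 h5) h3]
    · nlinarith [mul_nonneg h1 h5, mul_le_mul h2 h6 h5 (by norm_num),
        mul_le_mul (add_le_add h2 h6) h4 h3 (by norm_num)]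
  have a2 : |-297 / 100 * x' * (y + y') + 3 / 5 * x' ^ 2 - 1 / 5 * (y ^ 2 + y * y' + y' ^ 2)| ≤ 40 := by
    rw [abs_le]
    constructor
    · nlinarith [mul_nonneg h3 h7, mul_le_mul h6 (add_le_add h4 h8) (by linarith) (by norm_num),
        mul_le_mul h4 h8 h7 (by norm_num)]
    · nlinarith [mul_nonneg h3 h7, mul_nonneg h5 (add_nonneg h3 h7)]
  rw [e]
  refine (abs_add_le _ _).trans ?_
  rw [abs_mul, abs_mul, mul_add 40]
  exact add_le_add (mul_le_mul_of_nonneg_right a1 (abs_nonneg _))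
    (mul_le_mul_of_nonneg_right a2 (abs_nonneg _))

theorem CC_deriv_eq {x y p : ℝ} (hx : 0 < x) :
    3 * (99 / 100 * (x ^ 2 - y ^ 2) + 2 / 5 * x * y) - 6 * (y - x / 10) * (x + y / 10) * p =
      303 / 100 * (x ^ 2 + y ^ 2) * √(1 + p ^ 2) *
        cos (arctan p + 2 * arctan (x⁻¹ * y) - 2 * arctan (1 / 10)) := by
  have c1 : ∀ u, cos (2 * arctan u) = (1 - u ^ 2) / (1 + u ^ 2) := fun u => by
    rw [cos_two_mul, cos_sq_arctan]; field_simp; ring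
  have s1 : ∀ u, sin (2 * arctan u) = 2 * u / (1 + u ^ 2) := fun u => by
    have : 0 < 1 + u ^ 2 := by positivity
    have h2 := Real.sq_sqrt this.le
    rw [sin_two_mul, sin_arctan, cos_arctan]
    field_simp
    rw [h2]
  rw [cos_sub, cos_add, sin_add, c1, s1, c1, s1, cos_arctan, sin_arctan]
  have h0 : 0 < 1 + p ^ 2 := by positivity
  have h1 : √(1 + p ^ 2) ≠ 0 := (Real.sqrt_pos.2 h0).ne'
  have h2 : x ^ 2 + y ^ 2 ≠ 0 := by positivity
  have h3 : 1 + (x⁻¹ * y) ^ 2 = (x ^ 2 + y ^ 2) / x ^ 2 := by field_simp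
  rw [h3]
  field_simp
  ring

/-- The argument of `arccos` in the trigonometric solution of the cubic equation for the limit. -/
noncomputable def Targ (x : ℝ) : ℝ := -1 + 2 / 101 * (1 - x⁻¹ ^ 3)

/-- The limiting profile. -/
noncomputable def finf (x : ℝ) : ℝ := x * (-99 / 20 + 101 / 10 * cos (arccos (Targ x) / 3))

theorem Targ_bounds {x : ℝ} (hx : 1 ≤ x) : -1 ≤ Targ x ∧ Targ x < 1 := by
  have h1 : x⁻¹ ≤ 1 := inv_le_one_of_one_le₀ hx
  have h0 : 0 < x⁻¹ := by positivity
  have h2 : x⁻¹ ^ 3 ≤ 1 := pow_le_one₀ h0.le h1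
  have h3 : 0 < x⁻¹ ^ 3 := by positivity
  unfold Targ
  constructor <;> linarith

theorem Targ_gt {x : ℝ} (hx : 1 < x) : -1 < Targ x := by
  have h1 : x⁻¹ < 1 := inv_lt_one_of_one_lt₀ hx
  have h0 : 0 < x⁻¹ := by positivity
  have h2 : x⁻¹ ^ 3 < 1 := pow_lt_one₀ h0.le h1 (by norm_num)
  unfold Targ
  linarith

theorem CC_finf {x : ℝ} (hx : 1 ≤ x) : CC x (finf x) = 10201 / 10000 := by
  obtain ⟨h1, h2⟩ := Targ_bounds hx
  have h3 := cos_three_mul (arccos (Targ x) / 3)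
  rw [mul_div_cancel₀ _ (three_ne_zero), cos_arccos h1 h2.le] at h3
  have hx0 : x ≠ 0 := by positivity
  have hT : x ^ 3 * Targ x = x ^ 3 * (-99 / 101) - 2 / 101 := by
    unfold Targ; field_simp; ring
  set v := cos (arccos (Targ x) / 3)
  have : CC x (finf x) = 10201 / 10000 * x ^ 3 -
      1030301 / 20000 * (x ^ 3 * (4 * v ^ 3 - 3 * v) + x ^ 3) := by
    unfold CC finf; ring
  rw [this, ← h3, hT]
  ring

theorem finf_one : finf 1 = 1 / 10 := by
  have : Targ 1 = -1 := by norm_num [Targ]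
  rw [finf, this, arccos_neg_one, cos_pi_div_three]
  norm_num

theorem finf_gt {x : ℝ} (hx : 1 < x) : x / 10 < finf x := by
  have h1 : arccos (Targ x) < π := by
    rw [← arccos_neg_one]
    exact arccos_lt_arccos le_rfl (Targ_gt hx) (Targ_bounds hx.le).2.le
  have h2 : cos (π / 3) < cos (arccos (Targ x) / 3) :=
    cos_lt_cos_of_nonneg_of_le_pi (by linarith [arccos_nonneg (Targ x)])
      (by linarith [pi_pos]) (by linarith)
  rw [cos_pi_div_three] at h2
  unfold finf
  have := mul_lt_mul_of_pos_left (show (1 / 10 : ℝ) < -99 / 20 + 101 / 10 *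
    cos (arccos (Targ x) / 3) by linarith) (by linarith : 0 < x)
  linarith

theorem finf_ge {x : ℝ} (hx : 1 ≤ x) : x / 10 ≤ finf x := by
  rcases eq_or_lt_of_le hx with h | h
  · rw [← h, finf_one]
  · exact (finf_gt h).le

theorem finf_end_bounds : 17 / 100 ≤ finf (101 / 100) ∧ finf (101 / 100) ≤ 21 / 100 := by
  have h := CC_finf (x := 101 / 100) (by norm_num)
  have h0 := finf_ge (x := 101 / 100) (by norm_num)
  have ha := CC_strictAntiOn (x := 101 / 100) (by norm_num)
  constructor
  · refine (ha.le_iff_ge h0 ?_).1 ?_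
    · norm_num
    · rw [h]; norm_num [CC]
  · refine (ha.le_iff_ge ?_ h0).1 ?_
    · norm_num
    · rw [h]; norm_num [CC]

theorem continuousOn_finf : ContinuousOn finf J := by
  have h : ContinuousOn Targ J := by
    unfold Targ
    have : ContinuousOn (fun x : ℝ => x⁻¹) J := continuousOn_inv₀.mono fun x hx =>
      (J_bounds hx).2.2.ne'
    exact continuousOn_const.add (continuousOn_const.mul (continuousOn_const.sub (this.pow 3)))
  exact continuousOn_id.mul (continuousOn_const.add (continuousOn_const.mul
    (continuous_cos.comp_continuousOn ((continuous_arccos.comp_continuousOn h).div_const 3))))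

theorem contDiffAt_finf {x : ℝ} (hx : 1 < x) : ContDiffAt ℝ ∞ finf x := by
  have h1 : ContDiffAt ℝ ∞ Targ x := by
    unfold Targ
    exact contDiffAt_const.add (contDiffAt_const.mul (contDiffAt_const.sub
      ((contDiffAt_inv ℝ (by positivity)).pow 3)))
  have h2 := (contDiffAt_arccos (n := ∞) (Targ_gt hx).ne' (Targ_bounds hx.le).2.ne).comp x h1
  exact contDiffAt_id.mul (contDiffAt_const.add (contDiffAt_const.mul
    (contDiff_cos.contDiffAt.comp x (h2.div_const 3))))

theorem tendsto_deriv_finf : Tendsto (deriv finf) (𝓝[>] 1) atTop := by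
  have hI : Ioo (1 : ℝ) (101 / 100) ∈ 𝓝[>] (1 : ℝ) := Ioo_mem_nhdsGT (by norm_num)
  have hf : Tendsto finf (𝓝[>] 1) (𝓝 (1 / 10)) := by
    have := (continuousOn_finf 1 one_mem_J).tendsto
    rw [finf_one] at this
    refine this.mono_left (nhdsWithin_le_of_mem ?_)
    filter_upwards [hI] with x hx using ⟨hx.1.le, hx.2.le⟩
  have hid : Tendsto (fun x : ℝ => x) (𝓝[>] (1 : ℝ)) (𝓝 1) := nhdsWithin_le_nhds
  have hn : Tendsto (fun x => 3 * (99 / 100 * (x ^ 2 - finf x ^ 2) + 2 / 5 * x * finf x))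
      (𝓝[>] 1) (𝓝 (3 * (99 / 100 * (1 ^ 2 - (1 / 10) ^ 2) + 2 / 5 * 1 * (1 / 10)))) :=
    ((((hid.pow 2).sub (hf.pow 2)).const_mul _).add ((hid.const_mul _).mul hf)).const_mul _
  have hd : Tendsto (fun x => 6 * (finf x - x / 10) * (x + finf x / 10)) (𝓝[>] 1) (𝓝[>] 0) := by
    refine tendsto_nhdsWithin_iff.2 ⟨?_, ?_⟩
    · have := ((hf.sub (hid.div_const 10)).const_mul 6).mul (hid.add (hf.div_const 10))
      simpa using this
    · filter_upwards [hI] with x hx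
      have := finf_gt hx.1
      have := hx.1
      exact show (0 : ℝ) < _ from mul_pos (by linarith) (by linarith)
  have := hn.pos_mul_atTop (by norm_num) (tendsto_inv_nhdsGT_zero.comp hd)
  refine this.congr' ?_
  filter_upwards [hI] with x hx
  have h1 := ((contDiffAt_finf hx.1).differentiableAt (by simp)).hasDerivAt
  have h2 := (hasDerivWithinAt_CC (s := univ) h1.hasDerivWithinAt).hasDerivAt univ_mem
  have h3 : HasDerivAt (fun x => CC x (finf x)) 0 x := by
    refine (hasDerivAt_const x (10201 / 10000 : ℝ)).congr_of_eventuallyEq ?_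
    filter_upwards [Ioi_mem_nhds hx.1] with y hy using CC_finf (le_of_lt hy)
  have h4 := h2.unique h3
  have h5 : 6 * (finf x - x / 10) * (x + finf x / 10) ≠ 0 := by
    have := finf_gt hx.1
    have := hx.1
    exact (mul_pos (by linarith) (by linarith)).ne'
  simp only [Function.comp]
  rw [← div_eq_mul_inv, div_eq_iff h5]
  linarith

end LBMCF

namespace LBMCF
open scoped Topology ContDiff

section
variable {e T : ℝ} {F : ℕ → ℝ → ℝ → ℝ} {t x : ℝ}

namespace IsFlow

theorem mem_Icc_one (h : IsFlow e T F) (ht : t ∈ Icc 0 T) (hx : x ∈ J) : F 0 t x ∈ Icc (0 : ℝ) 1 :=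
  ⟨by linarith [h.f_ge ht hx], by linarith [h.f_le ht hx, h.ub]⟩

theorem hasDerivWithinAt_CC (h : IsFlow e T F) (ht : t ∈ Icc 0 T) (hx : x ∈ J) :
    HasDerivWithinAt (fun x => CC x (F 0 t x)) (303 / 100 * (x ^ 2 + F 0 t x ^ 2) *
      √(1 + F 1 t x ^ 2) * cos (TF F t x - 2 * arctan (1 / 10))) J x :=
  (LBMCF.hasDerivWithinAt_CC (h.sol.chain 0 t ht x hx)).congr_deriv
    (CC_deriv_eq (J_bounds hx).2.2)

theorem continuousOn_CC (h : IsFlow e T F) (ht : t ∈ Icc 0 T) :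
    ContinuousOn (fun x => CC x (F 0 t x)) J :=
  fun _ hx => (h.hasDerivWithinAt_CC ht hx).continuousWithinAt

theorem phase_bounds (h : IsFlow e T F) (ht : t ∈ Icc 0 T) (hx : x ∈ J) :
    0 < TF F t x - 2 * arctan (1 / 10) ∧ TF F t x - 2 * arctan (1 / 10) < π := by
  have h1 := h.phase_gt ht hx
  have h2 := two_arctan_le (x := 1) (f := 1 / 10) le_rfl (by norm_num)
  rw [inv_one, one_mul] at h2
  have h3 : 0 < arctan (1 / 10) := arctan_pos.2 (by norm_num)
  have h4 := two_arctan_le hx.1 (h.mem_Icc_one ht hx).1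
  have h5 := arctan_lt_pi_div_two (F 1 t x)
  have h6 := pi_gt_three
  have h7 := h.f_le ht hx
  have h8 := h.ub
  rw [TF_apply] at h1 ⊢
  constructor <;> linarith

theorem coeff_nonneg : 0 ≤ 303 / 100 * (x ^ 2 + F 0 t x ^ 2) * √(1 + F 1 t x ^ 2) := by
  positivity

theorem coeff_le (h : IsFlow e T F) (ht : t ∈ Icc 0 T) (hx : x ∈ J) :
    303 / 100 * (x ^ 2 + F 0 t x ^ 2) * √(1 + F 1 t x ^ 2) ≤ 4 * (1 + F 1 t x) := by
  obtain ⟨h1, h2, h3⟩ := J_bounds hx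
  have h4 := h.f_ge ht hx
  have h5 := (h.f_le ht hx).trans h.ub
  have h6 := h.p_pos t ht x hx
  have h7 : √(1 + F 1 t x ^ 2) ≤ 1 + F 1 t x := by
    rw [sqrt_le_left (by linarith)]
    nlinarith
  have h8 : 303 / 100 * (x ^ 2 + F 0 t x ^ 2) ≤ 4 := by nlinarith
  exact mul_le_mul h8 h7 (sqrt_nonneg _) (by norm_num)

/-- The first integral is at least its boundary value. -/
theorem CC_ge (h : IsFlow (finf (101 / 100)) T F) (ht : t ∈ Icc 0 T) (hx : x ∈ J) :
    10201 / 10000 ≤ CC x (F 0 t x) := by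
  have hsub1 : Icc 1 x ⊆ J := Icc_subset_Icc_right hx.2
  have hsub2 : Icc x (101 / 100) ⊆ J := Icc_subset_Icc_left hx.1
  rcases le_total (TF F t x - 2 * arctan (1 / 10)) (π / 2) with hc | hc
  · have hm : MonotoneOn (fun x => CC x (F 0 t x)) (Icc 1 x) :=
      monotoneOn_of_hasDerivWithinAt_nonneg (convex_Icc _ _)
        ((h.continuousOn_CC ht).mono hsub1)
        (fun y hy => (h.hasDerivWithinAt_CC ht (hsub1 (interior_subset hy))).mono
          (interior_subset.trans hsub1)) (fun y hy => by
          have hy' := interior_subset hy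
          have h1 := h.phase_mono ht (hsub1 hy') hx hy'.2
          have h2 := (h.phase_bounds ht (hsub1 hy')).1
          exact mul_nonneg coeff_nonneg
            (cos_nonneg_of_mem_Icc ⟨by linarith [pi_pos], by linarith⟩))
    have := hm ⟨le_rfl, hx.1⟩ ⟨hx.1, le_rfl⟩ hx.1
    simp only [h.f_one ht] at this
    refine le_trans (le_of_eq ?_) this
    norm_num [CC]
  · have hm : AntitoneOn (fun x => CC x (F 0 t x)) (Icc x (101 / 100)) :=
      antitoneOn_of_hasDerivWithinAt_nonpos (convex_Icc _ _)
        ((h.continuousOn_CC ht).mono hsub2)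
        (fun y hy => (h.hasDerivWithinAt_CC ht (hsub2 (interior_subset hy))).mono
          (interior_subset.trans hsub2)) (fun y hy => by
          have hy' := interior_subset hy
          have h1 := h.phase_mono ht hx (hsub2 hy') hy'.1
          have h2 := (h.phase_bounds ht (hsub2 hy')).2
          exact mul_nonpos_of_nonneg_of_nonpos coeff_nonneg
            (cos_nonpos_of_pi_div_two_le_of_le (by linarith) (by linarith [pi_pos])))
    have := hm ⟨le_rfl, hx.2⟩ ⟨hx.2, le_rfl⟩ hx.2
    simp only [h.f_end ht] at this
    rwa [CC_finf (by norm_num)] at this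

theorem f_le_finf (h : IsFlow (finf (101 / 100)) T F) (ht : t ∈ Icc 0 T) (hx : x ∈ J) :
    F 0 t x ≤ finf x := by
  rcases le_total (F 0 t x) (x / 10) with hc | hc
  · exact hc.trans (finf_ge hx.1)
  · rw [← (CC_strictAntiOn (J_bounds hx).2.2).le_iff_ge (finf_ge hx.1) hc, CC_finf hx.1]
    exact h.CC_ge ht hx

/-- If the phase oscillates by at most `η` on `[x, y]`, then the first integral at an intermediate
point is almost bounded by one of its values at the ends. -/
theorem CC_le_or (h : IsFlow e T F) (ht : t ∈ Icc 0 T) {y z η : ℝ} (hx : x ∈ J) (hy : y ∈ J)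
    (hxz : x ≤ z) (hzy : z ≤ y) (hη : 0 ≤ η) (hosc : TF F t y - TF F t x ≤ η) :
    CC z (F 0 t z) ≤ CC x (F 0 t x) + 4 * η ∨ CC z (F 0 t z) ≤ CC y (F 0 t y) + 4 * η := by
  have hz : z ∈ J := ⟨hx.1.trans hxz, hzy.trans hy.2⟩
  have hsub1 : Icc x z ⊆ J := Icc_subset_Icc hx.1 hz.2
  have hsub2 : Icc z y ⊆ J := Icc_subset_Icc hz.1 hy.2
  have hlin : ∀ w ∈ J, HasDerivWithinAt (fun w => 4 * η * (w + F 0 t w))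
      (4 * η * (1 + F 1 t w)) J w := fun w hw =>
    ((hasDerivWithinAt_id w J).fun_add (h.sol.chain 0 t ht w hw)).const_mul (4 * η)
  have hco := fun w (hw : w ∈ J) => (hlin w hw).continuousWithinAt
  have hfx := h.f_ge ht hx
  have hfz := h.f_ge ht hz
  have hfz' := (h.f_le ht hz).trans h.ub
  have hfy' := (h.f_le ht hy).trans h.ub
  have hxy1 := hx.1
  have hxy2 := hy.2
  have hp := fun w (hw : w ∈ J) => h.p_pos t ht w hw
  have hcoef := fun w (hw : w ∈ J) => mul_le_mul_of_nonneg_right (h.coeff_le ht hw) hη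
  rcases le_total (π / 2) (TF F t z - 2 * arctan (1 / 10)) with hc | hc
  · left
    have hm : AntitoneOn (fun w => CC w (F 0 t w) - 4 * η * (w + F 0 t w)) (Icc x z) :=
      antitoneOn_of_hasDerivWithinAt_nonpos (convex_Icc _ _)
        (((h.continuousOn_CC ht).sub hco).mono hsub1)
        (fun w hw => ((h.hasDerivWithinAt_CC ht (hsub1 (interior_subset hw))).fun_sub
          (hlin w (hsub1 (interior_subset hw)))).mono (interior_subset.trans hsub1))
        (fun w hw => by
          have hw' := interior_subset hw
          have hwJ := hsub1 hw'
          have h1 := h.phase_mono ht hx hwJ hw'.1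
          have h2 := h.phase_mono ht hz hy hzy
          have h3 : cos (TF F t w - 2 * arctan (1 / 10)) ≤ η := by
            rcases le_total (π / 2) (TF F t w - 2 * arctan (1 / 10)) with hd | hd
            · exact (cos_nonpos_of_pi_div_two_le_of_le hd
                (by linarith [(h.phase_bounds ht hwJ).2, pi_pos])).trans hη
            · rw [← sin_pi_div_two_sub]
              exact (sin_le (by linarith)).trans (by linarith)
          have h4 := mul_le_mul_of_nonneg_left h3 (coeff_nonneg (F := F) (t := t) (x := w))
          linarith [hcoef w hwJ])
    have := hm ⟨le_rfl, hxz⟩ ⟨hxz, le_rfl⟩ hxz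
    simp only at this
    nlinarith
  · right
    have hm : MonotoneOn (fun w => CC w (F 0 t w) + 4 * η * (w + F 0 t w)) (Icc z y) :=
      monotoneOn_of_hasDerivWithinAt_nonneg (convex_Icc _ _)
        (((h.continuousOn_CC ht).add hco).mono hsub2)
        (fun w hw => ((h.hasDerivWithinAt_CC ht (hsub2 (interior_subset hw))).fun_add
          (hlin w (hsub2 (interior_subset hw)))).mono (interior_subset.trans hsub2))
        (fun w hw => by
          have hw' := interior_subset hw
          have hwJ := hsub2 hw'
          have h1 := h.phase_mono ht hwJ hy hw'.2
          have h2 := h.phase_mono ht hx hz hxz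
          have h3 : -η ≤ cos (TF F t w - 2 * arctan (1 / 10)) := by
            rcases le_total (TF F t w - 2 * arctan (1 / 10)) (π / 2) with hd | hd
            · have := cos_nonneg_of_mem_Icc
                ⟨by linarith [(h.phase_bounds ht hwJ).1, pi_pos], hd⟩
              linarith
            · have h5 := sin_le (x := TF F t w - 2 * arctan (1 / 10) - π / 2) (by linarith)
              rw [sin_sub_pi_div_two] at h5
              linarith
          have h4 := mul_le_mul_of_nonneg_left h3 (coeff_nonneg (F := F) (t := t) (x := w))
          linarith [hcoef w hwJ])
    have := hm ⟨le_rfl, hzy⟩ ⟨hzy, le_rfl⟩ hzy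
    simp only at this
    nlinarith

end IsFlow
end

end LBMCF

namespace LBMCF
open scoped Topology ContDiff

section
variable {e T : ℝ} {F : ℕ → ℝ → ℝ → ℝ}

theorem IsFlow.hasDerivAt_integral (h : IsFlow e T F) {x y t : ℝ} (hx : x ∈ J) (hy : y ∈ J)
    (hxy : x ≤ y) (ht : t ∈ Ioo 0 T) :
    HasDerivAt (fun t => ∫ w in x..y, F 0 t w) (∫ w in x..y, sg w * D 1 (TF F t) w) t := by
  have hsub : Icc x y ⊆ J := Icc_subset_Icc hx.1 hy.2
  have hIoc : ∀ {w}, w ∈ uIoc x y → w ∈ J := fun {w} hw => by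
    rw [uIoc_of_le hxy] at hw
    exact hsub (Ioc_subset_Icc_self hw)
  have hcF : ∀ s ∈ Icc 0 T, ContinuousOn (F 0 s) (uIcc x y) := fun s hs => by
    rw [uIcc_of_le hxy]
    exact (h.sol.sm 0 hs).continuousOn.mono hsub
  have hcD : ContinuousOn (fun z : ℝ × ℝ => sg z.2 * D 1 (TF F z.1) z.2) (Icc 0 T ×ˢ J) :=
    (((contDiff_sg (n := 0)).continuous.comp continuous_snd).continuousOn).mul
      (h.sol.continuousOn_D_cp h.pos 1 sm3_Hf)
  obtain ⟨M, hM⟩ := (isCompact_Icc.prod isCompact_Icc).exists_bound_of_continuousOn hcD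
  have hcD' : ContinuousOn (fun w => sg w * D 1 (TF F t) w) (uIcc x y) := by
    rw [uIcc_of_le hxy]
    exact (((contDiff_sg (n := 0)).continuous.continuousOn).mul
      ((h.sol.sm_TF (Ioo_subset_Icc_self ht)).continuousOn_D 1)).mono hsub
  refine (intervalIntegral.hasDerivAt_integral_of_dominated_loc_of_deriv_le (bound := fun _ => M)
    (F' := fun t w => sg w * D 1 (TF F t) w) (Ioo_mem_nhds ht.1 ht.2) ?_
    (hcF t (Ioo_subset_Icc_self ht)).intervalIntegrable
    (intervalIntegrable_iff.1 hcD'.intervalIntegrable).aestronglyMeasurable ?_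
    intervalIntegrable_const ?_).2
  · filter_upwards [Ioo_mem_nhds ht.1 ht.2] with s hs
    exact (intervalIntegrable_iff.1
      (hcF s (Ioo_subset_Icc_self hs)).intervalIntegrable).aestronglyMeasurable
  · exact .of_forall fun w hw s hs => hM (s, w) ⟨Ioo_subset_Icc_self hs, hIoc hw⟩
  · refine .of_forall fun w hw s hs => ?_
    have := h.sol.der 0 s (Ioo_subset_Icc_self hs) w (hIoc hw)
    rw [Uu_zero] at this
    exact this.hasDerivAt (Icc_mem_nhds hs.1 hs.2)

theorem IsFlow.integral_speed_ge (h : IsFlow e T F) {x y t : ℝ} (hx : 1 ≤ x) (hxy : x ≤ y)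
    (hy : y ≤ 101 / 100) (ht : t ∈ Icc 0 T) :
    (x - 1) * (101 / 100 - y) * (TF F t y - TF F t x) ≤
      ∫ w in x..y, sg w * D 1 (TF F t) w := by
  have hsub : uIcc x y ⊆ J := by
    rw [uIcc_of_le hxy]
    exact Icc_subset_Icc hx hy
  have hc := ((h.sol.sm_TF ht).continuousOn_D 1).mono hsub
  have hd : ∀ w ∈ J, HasDerivWithinAt (TF F t) (D 1 (TF F t) w) J w := fun w hw => by
    have := (h.sol.sm_TF ht).hasDerivWithinAt 0 hw
    rwa [show D 0 (TF F t) = TF F t from funext fun y => D_zero _ y] at this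
  rw [← intervalIntegral.integral_eq_sub_of_hasDerivAt_of_le hxy
    (fun w hw => ((hd w (Icc_subset_Icc hx hy hw)).continuousWithinAt).mono (Icc_subset_Icc hx hy))
    (fun w hw => (hd w ⟨by linarith [hw.1], by linarith [hw.2]⟩).hasDerivAt
      (Icc_mem_nhds (by linarith [hw.1]) (by linarith [hw.2]))) hc.intervalIntegrable,
    ← intervalIntegral.integral_const_mul]
  refine intervalIntegral.integral_mono_on hxy (hc.intervalIntegrable.const_mul _)
    (((contDiff_sg (n := 0)).continuous.continuousOn).mul hc).intervalIntegrable fun w hw => ?_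
  refine mul_le_mul_of_nonneg_right ?_ (h.g_nonneg ht (Icc_subset_Icc hx hy hw))
  exact mul_le_mul (by linarith [hw.1]) (by linarith [hw.2]) (by linarith) (by linarith [hw.1])

/-- The phase becomes almost constant on interior intervals along a sequence of times. -/
theorem exists_phase_osc_le (h : ∀ T > 0, IsFlow e T F) {x y η : ℝ} (hx : 1 < x) (hxy : x ≤ y)
    (hy : y < 101 / 100) (hη : 0 < η) : ∃ t, 0 ≤ t ∧ TF F t y - TF F t x ≤ η := by
  by_contra! hcon
  have hxJ : x ∈ J := ⟨hx.le, hxy.trans hy.le⟩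
  have hyJ : y ∈ J := ⟨hx.le.trans hxy, hy.le⟩
  have hs : 0 < (x - 1) * (101 / 100 - y) := mul_pos (by linarith) (by linarith)
  set c := (x - 1) * (101 / 100 - y) * η with hc
  have hcpos : 0 < c := mul_pos hs hη
  set S : ℝ := 1 + 2 / c with hS
  have hS1 : 1 ≤ S := by
    have : 0 < 2 / c := by positivity
    linarith
  have hF := h (S + 1) (by linarith)
  have hder : ∀ t ∈ Icc 1 S, HasDerivAt (fun t => (∫ w in x..y, F 0 t w) - c * t)
      ((∫ w in x..y, sg w * D 1 (TF F t) w) - c) t := fun t ht => by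
    have := (hF.hasDerivAt_integral hxJ hyJ hxy ⟨by linarith [ht.1], by linarith [ht.2]⟩).fun_sub
      ((hasDerivAt_id t).const_mul c)
    simpa using this
  have hm : MonotoneOn (fun t => (∫ w in x..y, F 0 t w) - c * t) (Icc 1 S) :=
    monotoneOn_of_hasDerivWithinAt_nonneg (convex_Icc _ _)
      (fun t ht => (hder t ht).continuousAt.continuousWithinAt)
      (fun t ht => (hder t (interior_subset ht)).hasDerivWithinAt) (fun t ht => by
        have ht' := interior_subset ht
        have h1 := hF.integral_speed_ge hx.le hxy hy.le
          (t := t) ⟨by linarith [ht'.1], by linarith [ht'.2]⟩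
        have h2 := mul_le_mul_of_nonneg_left (hcon t (by linarith [ht'.1])).le hs.le
        linarith)
  have h1 := hm ⟨le_rfl, hS1⟩ ⟨hS1, le_rfl⟩ hS1
  have hbd : ∀ t ∈ Icc 1 S, ∀ w ∈ Icc x y, F 0 t w ∈ Icc (0 : ℝ) 1 := fun t ht w hw =>
    hF.mem_Icc_one ⟨by linarith [ht.1], by linarith [ht.2]⟩ ⟨hx.le.trans hw.1, hw.2.trans hy.le⟩
  have hintg : ∀ t ∈ Icc 1 S, IntervalIntegrable (F 0 t) MeasureTheory.volume x y :=
    fun t ht => by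
      refine ContinuousOn.intervalIntegrable ?_
      rw [uIcc_of_le hxy]
      exact (hF.sol.sm 0 ⟨by linarith [ht.1], by linarith [ht.2]⟩).continuousOn.mono
        (Icc_subset_Icc hx.le hy.le)
  have h2 : 0 ≤ ∫ w in x..y, F 0 1 w :=
    intervalIntegral.integral_nonneg hxy fun w hw => (hbd 1 ⟨le_rfl, hS1⟩ w hw).1
  have h3 : ∫ w in x..y, F 0 S w ≤ ∫ w in x..y, (1 : ℝ) :=
    intervalIntegral.integral_mono_on hxy (hintg S ⟨hS1, le_rfl⟩) intervalIntegrable_const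
      fun w hw => (hbd S ⟨hS1, le_rfl⟩ w hw).2
  rw [intervalIntegral.integral_const, smul_eq_mul, mul_one] at h3
  have h4 : c * S = c + 2 := by rw [hS]; field_simp
  simp only [h4] at h1
  linarith

end

end LBMCF

namespace LBMCF
open scoped Topology ContDiff

section
variable {F : ℕ → ℝ → ℝ → ℝ}

theorem flow_mono {e : ℝ} (h : ∀ T > 0, IsFlow e T F) {x s t : ℝ} (hx : x ∈ J) (hs : 0 ≤ s)
    (hst : s ≤ t) : F 0 s x ≤ F 0 t x :=
  (h (t + 1) (by linarith)).monotoneOn_time hx ⟨hs, by linarith⟩ ⟨by linarith, by linarith⟩ hst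

theorem exists_finf_sub_lt (h : ∀ T > 0, IsFlow (finf (101 / 100)) T F) {z ε : ℝ}
    (hz : z ∈ Ioo (1 : ℝ) (101 / 100)) (hε : 0 < ε) : ∃ t, 0 ≤ t ∧ finf z - ε < F 0 t z := by
  by_contra! hcon
  have hF : ∀ t, 0 ≤ t → IsFlow (finf (101 / 100)) (t + 1) F ∧ t ∈ Icc 0 (t + 1) := fun t ht =>
    ⟨h (t + 1) (by linarith), ht, by linarith⟩
  have hzJ : z ∈ J := Ioo_subset_Icc_self hz
  have hz0 : 0 < z := (J_bounds hzJ).2.2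
  obtain ⟨hF0, h00⟩ := hF 0 le_rfl
  have hinit : z / 10 ≤ F 0 0 z := by
    rw [hF0.f_init hzJ]
    nlinarith [hz.1, hz.2, hF0.lb, mul_nonneg (sub_nonneg.2 hz.1.le) (sub_nonneg.2 hz.2.le)]
  have hzε : z / 10 ≤ finf z - ε := hinit.trans (hcon 0 le_rfl)
  have hgap : 10201 / 10000 < CC z (finf z - ε) := by
    rw [← CC_finf hz.1.le, (CC_strictAntiOn hz0).lt_iff_gt (finf_ge hz.1.le) hzε]
    linarith
  set κ := CC z (finf z - ε) - 10201 / 10000 with hκ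
  have hκ0 : 0 < κ := by linarith
  have hle : ∀ t, 0 ≤ t → 10201 / 10000 + κ ≤ CC z (F 0 t z) := fun t ht => by
    rw [hκ, add_sub_cancel, (CC_strictAntiOn hz0).le_iff_ge hzε
      (hinit.trans (flow_mono h hzJ le_rfl ht))]
    exact hcon t ht
  obtain ⟨x, hx, hxκ⟩ : ∃ x ∈ Ioo 1 z, 40 * ((x - 1) + (finf x - 1 / 10)) < κ / 3 := by
    have hc : Tendsto (fun x => 40 * ((x - 1) + (finf x - 1 / 10))) (𝓝[>] (1 : ℝ))
        (𝓝 (40 * ((1 - 1) + (finf 1 - 1 / 10)))) := by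
      have h1 : Tendsto finf (𝓝[>] (1 : ℝ)) (𝓝 (finf 1)) :=
        (continuousOn_finf 1 one_mem_J).mono_left
          (nhdsWithin_le_of_mem (Icc_mem_nhdsGT (by norm_num)))
      have h2 : Tendsto (fun x : ℝ => x) (𝓝[>] (1 : ℝ)) (𝓝 1) := nhdsWithin_le_nhds
      exact ((h2.sub_const 1).add (h1.sub_const _)).const_mul _
    rw [finf_one] at hc
    have := (hc.eventually_lt_const (u := κ / 3) (by norm_num; linarith)).and
      (Ioo_mem_nhdsGT hz.1)
    obtain ⟨x, hx1, hx2⟩ := this.exists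
    exact ⟨x, hx2, hx1⟩
  obtain ⟨y, hy, hyκ⟩ : ∃ y ∈ Ioo z (101 / 100),
      40 * ((101 / 100 - y) + (finf (101 / 100) - F 0 0 y)) < κ / 3 := by
    have hc : Tendsto (fun y => 40 * ((101 / 100 - y) + (finf (101 / 100) - F 0 0 y)))
        (𝓝[<] (101 / 100 : ℝ))
        (𝓝 (40 * ((101 / 100 - 101 / 100) + (finf (101 / 100) - F 0 0 (101 / 100))))) := by
      have h1 : Tendsto (F 0 0) (𝓝[<] (101 / 100 : ℝ)) (𝓝 (F 0 0 (101 / 100))) :=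
        ((hF0.sol.sm 0 h00).continuousOn _ end_mem_J).mono_left
          (nhdsWithin_le_of_mem (Icc_mem_nhdsLT (by norm_num)))
      have h2 : Tendsto (fun x : ℝ => x) (𝓝[<] (101 / 100 : ℝ)) (𝓝 (101 / 100)) :=
        nhdsWithin_le_nhds
      exact ((h2.const_sub _).add (h1.const_sub _)).const_mul _
    rw [hF0.f_end h00] at hc
    have := (hc.eventually_lt_const (u := κ / 3) (by norm_num; linarith)).and
      (Ioo_mem_nhdsLT hz.2)
    obtain ⟨y, hy1, hy2⟩ := this.exists
    exact ⟨y, hy2, hy1⟩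
  obtain ⟨t, ht0, ht⟩ := exists_phase_osc_le h (η := κ / 16) hx.1 (hx.2.trans hy.1).le hy.2
    (by linarith)
  obtain ⟨hFt, htm⟩ := hF t ht0
  have hxJ : x ∈ J := ⟨hx.1.le, (hx.2.trans hz.2).le⟩
  have hyJ : y ∈ J := ⟨(hz.1.trans hy.1).le, hy.2.le⟩
  have hzt := hle t ht0
  have htwo : ∀ w ∈ J, w ∈ Icc (0 : ℝ) 2 := fun w hw => ⟨by linarith [hw.1], by linarith [hw.2]⟩
  rcases hFt.CC_le_or htm hxJ hyJ hx.2.le hy.1.le (by linarith) ht with hc | hc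
  · have h1 := (abs_sub_le_iff.1 (CC_lipschitz (htwo x hxJ) (hFt.mem_Icc_one htm hxJ)
      (htwo 1 one_mem_J) (hFt.mem_Icc_one htm one_mem_J))).1
    rw [hFt.f_one htm, ← finf_one, CC_finf le_rfl, finf_one, abs_of_nonneg (by linarith [hx.1]),
      abs_of_nonneg (by linarith [hFt.f_ge htm hxJ])] at h1
    have h2 := hFt.f_le_finf htm hxJ
    linarith
  · have h1 := (abs_sub_le_iff.1 (CC_lipschitz (htwo y hyJ) (hFt.mem_Icc_one htm hyJ)
      (htwo _ end_mem_J) (hFt.mem_Icc_one htm end_mem_J))).1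
    rw [hFt.f_end htm, CC_finf (by norm_num), abs_of_nonpos (by linarith [hy.2]),
      abs_of_nonpos (by linarith [hFt.f_le htm hyJ])] at h1
    have h2 := flow_mono h hyJ le_rfl ht0
    linarith

theorem tendsto_finf (h : ∀ T > 0, IsFlow (finf (101 / 100)) T F) {z : ℝ} (hz : z ∈ J) :
    Tendsto (fun t => F 0 (max t 0) z) atTop (𝓝 (finf z)) := by
  have hF : ∀ t : ℝ, IsFlow (finf (101 / 100)) (max t 0 + 1) F ∧
      max t 0 ∈ Icc 0 (max t 0 + 1) := fun t =>
    ⟨h _ (by linarith [le_max_right t 0]), le_max_right t 0, by linarith⟩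
  rcases hz.1.eq_or_lt with h1 | h1
  · subst h1
    rw [finf_one]
    exact tendsto_const_nhds.congr fun t => ((hF t).1.f_one (hF t).2).symm
  rcases hz.2.eq_or_lt with h2 | h2
  · subst h2
    exact tendsto_const_nhds.congr fun t => ((hF t).1.f_end (hF t).2).symm
  refine Metric.tendsto_atTop.2 fun ε hε => ?_
  obtain ⟨t₀, h0, ht₀⟩ := exists_finf_sub_lt h ⟨h1, h2⟩ hε
  refine ⟨t₀, fun t ht => ?_⟩
  have h3 := flow_mono h hz h0 (ht.trans (le_max_left t 0))
  have h4 := (hF t).1.f_le_finf (hF t).2 hz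
  rw [Real.dist_eq, abs_lt]
  constructor <;> linarith

theorem tendstoUniformlyOn_finf (h : ∀ T > 0, IsFlow (finf (101 / 100)) T F) :
    TendstoUniformlyOn (fun t x => F 0 t x) finf atTop J := by
  have := Monotone.tendstoUniformlyOn_of_forall_tendsto (F := fun t x => F 0 (max t 0) x)
    (s := J) isCompact_Icc
    (fun t => (((h (max t 0 + 1) (by linarith [le_max_right t 0])).sol.sm 0
      ⟨le_max_right t 0, by linarith⟩).continuousOn))
    (fun x hx s t hst => flow_mono h hx (le_max_right s 0) (max_le_max_right 0 hst))
    continuousOn_finf (fun x hx => tendsto_finf h hx)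
  refine this.congr ?_
  filter_upwards [eventually_ge_atTop 0] with t ht x _
  simp only [max_eq_left ht]

theorem exists_slope_gt (h : ∀ T > 0, IsFlow (finf (101 / 100)) T F) (M : ℝ) :
    ∃ t₀, 0 ≤ t₀ ∧ ∀ t ≥ t₀, ∃ x ∈ Ioo (1 : ℝ) (101 / 100), M < F 1 t x := by
  have hev := (tendsto_deriv_finf.eventually_gt_atTop M)
  rw [eventually_nhdsWithin_iff, Metric.eventually_nhds_iff] at hev
  obtain ⟨δ, hδ, hev⟩ := hev
  set x : ℝ := 1 + min (δ / 2) (1 / 200) with hx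
  have hx0 : 0 < min (δ / 2) (1 / 200) := lt_min (by linarith) (by norm_num)
  have hx1 : 1 < x := by linarith
  have hx2 : x < 101 / 100 := by linarith [min_le_right (δ / 2) (1 / 200)]
  have hx3 : x < 1 + δ := by linarith [min_le_left (δ / 2) (1 / 200)]
  obtain ⟨c, hc, hcs⟩ := exists_deriv_eq_slope finf hx1
    (continuousOn_finf.mono (Icc_subset_Icc_right hx2.le)) (fun y hy =>
      ((contDiffAt_finf hy.1).differentiableAt (by simp)).differentiableWithinAt)
  have hMc := hev (y := c) (by
    rw [Real.dist_eq, abs_of_pos (by linarith [hc.1])]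
    linarith [hc.2]) hc.1
  rw [hcs, lt_div_iff₀ (by linarith)] at hMc
  obtain ⟨t₀, h0, ht₀⟩ := exists_finf_sub_lt h ⟨hx1, hx2⟩ (sub_pos.2 hMc)
  refine ⟨t₀, h0, fun t ht => ?_⟩
  have ht0 : 0 ≤ t := h0.trans ht
  have hF := h (t + 1) (by linarith)
  have htm : t ∈ Icc 0 (t + 1) := ⟨ht0, by linarith⟩
  have hxJ : x ∈ J := ⟨hx1.le, hx2.le⟩
  obtain ⟨ξ, hξ, hs⟩ := exists_hasDerivAt_eq_slope (F 0 t) (F 1 t) hx1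
    ((hF.sol.sm 0 htm).continuousOn.mono (Icc_subset_Icc_right hx2.le)) (fun y hy =>
      (hF.sol.chain 0 t htm y ⟨hy.1.le, (hy.2.trans hx2).le⟩).hasDerivAt
        (Icc_mem_nhds hy.1 (hy.2.trans hx2)))
  refine ⟨ξ, ⟨hξ.1, hξ.2.trans hx2⟩, ?_⟩
  rw [hs, lt_div_iff₀ (by linarith), hF.f_one htm]
  have := flow_mono h hxJ h0 ht
  rw [finf_one] at ht₀
  linarith

end

end LBMCF

namespace LBMCF
open scoped Topology ContDiff

section
variable {F : ℕ → ℝ → ℝ → ℝ}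

theorem IsSol.derivWithin_eq {P0 : Polynomial ℝ} {T : ℝ} (h : IsSol P0 T F) (j : ℕ) {t x : ℝ}
    (ht : t ∈ Icc 0 T) (hx : x ∈ J) : derivWithin (F j t) J x = F (j + 1) t x :=
  (h.chain j t ht x hx).derivWithin (uniqueDiffOn_J x hx)

theorem IsSol.flowRHS_eq {P0 : Polynomial ℝ} {T : ℝ} (h : IsSol P0 T F) {t x : ℝ}
    (ht : t ∈ Icc 0 T) (hx : x ∈ J) :
    flowRHS 3 (101 / 100) sg (F 0) t x = Uu (TF F t) 0 x := by
  rw [Uu_zero, h.D1_TF ht hx, gE, flowRHS,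
    derivWithin_congr (fun y hy => h.derivWithin_eq 0 ht hy) (h.derivWithin_eq 0 ht hx),
    h.derivWithin_eq 0 ht hx, h.derivWithin_eq 1 ht hx]
  norm_num

theorem derivWithin_time_eq {e : ℝ} (h : ∀ T > 0, IsFlow e T F) {t x : ℝ} (ht : 0 ≤ t)
    (hx : x ∈ J) :
    derivWithin (fun s => F 0 s x) (Ici 0) t = flowRHS 3 (101 / 100) sg (F 0) t x := by
  have hF := h (t + 1) (by linarith)
  have htm : t ∈ Icc 0 (t + 1) := ⟨ht, by linarith⟩
  rw [hF.sol.flowRHS_eq htm hx]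
  refine ((hF.sol.der 0 t htm x hx).mono_of_mem_nhdsWithin ?_).derivWithin
    (uniqueDiffOn_Ici 0 t ht)
  filter_upwards [self_mem_nhdsWithin, nhdsWithin_le_nhds (Iio_mem_nhds (lt_add_one t))]
    with s hs hs' using ⟨hs, le_of_lt hs'⟩

theorem init_supercritical {e : ℝ} (h : ∀ T > 0, IsFlow e T F) {x : ℝ} (hx : x ∈ J) :
    (3 - 1) * arctan (F 0 0 x / x) + arctan (derivWithin (F 0 0) J x) > (3 - 2) * π / 2 := by
  have hF := h 1 one_pos
  have := hF.phase_gt hF.zero_mem hx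
  rw [TF_apply, ← div_eq_inv_mul] at this
  rw [hF.sol.derivWithin_eq 0 hF.zero_mem hx]
  norm_num
  linarith

end

theorem tendsto_derivWithin_finf :
    Tendsto (fun x => derivWithin finf (Ioc 1 (101 / 100)) x) (𝓝[>] 1) atTop := by
  refine tendsto_deriv_finf.congr' ?_
  filter_upwards [Ioo_mem_nhdsGT (show (1 : ℝ) < 101 / 100 by norm_num)] with x hx
  exact (derivWithin_of_mem_nhds (Ioc_mem_nhds hx.1 hx.2)).symm

end LBMCF

/-- **Infinite-time singularity** (Theorem 1.3, reduced Calabi-symmetry form).  There exist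
data `n ≥ 3`, `a > 1`, `σ`, `q > 0`, `p`, supercritical initial data `f₀`, a smooth eternal
solution `f` of the reduced flow, and a limit `f_∞` continuous on `[1,a]`, smooth on `(1,a]`,
with `f_∞(1) = q` and `f_∞' → +∞` at `1⁺`, such that `f(t,·) → f_∞` uniformly as `t → ∞`;
consequently `sup ∂ₓ f(t,·) → ∞`, i.e. the flow becomes singular at `x = 1` at infinite time. -/
theorem infinite_time_singularity :
    ∃ (n : ℕ) (a p q : ℝ) (σ f₀ finf : ℝ → ℝ) (f : ℝ → ℝ → ℝ),
      3 ≤ n ∧ 1 < a ∧ 0 < q ∧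
      ContDiffOn ℝ (⊤ : ℕ∞) σ (Icc 1 a) ∧ (∀ x ∈ Ioo 1 a, 0 < σ x) ∧ σ 1 = 0 ∧ σ a = 0 ∧
      ContDiffOn ℝ (⊤ : ℕ∞) f₀ (Icc 1 a) ∧ f₀ 1 = q ∧ f₀ a = p ∧
      (∀ x ∈ Icc 1 a,
        ((n : ℝ) - 1) * arctan (f₀ x / x) + arctan (derivWithin f₀ (Icc 1 a) x) >
          ((n : ℝ) - 2) * π / 2) ∧
      ContDiffOn ℝ (⊤ : ℕ∞) (fun pt : ℝ × ℝ => f pt.1 pt.2) (Ici 0 ×ˢ Icc 1 a) ∧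
      (∀ x ∈ Icc 1 a, f 0 x = f₀ x) ∧
      (∀ t ∈ Ici (0 : ℝ), ∀ x ∈ Icc 1 a,
        derivWithin (fun s => f s x) (Ici 0) t = flowRHS n a σ f t x) ∧
      ContinuousOn finf (Icc 1 a) ∧ ContDiffOn ℝ (⊤ : ℕ∞) finf (Ioc 1 a) ∧ finf 1 = q ∧
      Tendsto (fun x => derivWithin finf (Ioc 1 a) x) (nhdsWithin 1 (Ioi 1)) atTop ∧
      TendstoUniformlyOn (fun t x => f t x) finf atTop (Icc 1 a) ∧
      (∀ M : ℝ, ∃ t₀ : ℝ, ∀ t ≥ t₀, ∃ x ∈ Ioc 1 a, M < derivWithin (f t) (Icc 1 a) x) := by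
  obtain ⟨F, hF⟩ := LBMCF.exists_flow LBMCF.finf_end_bounds.1 LBMCF.finf_end_bounds.2
  have h1 := hF 1 one_pos
  refine ⟨3, 101 / 100, LBMCF.finf (101 / 100), 1 / 10, LBMCF.sg, F 0 0, LBMCF.finf, F 0,
    le_rfl, by norm_num, by norm_num, LBMCF.contDiff_sg.contDiffOn, fun x hx => mul_pos (by linarith [hx.1])
      (by linarith [hx.2]), LBMCF.sg_one, LBMCF.sg_b, h1.sol.sm 0 h1.zero_mem, h1.f_one h1.zero_mem,
    h1.f_end h1.zero_mem, fun x hx => by exact_mod_cast LBMCF.init_supercritical hF hx,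
    LBMCF.IsSol.contDiffOn_Ici (fun T hT => (hF T hT).sol) 0, fun _ _ => rfl,
    fun t ht x hx => LBMCF.derivWithin_time_eq hF ht hx, LBMCF.continuousOn_finf,
    fun x hx => (LBMCF.contDiffAt_finf hx.1).contDiffWithinAt, LBMCF.finf_one,
    LBMCF.tendsto_derivWithin_finf,
    LBMCF.tendstoUniformlyOn_finf hF, fun M => ?_⟩
  obtain ⟨t₀, h0, ht₀⟩ := LBMCF.exists_slope_gt hF M
  refine ⟨t₀, fun t ht => ?_⟩
  obtain ⟨x, hx, hM⟩ := ht₀ t ht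
  refine ⟨x, Ioo_subset_Ioc_self hx, ?_⟩
  rwa [(hF (t + 1) (by linarith)).sol.derivWithin_eq 0 ⟨by linarith, by linarith⟩
    (Ioo_subset_Icc_self hx)]
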